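/- Let T be a universal theory in a first-order language L that is κ-unique for some uncountable cardinal κ. Then the theory T_∞ of the infinite models of T is superstable; concretely, for every cardinal λ with λ ≥ 2^(max(|L|,ℵ₀)), every infinite model M of T, and every subset A ⊆ M of cardinality at most λ, the set of complete 1-types over A — i.e., maximal sets of L-formulas in one free variable with parameters from A that are finitely satisfiable in (M, a)_{a ∈ A} — has cardinality at most λ. -/

import Mathlib

open FirstOrder Language Cardinal

universe u

/-- `X` generates the `L`-structure `M`: the substructure generated by `X` is all of `M`. -/
def Generates (L : FirstOrder.Language.{u, u}) (M : Type u) [L.Structure M] (X : Set M) : Prop :=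
  Substructure.closure L X = ⊤

/-- `M` is `μ`-generated: it is generated by a set of cardinality `μ`. -/
def IsGenerated (L : FirstOrder.Language.{u, u}) (M : Type u) [L.Structure M]
    (μ : Cardinal.{u}) : Prop :=
  ∃ X : Set M, #X = μ ∧ Generates L M X

/-- `M` is strictly `μ`-generated: it is `μ`-generated but not `ν`-generated for any `ν < μ`. -/
def StrictlyGenerated (L : FirstOrder.Language.{u, u}) (M : Type u) [L.Structure M]
    (μ : Cardinal.{u}) : Prop :=
  IsGenerated L M μ ∧ ∀ ν < μ, ¬ IsGenerated L M ν

/-- A theory `T` is `κ`-unique: it has a strictly `κ`-generated model, and any two strictly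
`κ`-generated models of `T` are isomorphic. -/
def KUnique {L : FirstOrder.Language.{u, u}} (T : L.Theory) (κ : Cardinal.{u}) : Prop :=
  (∃ (M : Type u) (_ : L.Structure M), M ⊨ T ∧ StrictlyGenerated L M κ) ∧
  (∀ (M N : Type u) (_ : L.Structure M) (_ : L.Structure N),
    M ⊨ T → N ⊨ T → StrictlyGenerated L M κ → StrictlyGenerated L N κ →
      Nonempty (M ≃[L] N))

/-- A sentence is universal if it is of the form `∀ x₁ … ∀ xₙ, φ` with `φ` quantifier-free. -/
def IsUniversalSentence {L : FirstOrder.Language.{u, u}} (φ : L.Sentence) : Prop :=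
  ∃ (n : ℕ) (ψ : L.BoundedFormula Empty n), ψ.IsQF ∧ φ = ψ.alls

/-- A theory is universal if every sentence of it is universal. -/
def IsUniversalTheory {L : FirstOrder.Language.{u, u}} (T : L.Theory) : Prop :=
  ∀ φ ∈ T, IsUniversalSentence φ


/-- A set `p` of `L`-formulas in one free variable with parameters from `A` is finitely
satisfiable in `(M, a)_{a ∈ A}` if every finite subset of `p` is simultaneously realized
by some element of `M`. -/
def FinitelySatisfiableOver {L : FirstOrder.Language.{u, u}} {M : Type u} [L.Structure M]
    (A : Set M) (p : Set (L.Formula (↥A ⊕ Fin 1))) : Prop :=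
  ∀ s : Finset (L.Formula (↥A ⊕ Fin 1)), ↑s ⊆ p →
    ∃ x : M, ∀ φ ∈ s, Formula.Realize φ (Sum.elim (fun a => (a : M)) fun _ => x)

/-- A complete 1-type over `A` in `M`: a maximal set of `L`-formulas in one free variable with
parameters from `A` that is finitely satisfiable in `(M, a)_{a ∈ A}`. -/
def IsCompleteTypeOver {L : FirstOrder.Language.{u, u}} {M : Type u} [L.Structure M]
    (A : Set M) (p : Set (L.Formula (↥A ⊕ Fin 1))) : Prop :=
  FinitelySatisfiableOver A p ∧
    ∀ q : Set (L.Formula (↥A ⊕ Fin 1)), FinitelySatisfiableOver A q → p ⊆ q → q = p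

universe v

section Saturation

variable {L : FirstOrder.Language.{u, u}}

/-- Existential closure of a formula over a possibly infinite set of variables. -/
theorem exists_formula_realize_iff_exists {α W : Type*} (φ : L.Formula (α ⊕ W)) :
    ∃ φ' : L.Formula α, ∀ (M : Type u) [L.Structure M] [Nonempty M] (v : α → M),
      φ'.Realize v ↔ ∃ w : W → M, φ.Realize (Sum.elim v w) := by
  classical
  let W' := {w : W // Sum.inr w ∈ φ.freeVarFinset}
  have : Finite W' :=
    Finite.of_injective (fun w : W' => (⟨Sum.inr w.1, w.2⟩ : φ.freeVarFinset)) fun a b h =>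
      Subtype.ext (Sum.inr.inj (congrArg Subtype.val h))
  let f : φ.freeVarFinset → α ⊕ W' := fun x =>
    match x with
    | ⟨Sum.inl a, _⟩ => Sum.inl a
    | ⟨Sum.inr w, hw⟩ => Sum.inr ⟨w, hw⟩
  let ψ : L.Formula (α ⊕ W') := φ.restrictFreeVar f
  refine ⟨ψ.iExs W', fun M _ _ v => ?_⟩
  rw [Formula.realize_iExs]
  have key : ∀ (w' : W' → M) (w : W → M), (∀ x : W', w' x = w x.1) →
      (ψ.Realize (Sum.elim v w') ↔ φ.Realize (Sum.elim v w)) := by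
    intro w' w h
    apply BoundedFormula.realize_restrictFreeVar
    rintro ⟨a | a, ha⟩
    · rfl
    · exact h ⟨a, ha⟩
  constructor
  · rintro ⟨w', hw'⟩
    refine ⟨fun w => if h : Sum.inr w ∈ φ.freeVarFinset then w' ⟨w, h⟩ else
      Classical.arbitrary M, (key w' _ fun x => ?_).1 hw'⟩
    simp [x.2]
  · rintro ⟨w, hw⟩
    exact ⟨fun x => w x.1, (key _ w fun _ => rfl).2 hw⟩

/-- The ultraproduct of a family of structures. -/
def UProd {I : Type v} (U : Ultrafilter I) (M : I → Type u) : Type (max v u) :=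
  (U : Filter I).Product M

namespace UProd

variable {I : Type v} (U : Ultrafilter I) {M : I → Type u}

/-- The class of a family in the ultraproduct. -/
def mk (x : ∀ i, M i) : UProd U M :=
  @Quotient.mk' _ ((U : Filter I).productSetoid M) x

theorem mk_eq_mk {x y : ∀ i, M i} : mk U x = mk U y ↔ ∀ᶠ i in U, x i = y i :=
  @Quotient.eq'' _ ((U : Filter I).productSetoid M) x y

variable [∀ i, L.Structure (M i)]

instance instStructure : L.Structure (UProd U M) :=
  inferInstanceAs (L.Structure ((U : Filter I).Product M))

theorem funMap_mk {n : ℕ} (F : L.Functions n) (x : Fin n → ∀ i, M i) :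
    Structure.funMap F (fun l => mk U (x l)) = mk U fun i => Structure.funMap F fun l => x l i :=
  Ultraproduct.funMap_cast F x

theorem realize_mk [∀ i, Nonempty (M i)] {β : Type*} (φ : L.Formula β) (x : β → ∀ i, M i) :
    φ.Realize (fun b => mk U (x b)) ↔ ∀ᶠ i in U, φ.Realize fun b => x b i :=
  Ultraproduct.realize_formula_cast φ x

end UProd

/-- The diagonal embedding of a structure into an ultrapower. -/
noncomputable def diagEmb {I : Type v} (U : Ultrafilter I) (M : Type u) [L.Structure M]
    [Nonempty M] : M ↪ₑ[L] UProd U (fun _ => M) where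
  toFun x := UProd.mk U fun _ => x
  map_formula' n φ x := by
    refine Iff.trans (UProd.realize_mk U φ (fun b _ => x b)) ?_
    simp

/-- `p` is a finitely satisfiable set of formulas in `M`, where the variables on the left are
interpreted by `v`. -/
def FinSat {α V : Type*} {M : Type u} [L.Structure M] (v : α → M)
    (p : Set (L.Formula (α ⊕ V))) : Prop :=
  ∀ s : Finset (L.Formula (α ⊕ V)), ↑s ⊆ p →
    ∃ w : V → M, ∀ φ ∈ s, φ.Realize (Sum.elim v w)

theorem FinSat.exists_formula {α V : Type*} (s : Finset (L.Formula (α ⊕ V))) :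
    ∃ ψ : L.Formula α, ∀ (M : Type u) [L.Structure M] [Nonempty M] (v : α → M),
      ψ.Realize v ↔ ∃ w : V → M, ∀ φ ∈ s, φ.Realize (Sum.elim v w) := by
  obtain ⟨ψ, hψ⟩ := exists_formula_realize_iff_exists
    (Formula.iInf fun φ : s => (φ : L.Formula (α ⊕ V)))
  refine ⟨ψ, fun M _ _ v => ?_⟩
  rw [hψ]
  simp

theorem finSat_comp_iff {α V : Type*} {M N : Type u} [L.Structure M] [L.Structure N] [Nonempty M]
    (f : M ↪ₑ[L] N) (v : α → M) (p : Set (L.Formula (α ⊕ V))) :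
    FinSat (f ∘ v) p ↔ FinSat v p := by
  have : Nonempty N := Nonempty.map f inferInstance
  refine forall_congr' fun s => imp_congr_right fun _ => ?_
  obtain ⟨ψ, hψ⟩ := FinSat.exists_formula s
  rw [← hψ, ← hψ]
  exact f.map_formula ψ v

theorem exists_elementary_realizing (M : Type u) [L.Structure M] [Nonempty M] (V : Type u) :
    ∃ (N : Type u) (_ : L.Structure N) (f : M ↪ₑ[L] N), ∀ p : Set (L.Formula (M ⊕ V)),
      FinSat id p → ∃ w : V → N, ∀ φ ∈ p, φ.Realize (Sum.elim f w) := by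
  classical
  let I := Finset (L.Formula (M ⊕ V))
  let U : Ultrafilter I := Ultrafilter.of Filter.atTop
  refine ⟨UProd U (fun _ => M), inferInstance, diagEmb U M, fun p hp => ?_⟩
  have h : ∀ s : I, ∃ w : V → M, ∀ φ ∈ s, φ ∈ p → φ.Realize (Sum.elim id w) := by
    intro s
    obtain ⟨w, hw⟩ := hp (s.filter (· ∈ p)) fun φ h => (Finset.mem_filter.1 h).2
    exact ⟨w, fun φ h1 h2 => hw φ (by simp [h1, h2])⟩
  choose w hw using h
  refine ⟨fun v => UProd.mk U fun s => w s v, fun φ hφ => ?_⟩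
  have e : (Sum.elim (diagEmb (L := L) U M) (fun v => UProd.mk U fun s => w s v) :
      M ⊕ V → UProd U (fun _ => M)) =
      fun i => UProd.mk U (Sum.elim (fun x _ => x) (fun v s => w s v) i) := by
    funext i; cases i <;> rfl
  rw [e, UProd.realize_mk]
  have hU : ∀ᶠ s in (U : Filter I), {φ} ≤ s :=
    (Ultrafilter.of_le _) (Filter.eventually_ge_atTop _)
  filter_upwards [hU] with s hs
  have := hw s φ (hs (Finset.mem_singleton_self φ)) hφ
  convert this using 1
  funext i; cases i <;> rfl

theorem exists_elementary_realizing' (M : Type u) [L.Structure M] [Nonempty M] (V : Type u) :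
    ∃ (N : Type u) (_ : L.Structure N) (f : M ↪ₑ[L] N), ∀ (α : Type u) (v : α → M)
      (p : Set (L.Formula (α ⊕ V))),
      FinSat v p → ∃ w : V → N, ∀ φ ∈ p, φ.Realize (Sum.elim (f ∘ v) w) := by
  classical
  obtain ⟨N, _, f, h⟩ := exists_elementary_realizing (L := L) M V
  refine ⟨N, inferInstance, f, fun α v p hp => ?_⟩
  have aux : ∀ (K : Type u) [L.Structure K] (g : M → K) (w : V → K) (φ : L.Formula (α ⊕ V)),
      Formula.Realize (Formula.relabel (Sum.map v id) φ) (Sum.elim g w) ↔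
        φ.Realize (Sum.elim (g ∘ v) w) := by
    intro K _ g w φ
    rw [Formula.realize_relabel]
    simp [Sum.elim_comp_map]
  obtain ⟨w, hw⟩ := h (Formula.relabel (Sum.map v id) '' p) (by
    intro s hs
    obtain ⟨t, ht, rfl⟩ := Finset.subset_set_image_iff.1 hs
    obtain ⟨w, hw⟩ := hp t ht
    refine ⟨w, fun φ hφ => ?_⟩
    obtain ⟨ψ, hψ, rfl⟩ := Finset.mem_image.1 hφ
    exact (aux M id w ψ).2 (hw ψ hψ))
  exact ⟨w, fun φ hφ => (aux N f w φ).1 (hw _ ⟨φ, hφ, rfl⟩)⟩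

/-- Every finitely satisfiable set of formulas over `A` in variables `V` is realized by elements
of `B`. -/
def RealizesOver (L : FirstOrder.Language.{u, u}) {N : Type u} [L.Structure N] (A B : Set N)
    (V : Type u) : Prop :=
  ∀ p : Set (L.Formula (A ⊕ V)), FinSat ((↑) : A → N) p →
    ∃ w : V → N, (∀ i, w i ∈ B) ∧ ∀ φ ∈ p, φ.Realize (Sum.elim (↑) w)

theorem RealizesOver.exists_realize {N : Type u} [L.Structure N] [Nonempty N] {A B : Set N}
    {V : Type u} (h : RealizesOver L A B V) {α W : Type*} (ι : W ↪ V) (v : α → N)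
    (hv : ∀ a, v a ∈ A) (p : Set (L.Formula (α ⊕ W))) (hp : FinSat v p) :
    ∃ w : W → N, (∀ i, w i ∈ B) ∧ ∀ φ ∈ p, φ.Realize (Sum.elim v w) := by
  classical
  let v' : α → A := fun a => ⟨v a, hv a⟩
  have aux : ∀ (w : V → N) (φ : L.Formula (α ⊕ W)),
      Formula.Realize (Formula.relabel (Sum.map v' ι) φ) (Sum.elim (↑) w) ↔
        φ.Realize (Sum.elim v (w ∘ ι)) := by
    intro w φ
    rw [Formula.realize_relabel, Sum.elim_comp_map]
    rfl
  obtain ⟨w, hwB, hw⟩ := h (Formula.relabel (Sum.map v' ι) '' p) (by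
    intro s hs
    obtain ⟨t, ht, rfl⟩ := Finset.subset_set_image_iff.1 hs
    obtain ⟨w, hw⟩ := hp t ht
    refine ⟨Function.extend ι w fun _ => Classical.arbitrary N, fun φ hφ => ?_⟩
    obtain ⟨ψ, hψ, rfl⟩ := Finset.mem_image.1 hφ
    rw [aux, Function.extend_comp ι.injective]
    exact hw ψ hψ)
  exact ⟨w ∘ ι, fun i => hwB _, fun φ hφ => (aux w φ).1 (hw _ ⟨φ, hφ, rfl⟩)⟩

theorem exists_realizesOver_range (M : Type u) [L.Structure M] [Nonempty M] (V : Type u) :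
    ∃ (N : Type u) (_ : L.Structure N) (f : M ↪ₑ[L] N),
      RealizesOver L (Set.range f) Set.univ V := by
  obtain ⟨N, _, f, h⟩ := exists_elementary_realizing' (L := L) M V
  refine ⟨N, inferInstance, f, fun p hp => ?_⟩
  have hv : ∀ x : Set.range f, ∃ y, f y = x := fun x => x.2
  choose v hv using hv
  have e : ((↑) : Set.range f → N) = f ∘ v := by funext x; exact (hv x).symm
  rw [e, finSat_comp_iff] at hp
  obtain ⟨w, hw⟩ := h _ v p hp
  exact ⟨w, fun _ => Set.mem_univ _, fun φ hφ => e ▸ hw φ hφ⟩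

/-- A bundled nonempty structure. -/
structure NStr (L : FirstOrder.Language.{u, u}) where
  /-- The carrier. -/
  carrier : Type u
  [str : L.Structure carrier]
  [nonempty : Nonempty carrier]

attribute [instance] NStr.str NStr.nonempty

section Chain

variable (M : ℕ → NStr L) (e : ∀ n, (M n).carrier ↪ₑ[L] (M (n + 1)).carrier)

/-- The composite embeddings in a chain. -/
def chainEmb {n m : ℕ} (h : n ≤ m) : (M n).carrier ↪ₑ[L] (M m).carrier :=
  Nat.leRecOn (C := fun k => (M n).carrier ↪ₑ[L] (M k).carrier) h (fun {k} g => (e k).comp g)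
    (ElementaryEmbedding.refl L _)

theorem chainEmb_succ {n m : ℕ} (h : n ≤ m) (x : (M n).carrier) :
    chainEmb M e (h.trans m.le_succ) x = e m (chainEmb M e h x) := by
  unfold chainEmb
  rw [Nat.leRecOn_succ h]
  rfl

theorem chainEmb_succ_left {n m : ℕ} (h : n + 1 ≤ m) (x : (M n).carrier) :
    chainEmb M e h (e n x) = chainEmb M e (n.le_succ.trans h) x := by
  induction m, h using Nat.le_induction with
  | base =>
    rw [chainEmb_succ M e le_rfl]
    unfold chainEmb
    rw [Nat.leRecOn_self, Nat.leRecOn_self]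
    rfl
  | succ m h ih =>
    rw [chainEmb_succ M e h, ih, chainEmb_succ]

/-- The embeddings of a chain of structures in their ultraproduct. -/
noncomputable def chainToUProd (U : Ultrafilter ℕ) (hU : (U : Filter ℕ) ≤ Filter.atTop) (n : ℕ) :
    (M n).carrier ↪ₑ[L] UProd U (fun m => (M m).carrier) where
  toFun x := UProd.mk U fun m => if h : n ≤ m then chainEmb M e h x else Classical.arbitrary _
  map_formula' k φ x := by
    refine Iff.trans (UProd.realize_mk U φ _) ?_
    have : ∀ᶠ m in (U : Filter ℕ), n ≤ m := hU (Filter.eventually_ge_atTop n)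
    rw [← Filter.eventually_const (f := (U : Filter ℕ)) (p := φ.Realize x)]
    refine Filter.eventually_congr (this.mono fun m hm => ?_)
    simp only [hm, dite_true]
    exact (chainEmb M e hm).map_formula φ x

theorem chainToUProd_succ (U : Ultrafilter ℕ) (hU : (U : Filter ℕ) ≤ Filter.atTop) (n : ℕ)
    (x : (M n).carrier) :
    chainToUProd M e U hU (n + 1) (e n x) = chainToUProd M e U hU n x := by
  refine (UProd.mk_eq_mk U).2 ?_
  have : ∀ᶠ m in (U : Filter ℕ), n + 1 ≤ m := hU (Filter.eventually_ge_atTop (n + 1))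
  refine this.mono fun m hm => ?_
  have hm' : n ≤ m := n.le_succ.trans hm
  simp only [hm, hm', dite_true]
  exact chainEmb_succ_left M e hm x

end Chain

/-- The range of an elementary embedding, as an elementary substructure. -/
def elementaryRange {M N : Type u} [L.Structure M] [L.Structure N] (f : M ↪ₑ[L] N) :
    L.ElementarySubstructure N where
  toSubstructure := f.toHom.range
  isElementary' := by
    intro n φ x
    have hx : ∀ i, ∃ y, f y = x i := fun i => (x i).2
    choose y hy using hx
    have e1 : ((↑) : _ → N) ∘ x = f ∘ y := by funext i; exact (hy i).symm
    let g : M ≃[L] f.toHom.range := f.toEmbedding.equivRange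
    have e2 : x = g ∘ y := by
      funext i
      apply Subtype.ext
      exact (hy i).symm
    rw [e1, e2, f.map_formula]
    exact (g.toElementaryEmbedding.map_formula φ y).symm

theorem exists_chain (M : Type u) [L.Structure M] [Nonempty M] (V : Type u) :
    ∃ (N : Type u) (_ : L.Structure N) (f : M ↪ₑ[L] N) (S : ℕ → L.ElementarySubstructure N),
      (∀ n, ∀ x ∈ S n, x ∈ S (n + 1)) ∧ (∀ x, f x ∈ S 0) ∧
      ∀ n, RealizesOver L (S n : Set N) (S (n + 1)) V := by
  have hstep : ∀ K : NStr L, ∃ (K' : NStr L) (e : K.carrier ↪ₑ[L] K'.carrier), ∀ (α : Type u)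
      (v : α → K.carrier) (p : Set (L.Formula (α ⊕ V))),
      FinSat v p → ∃ w : V → K'.carrier, ∀ φ ∈ p, φ.Realize (Sum.elim (e ∘ v) w) := by
    intro K
    obtain ⟨N, _, f, h⟩ := exists_elementary_realizing' (L := L) K.carrier V
    have : Nonempty N := Nonempty.map f inferInstance
    exact ⟨⟨N⟩, f, h⟩
  choose next e he using hstep
  obtain ⟨C, ⟨e0⟩, e, he⟩ : ∃ C : ℕ → NStr L, Nonempty (M ↪ₑ[L] (C 0).carrier) ∧
      ∃ e : ∀ n, (C n).carrier ↪ₑ[L] (C (n + 1)).carrier, ∀ (n : ℕ) (α : Type u)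
        (v : α → (C n).carrier) (p : Set (L.Formula (α ⊕ V))),
        FinSat v p → ∃ w : V → (C (n + 1)).carrier, ∀ φ ∈ p, φ.Realize (Sum.elim (e n ∘ v) w) :=
    ⟨fun n => Nat.rec ⟨M⟩ (fun _ K => next K) n, ⟨ElementaryEmbedding.refl L M⟩,
      fun n => e _, fun n => he _⟩
  let U : Ultrafilter ℕ := Ultrafilter.of Filter.atTop
  have hU : (U : Filter ℕ) ≤ Filter.atTop := Ultrafilter.of_le _
  let N : Type u := UProd U fun m => (C m).carrier
  let _ : L.Structure N := UProd.instStructure (L := L) U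
  let ι : ∀ n, (C n).carrier ↪ₑ[L] N := chainToUProd C e U hU
  let S : ℕ → L.ElementarySubstructure N := fun n => elementaryRange (ι n)
  refine ⟨N, inferInstance, (ι 0).comp e0, S, ?_, fun x => ⟨e0 x, rfl⟩, ?_⟩
  · rintro n x ⟨y, rfl⟩
    exact ⟨e n y, chainToUProd_succ C e U hU n y⟩
  · intro n p hp
    let v : ↥(S n : Set N) → N := Subtype.val
    have hv : ∀ a, v a ∈ S n := fun a => a.2
    change FinSat v p at hp
    have hv' : ∀ a, ∃ y, ι n y = v a := hv
    choose y hy using hv'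
    have e1 : v = ι n ∘ y := by funext a; exact (hy a).symm
    rw [e1, finSat_comp_iff] at hp
    obtain ⟨w, hw⟩ := he n _ y p hp
    refine ⟨fun i => ι (n + 1) (w i), fun i => ⟨w i, rfl⟩, fun φ hφ => ?_⟩
    have key := ((ι (n + 1)).map_formula φ _).2 (hw φ hφ)
    convert key using 1
    funext i
    rcases i with a | i
    · exact (hy a).symm.trans (chainToUProd_succ C e U hU n (y a)).symm
    · rfl

end Saturation

section IteratedUltrafilters

variable {S : Type*} {I' I : Type*} [DecidableEq I'] [DecidableEq I]

/-- The iterated ultrafilter along a list of coordinates; the head of the list is the outermost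
quantifier. -/
def iterList (D : Ultrafilter S) (ω₀ : I → S) : List I → Ultrafilter (I → S)
  | [] => pure ω₀
  | i :: l => D.bind fun x => (iterList D ω₀ l).map fun ω => Function.update ω i x

theorem eventually_iterList_nil (D : Ultrafilter S) (ω₀ : I → S) (P : (I → S) → Prop) :
    (∀ᶠ ω in iterList D ω₀ [], P ω) ↔ P ω₀ := Iff.rfl

theorem eventually_iterList_cons (D : Ultrafilter S) (ω₀ : I → S) (i : I) (l : List I)
    (P : (I → S) → Prop) :
    (∀ᶠ ω in iterList D ω₀ (i :: l), P ω) ↔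
      ∀ᶠ x in D, ∀ᶠ ω in iterList D ω₀ l, P (Function.update ω i x) := Iff.rfl

theorem dependsOn_update {P : (I → S) → Prop} {s : Set I} {i : I} (x : S)
    (hP : DependsOn P (insert i s)) : DependsOn (fun ω => P (Function.update ω i x)) s := by
  intro ω ω' h
  refine hP fun j hj => ?_
  by_cases hji : j = i
  · subst hji; simp
  · simpa [hji] using h j (by simpa [hji] using hj)

theorem eventually_iterList_filter (D : Ultrafilter S) (ω₀ : I → S) (s : Finset I) (l : List I)
    (P : (I → S) → Prop) (hP : DependsOn P (s : Set I)) :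
    (∀ᶠ ω in iterList D ω₀ l, P ω) ↔ ∀ᶠ ω in iterList D ω₀ (l.filter (· ∈ s)), P ω := by
  induction l generalizing P s with
  | nil => rfl
  | cons i l ih =>
    rw [eventually_iterList_cons]
    by_cases hi : i ∈ s
    · rw [List.filter_cons_of_pos (by simpa using hi), eventually_iterList_cons]
      refine Filter.eventually_congr (Filter.Eventually.of_forall fun x => ?_)
      refine ih s _ ?_
      exact (dependsOn_update x (hP.mono (by simp)))
    · rw [List.filter_cons_of_neg (by simpa using hi), ← ih s P hP]
      have : ∀ x ω, P (Function.update ω i x) ↔ P ω := fun x ω =>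
        iff_of_eq (hP fun j hj => by
          rw [Function.update_of_ne]
          rintro rfl
          exact hi hj)
      simp [this]

theorem eventually_iterList_map (D : Ultrafilter S) (ω₀ : I → S) (ω₁ : I' → S) (σ : I → I')
    (l : List I) (hl : l.Nodup) (hσ : Set.InjOn σ {i | i ∈ l})
    (P : (I → S) → Prop) (hP : DependsOn P {i | i ∈ l}) :
    (∀ᶠ ω in iterList D ω₁ (l.map σ), P (ω ∘ σ)) ↔ ∀ᶠ ω in iterList D ω₀ l, P ω := by
  induction l generalizing P with
  | nil =>
    rw [List.map_nil, eventually_iterList_nil, eventually_iterList_nil]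
    exact iff_of_eq (hP fun i hi => by simp at hi)
  | cons i l ih =>
    rw [List.map_cons, eventually_iterList_cons, eventually_iterList_cons]
    refine Filter.eventually_congr (Filter.Eventually.of_forall fun x => ?_)
    have hs : {j | j ∈ i :: l} = insert i {j | j ∈ l} := by ext j; simp
    rw [hs] at hP hσ
    rw [← ih (List.nodup_cons.1 hl).2 (hσ.mono (Set.subset_insert _ _)) _
      (dependsOn_update x hP)]
    refine Filter.eventually_congr (Filter.Eventually.of_forall fun ω => ?_)
    refine iff_of_eq (hP fun j hj => ?_)
    by_cases hji : j = i
    · subst hji; simp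
    · have : σ j ≠ σ i := fun h => hji (hσ hj (Set.mem_insert _ _) h)
      simp [hji, this]

theorem eventually_iterList_concat (D : Ultrafilter S) (ω₀ : I → S) (i : I)
    (l : List I) (hi : i ∉ l) (P : (I → S) → Prop) (hP : DependsOn P (insert i {j | j ∈ l})) :
    (∀ᶠ ω in iterList D ω₀ (l ++ [i]), P ω) ↔
      ∀ᶠ ω in iterList D ω₀ l, ∀ᶠ x in D, P (Function.update ω i x) := by
  induction l generalizing P with
  | nil => rfl
  | cons j l ih =>
    rw [List.cons_append, eventually_iterList_cons, eventually_iterList_cons]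
    refine Filter.eventually_congr (Filter.Eventually.of_forall fun x => ?_)
    have hij : i ≠ j := fun h => hi (by simp [h])
    have hs : insert i {k | k ∈ j :: l} = insert j (insert i {k | k ∈ l}) := by
      ext k; simp only [List.mem_cons, Set.mem_insert_iff, Set.mem_ofPred_eq]; tauto
    rw [hs] at hP
    rw [ih (fun h => hi (by simp [h])) _ (dependsOn_update x hP)]
    refine Filter.eventually_congr (Filter.Eventually.of_forall fun ω => ?_)
    refine Filter.eventually_congr (Filter.Eventually.of_forall fun y => ?_)
    rw [Function.update_comm hij.symm]

end IteratedUltrafilters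

section IterU

variable {S : Type*} [Nonempty S] {I' I : Type*} [LinearOrder I'] [LinearOrder I]

/-- The iterated ultrafilter along a linear order; larger coordinates are quantified first. -/
noncomputable def iterU (D : Ultrafilter S) (I : Type*) [LinearOrder I] : Ultrafilter (I → S) :=
  (Ultrafilter.of (Filter.atTop : Filter (Finset I))).bind fun t =>
    iterList D (fun _ => Classical.arbitrary S) (t.sort (· ≥ ·))

theorem eventually_iterU (D : Ultrafilter S) (s : Finset I) (P : (I → S) → Prop)
    (hP : DependsOn P (s : Set I)) :
    (∀ᶠ ω in iterU D I, P ω) ↔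
      ∀ᶠ ω in iterList D (fun _ => Classical.arbitrary S) (s.sort (· ≥ ·)), P ω := by
  have h1 : (∀ᶠ ω in iterU D I, P ω) ↔ ∀ᶠ t in (Ultrafilter.of
      (Filter.atTop : Filter (Finset I)) : Filter (Finset I)),
        ∀ᶠ ω in iterList D (fun _ => Classical.arbitrary S) (Finset.sort t (· ≥ ·)), P ω := Iff.rfl
  have h2 : ∀ᶠ t in (Ultrafilter.of
      (Filter.atTop : Filter (Finset I)) : Filter (Finset I)), s ≤ t :=
    (Ultrafilter.of_le _) (Filter.eventually_ge_atTop s)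
  rw [h1, ← Filter.eventually_const (f := (Ultrafilter.of (Filter.atTop : Filter (Finset I)) :
    Filter (Finset I))) (p := ∀ᶠ ω in iterList D _ (s.sort (· ≥ ·)), P ω)]
  refine Filter.eventually_congr (h2.mono fun t ht => ?_)
  rw [eventually_iterList_filter D _ s _ P hP]
  have : (t.sort (· ≥ ·)).filter (· ∈ s) = s.sort (· ≥ ·) := by
    have h3 : ((t.sort (· ≥ ·)).filter (· ∈ s)).Nodup := (t.sort_nodup _).filter _
    rw [← (List.toFinset_sort (r := (· ≥ ·)) h3).2 ((t.pairwise_sort _).filter _)]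
    congr 1
    ext i
    simp only [List.mem_toFinset, List.mem_filter, Finset.mem_sort, decide_eq_true_eq]
    exact ⟨fun h => h.2, fun h => ⟨ht h, h⟩⟩
  rw [this]

theorem DependsOn.comp_right {S I I' β : Type*} [DecidableEq I'] {P : (I → S) → β} {s : Finset I}
    (hP : DependsOn P (s : Set I)) (σ : I → I') :
    DependsOn (fun ω : I' → S => P (ω ∘ σ)) (s.image σ : Set I') := by
  intro ω ω' h
  exact hP fun i hi => h _ (by simpa using ⟨i, hi, rfl⟩)

theorem eventually_iterU_comp (D : Ultrafilter S) (s : Finset I) (P : (I → S) → Prop)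
    (hP : DependsOn P (s : Set I)) (σ : I → I') (hσ : StrictMonoOn σ s) :
    (∀ᶠ ω in iterU D I', P (ω ∘ σ)) ↔ ∀ᶠ ω in iterU D I, P ω := by
  rw [eventually_iterU D _ _ (hP.comp_right σ), eventually_iterU D _ _ hP]
  have hs : {i | i ∈ s.sort (· ≥ ·)} = (s : Set I) := by ext; simp
  rw [← eventually_iterList_map D (fun _ => Classical.arbitrary S)
    (fun _ => Classical.arbitrary S) σ (s.sort (· ≥ ·)) (s.sort_nodup _) (hs ▸ hσ.injOn) P
    (hs ▸ hP)]
  have hmap : (s.image σ).sort (· ≥ ·) = (s.sort (· ≥ ·)).map σ := by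
    have hnd : ((s.sort (· ≥ ·)).map σ).Nodup :=
      (s.sort_nodup _).map_on fun x hx y hy h =>
        hσ.injOn (by simpa using hx) (by simpa using hy) h
    have hpw : ((s.sort (· ≥ ·)).map σ).Pairwise (· ≥ ·) := by
      rw [List.pairwise_map]
      refine (s.pairwise_sort (· ≥ ·)).imp_of_mem fun {a b} ha hb hab => ?_
      exact hσ.monotoneOn (by simpa using hb) (by simpa using ha) hab
    rw [← (List.toFinset_sort (r := (· ≥ ·)) hnd).2 hpw]
    congr 1
    ext i
    simp
  rw [hmap]

theorem eventually_iterU_bot (D : Ultrafilter S) (s : Finset I) (i : I) (hi : ∀ j ∈ s, i < j)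
    (P : (I → S) → Prop) (hP : DependsOn P (insert i (s : Set I))) :
    (∀ᶠ ω in iterU D I, P ω) ↔
      ∀ᶠ ω in iterU D I, ∀ᶠ x in D, P (Function.update ω i x) := by
  have his : i ∉ s := fun h => lt_irrefl i (hi i h)
  have hP' : DependsOn P ((insert i s : Finset I) : Set I) := by simpa using hP
  have hQ : DependsOn (fun ω => ∀ᶠ x in D, P (Function.update ω i x)) (s : Set I) := by
    intro ω ω' h
    refine propext (Filter.eventually_congr (Filter.Eventually.of_forall fun x => ?_))
    exact iff_of_eq (dependsOn_update x hP h)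
  rw [eventually_iterU D _ _ hP', eventually_iterU D _ _ hQ]
  have hsort : (insert i s).sort (· ≥ ·) = s.sort (· ≥ ·) ++ [i] := by
    have hnd : (s.sort (· ≥ ·) ++ [i]).Nodup := by
      rw [List.nodup_append]
      refine ⟨s.sort_nodup _, by simp, ?_⟩
      intro a ha b hb
      simp only [List.mem_singleton] at hb
      subst hb
      rintro rfl
      exact his (by simpa using ha)
    have hpw : (s.sort (· ≥ ·) ++ [i]).Pairwise (· ≥ ·) := by
      rw [List.pairwise_append]
      refine ⟨s.pairwise_sort _, by simp, ?_⟩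
      intro a ha b hb
      simp only [List.mem_singleton] at hb
      subst hb
      exact (hi a (by simpa using ha)).le
    rw [← (List.toFinset_sort (r := (· ≥ ·)) hnd).2 hpw]
    congr 1
    ext j
    simp
  have hs : {i | i ∈ s.sort (· ≥ ·)} = (s : Set I) := by ext; simp
  rw [hsort]
  exact eventually_iterList_concat D _ i _ (by simpa using his) P (by rwa [hs])

theorem eventually_iterU_ne (D : Ultrafilter S) (hD : ∀ x, ∀ᶠ y in (D : Filter S), y ≠ x) (i j : I)
    (hij : i ≠ j) : ∀ᶠ ω in (iterU D I : Filter (I → S)), ω i ≠ ω j := by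
  wlog h : i < j generalizing i j
  · exact (this j i hij.symm (lt_of_le_of_ne (not_lt.1 h) hij.symm)).mono fun ω h => h.symm
  have hP : DependsOn (fun ω : I → S => ω i ≠ ω j) (({i, j} : Finset I) : Set I) := by
    intro ω ω' h
    simp only [h i (by simp), h j (by simp)]
  rw [eventually_iterU_bot D {j} i (by simpa using h) _ (by simpa using hP)]
  refine Filter.Eventually.of_forall fun ω => ?_
  refine (hD (ω j)).mono fun x hx => ?_
  simpa [hij.symm] using hx

end IterU

section IterUSum

variable {S : Type*} [Nonempty S] {I' I : Type*} [LinearOrder I'] [LinearOrder I]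

theorem eventually_iterU_single (D : Ultrafilter S) (i : I) (Q : S → Prop) :
    (∀ᶠ ω in (iterU D I : Filter (I → S)), Q (ω i)) ↔ ∀ᶠ x in D, Q x := by
  rw [eventually_iterU_bot D ∅ i (by simp) _ (fun ω ω' h => by simp [h i (by simp)])]
  simp

theorem eventually_iterU_sumLex (D : Ultrafilter S) (s : Finset I) (t : Finset I')
    (P : (I ⊕ₗ I' → S) → Prop)
    (hP : DependsOn P ((fun i => toLex (Sum.inl i)) '' (s : Set I) ∪
      (fun i => toLex (Sum.inr i)) '' (t : Set I'))) :
    (∀ᶠ ω in iterU D (I ⊕ₗ I'), P ω) ↔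
      ∀ᶠ ω' in iterU D I', ∀ᶠ ω in iterU D I, P (fun i => Sum.elim ω ω' (ofLex i)) := by
  induction s using Finset.induction_on_min generalizing P with
  | empty =>
    have x0 : S := Classical.arbitrary S
    let P' : (I' → S) → Prop := fun ω' => P fun i => Sum.elim (fun _ => x0) ω' (ofLex i)
    have hP' : DependsOn P' (t : Set I') := by
      intro ω ω' h
      refine hP ?_
      rintro _ (⟨i, hi, rfl⟩ | ⟨i, hi, rfl⟩)
      · rfl
      · exact h i hi
    have h1 : ∀ ω, P ω ↔ P' (ω ∘ fun i => toLex (Sum.inr i)) := by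
      intro ω
      refine iff_of_eq (hP ?_)
      rintro _ (⟨i, hi, rfl⟩ | ⟨i, hi, rfl⟩)
      · simp at hi
      · rfl
    simp only [h1]
    rw [eventually_iterU_comp D t P' hP' _ (fun a _ b _ hab => Sum.Lex.inr_lt_inr_iff.2 hab)]
    refine Filter.eventually_congr (Filter.Eventually.of_forall fun ω' => ?_)
    exact Filter.eventually_const.symm
  | insert i s hi ih =>
    have hset : (fun i => toLex (Sum.inl i)) '' ((insert i s : Finset I) : Set I) ∪
      (fun i => toLex (Sum.inr i)) '' (t : Set I') = insert (toLex (Sum.inl i))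
      ((fun i => toLex (Sum.inl i)) '' (s : Set I) ∪
      (fun i => toLex (Sum.inr i)) '' (t : Set I')) := by
      rw [Finset.coe_insert, Set.image_insert_eq, Set.insert_union]
    rw [hset] at hP
    rw [eventually_iterU_bot D (s.image (fun i => toLex (Sum.inl i)) ∪
      t.image (fun i => toLex (Sum.inr i))) (toLex (Sum.inl i)) ?_ P (by push_cast; exact hP)]
    · rw [ih]
      · refine Filter.eventually_congr (Filter.Eventually.of_forall fun ω' => ?_)
        refine Iff.trans ?_ (eventually_iterU_bot D s i hi
          (fun ω => P fun j => Sum.elim ω ω' (ofLex j)) ?_).symm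
        · refine Filter.eventually_congr (Filter.Eventually.of_forall fun ω => ?_)
          refine Filter.eventually_congr (Filter.Eventually.of_forall fun x => ?_)
          refine iff_of_eq (congrArg P ?_)
          funext j
          rcases j with j | j
          · by_cases h : j = i
            · subst h
              exact (Function.update_self _ _ _).trans (Function.update_self j x ω).symm
            · exact (Function.update_of_ne (fun h' => h (Sum.inl.inj h')) _ _).trans
                (show ω j = Function.update ω i x j from
                  (Function.update_of_ne h x ω).symm)
          · exact Function.update_of_ne (fun h' => Sum.inr_ne_inl h') _ _
        · intro ω₁ ω₂ h
          refine hP ?_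
          rintro _ (rfl | ⟨i, hi, rfl⟩ | ⟨i, hi, rfl⟩)
          · exact h i (by simp)
          · exact h _ (by simp [show i ∈ s from hi])
          · rfl
      · intro ω₁ ω₂ h
        refine propext (Filter.eventually_congr (Filter.Eventually.of_forall fun x => ?_))
        exact iff_of_eq (dependsOn_update x hP h)
    · intro j hj
      simp only [Finset.mem_union, Finset.mem_image] at hj
      rcases hj with ⟨k, hk, rfl⟩ | ⟨k, hk, rfl⟩
      · exact Sum.Lex.inl_lt_inl_iff.2 (hi k hk)
      · exact Sum.Lex.inl_lt_inr _ _

end IterUSum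

section FormulaSupport

variable {L : FirstOrder.Language.{u, u}}

open Classical in
/-- The finite set of free variables of a formula. -/
noncomputable def fsupp {α : Type*} (φ : L.Formula α) : Finset α := φ.freeVarFinset

theorem realize_congr_fsupp {α : Type*} {M : Type*} [L.Structure M] (φ : L.Formula α)
    {v w : α → M} (h : ∀ a ∈ fsupp φ, v a = w a) : φ.Realize v ↔ φ.Realize w := by
  classical
  have h1 := BoundedFormula.realize_restrictFreeVar (φ := φ) (f := id)
    (v := fun a => v a) (v' := v) (xs := default) (fun a => rfl)
  have h2 := BoundedFormula.realize_restrictFreeVar (φ := φ) (f := id)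
    (v := fun a => v a) (v' := w) (xs := default)
    (fun a => h a (by unfold fsupp; convert a.2))
  exact h1.symm.trans h2

end FormulaSupport

section Morley

variable {L : FirstOrder.Language.{u, u}} {N N' : Type u} [L.Structure N] [L.Structure N']
  {α : Type u} {I J : Type} [LinearOrder I] [LinearOrder J]

/-- The set of coordinates of the sequence variables occurring in a formula. -/
noncomputable def seqSupp (ψ : L.Formula (α ⊕ (I × ℕ))) : Finset I :=
  (fsupp ψ).toRight.image Prod.fst

theorem dependsOn_realize (v : α → N) (ψ : L.Formula (α ⊕ (I × ℕ))) :
    DependsOn (fun ω : I → ℕ → α => ψ.Realize (Sum.elim v fun p => v (ω p.1 p.2)))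
      (seqSupp ψ : Set I) := by
  intro ω ω' h
  refine propext (realize_congr_fsupp ψ ?_)
  rintro (a | ⟨i, l⟩) ha
  · rfl
  · have : i ∈ seqSupp ψ := Finset.mem_image.2 ⟨(i, l), by simpa using ha, rfl⟩
    simp [h i (by exact_mod_cast this)]

/-- The sequence `e` is a coheir sequence over the parameters `v'`, generated by the
ultrafilter `D`. -/
def IsMor (L : FirstOrder.Language.{u, u}) {N N' : Type u} [L.Structure N] [L.Structure N']
    {α : Type u} [Nonempty α] {I : Type} [LinearOrder I] (v : α → N) (v' : α → N')
    (D : Ultrafilter (ℕ → α)) (e : I → ℕ → N') : Prop :=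
  ∀ ψ : L.Formula (α ⊕ (I × ℕ)), ψ.Realize (Sum.elim v' fun p => e p.1 p.2) ↔
    ∀ᶠ ω in (iterU D I : Filter (I → ℕ → α)), ψ.Realize (Sum.elim v fun p => v (ω p.1 p.2))

variable [Nonempty α] {v : α → N} {v' : α → N'} {D : Ultrafilter (ℕ → α)} {e : I → ℕ → N'}

theorem IsMor.realize_comp (he : IsMor L v v' D e) (ψ : L.Formula (α ⊕ (J × ℕ))) (σ : J → I)
    (hσ : StrictMonoOn σ (seqSupp ψ)) :
    ψ.Realize (Sum.elim v' fun p => e (σ p.1) p.2) ↔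
      ∀ᶠ ω in (iterU D J : Filter (J → ℕ → α)), ψ.Realize (Sum.elim v fun p => v (ω p.1 p.2)) := by
  have h1 := he (Formula.relabel (Sum.map id (Prod.map σ id)) ψ)
  simp only [Formula.realize_relabel, Sum.elim_comp_map, Function.comp_id] at h1
  refine h1.trans ?_
  exact eventually_iterU_comp D (seqSupp ψ) _ (dependsOn_realize v ψ) σ hσ

theorem IsMor.realize_comp_iff (he : IsMor L v v' D e) (ψ : L.Formula (α ⊕ (J × ℕ))) (σ τ : J → I)
    (hσ : StrictMonoOn σ (seqSupp ψ)) (hτ : StrictMonoOn τ (seqSupp ψ)) :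
    ψ.Realize (Sum.elim v' fun p => e (σ p.1) p.2) ↔
      ψ.Realize (Sum.elim v' fun p => e (τ p.1) p.2) :=
  (he.realize_comp ψ σ hσ).trans (he.realize_comp ψ τ hτ).symm

theorem IsMor.eq_iff (he : IsMor L v v' D e) (i j : I) (l l' : ℕ) :
    e i l = e i l' ↔ e j l = e j l' := by
  let ψ : L.Formula (α ⊕ (Unit × ℕ)) :=
    Term.equal (Term.var (Sum.inr ((), l))) (Term.var (Sum.inr ((), l')))
  have := he.realize_comp_iff ψ (fun _ => i) (fun _ => j)
    (Set.subsingleton_of_subsingleton.strictMonoOn _)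
    (Set.subsingleton_of_subsingleton.strictMonoOn _)
  simpa [ψ, Formula.realize_equal] using this

theorem IsMor.finite_range (he : IsMor L v v' D e) (i j : I) (h : (Set.range (e i)).Finite) :
    (Set.range (e j)).Finite := by
  have : Set.range (e j) ⊆ (fun x => e j (Function.invFun (e i) x)) '' Set.range (e i) := by
    rintro _ ⟨l, rfl⟩
    refine ⟨e i l, ⟨l, rfl⟩, ?_⟩
    rw [he.eq_iff j i]
    exact Function.invFun_eq ⟨l, rfl⟩
  exact (h.image _).subset this

theorem IsMor.pair_iff (he : IsMor L v v' D e) {i j i' j' : I} (h : i < j) (h' : i' < j')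
    (ψ : L.Formula (α ⊕ (Bool × ℕ))) :
    ψ.Realize (Sum.elim v' fun p => e (cond p.1 j i) p.2) ↔
      ψ.Realize (Sum.elim v' fun p => e (cond p.1 j' i') p.2) := by
  have : ∀ {i j : I}, i < j → StrictMono (fun b : Bool => cond b j i) := by
    intro i j h a b hab
    cases a <;> cases b <;> first | exact absurd hab (by decide) | exact h
  exact he.realize_comp_iff ψ (fun b => cond b j i) (fun b => cond b j' i')
    ((this h).strictMonoOn _) ((this h').strictMonoOn _)

/-- Extending a coheir sequence by elements of an ultrapower realizing the coheir in the
opposite direction. -/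
theorem IsMor.ultrapower [Nonempty N] {e : ℕ → ℕ → N} (he : IsMor L v v D e) :
    IsMor L v (fun x => diagEmb (L := L) (iterU D ℕᵒᵈ) N (v x)) D
      (fun i : ℕ ⊕ₗ ℕᵒᵈ => Sum.elim (fun n l => diagEmb (L := L) (iterU D ℕᵒᵈ) N (e n l))
        (fun n l => UProd.mk (iterU D ℕᵒᵈ) fun ω => v (ω n l)) (ofLex i)) := by
  classical
  intro ψ
  have h1 : (Sum.elim (fun x => diagEmb (L := L) (iterU D ℕᵒᵈ) N (v x))
      (fun p : (ℕ ⊕ₗ ℕᵒᵈ) × ℕ => Sum.elim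
        (fun n l => diagEmb (L := L) (iterU D ℕᵒᵈ) N (e n l))
        (fun n l => UProd.mk (iterU D ℕᵒᵈ) fun ω => v (ω n l)) (ofLex p.1) p.2)) =
      fun x => UProd.mk (iterU D ℕᵒᵈ) (fun ω => Sum.elim v
        (fun p : (ℕ ⊕ₗ ℕᵒᵈ) × ℕ => Sum.elim (fun n l => e n l) (fun n l => v (ω n l))
          (ofLex p.1) p.2) x) := by
    funext x
    rcases x with x | ⟨n | n, l⟩ <;> rfl
  rw [h1, UProd.realize_mk]
  rw [eventually_iterU_sumLex D
    ((seqSupp ψ).preimage (fun i => toLex (Sum.inl i)) (fun a _ b _ h => Sum.inl.inj h))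
    ((seqSupp ψ).preimage (fun i => toLex (Sum.inr i)) (fun a _ b _ h => Sum.inr.inj h))]
  · refine Filter.eventually_congr (Filter.Eventually.of_forall fun ω' => ?_)
    have h2 := he (Formula.relabel (fun x => match x with
      | Sum.inl a => Sum.inl a
      | Sum.inr (i, l) => Sum.elim (fun n => Sum.inr (n, l)) (fun n => Sum.inl (ω' n l))
          (ofLex i)) ψ)
    simp only [Formula.realize_relabel] at h2
    refine Iff.trans (iff_of_eq (congrArg _ ?_)) (h2.trans (Filter.eventually_congr
      (Filter.Eventually.of_forall fun ω => iff_of_eq (congrArg _ ?_))))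
    · funext x
      rcases x with x | ⟨n | n, l⟩ <;> rfl
    · funext x
      rcases x with x | ⟨n | n, l⟩ <;> rfl
  · refine (dependsOn_realize v ψ).mono ?_
    intro i hi
    rcases i with i | i
    · exact Or.inl ⟨i, Finset.mem_coe.2 (Finset.mem_preimage.2 hi), rfl⟩
    · exact Or.inr ⟨i, Finset.mem_coe.2 (Finset.mem_preimage.2 hi), rfl⟩

/-- Existence of coheir sequences. -/
theorem exists_isMor [Nonempty N] {A B : Set N} {V : Type u} (hreal : RealizesOver L A B V)
    (hAB : A ⊆ B) (ι : ℕ × ℕ ↪ V) (v : α → N) (hv : ∀ a, v a ∈ A)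
    (hTV : ∀ (ψ : L.Formula (α ⊕ ℕ)) (w : ℕ → N), ψ.Realize (Sum.elim v w) →
      ∃ y : ℕ → α, ψ.Realize (Sum.elim v (v ∘ y))) (d : ℕ → N) (hd : ∀ l, d l ∈ A) :
    ∃ (D : Ultrafilter (ℕ → α)) (e : ℕ → ℕ → N), e 0 = d ∧ (∀ i l, e i l ∈ B) ∧
      IsMor L v v D e := by
  classical
  obtain ⟨D, hD⟩ : ∃ D : Ultrafilter (ℕ → α), ∀ ψ : L.Formula (α ⊕ ℕ),
      ψ.Realize (Sum.elim v d) → ∀ᶠ y in (D : Filter (ℕ → α)), ψ.Realize (Sum.elim v (v ∘ y)) := by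
    obtain ⟨D, hD⟩ := Ultrafilter.exists_ultrafilter_of_finite_inter_nonempty
      ((fun ψ : L.Formula (α ⊕ ℕ) => {y : ℕ → α | ψ.Realize (Sum.elim v (v ∘ y))}) ''
        {ψ | ψ.Realize (Sum.elim v d)}) (by
      intro T hT
      obtain ⟨t, ht, rfl⟩ := Finset.subset_set_image_iff.1 hT
      obtain ⟨y, hy⟩ := hTV (Formula.iInf fun φ : t => (φ : L.Formula (α ⊕ ℕ))) d (by
        simp only [Formula.realize_iInf]
        exact fun φ => ht φ.2)
      refine ⟨y, ?_⟩
      simp only [Formula.realize_iInf] at hy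
      simp only [Finset.coe_image, Set.sInter_image, Set.mem_iInter]
      intro ψ hψ
      exact hy ⟨ψ, hψ⟩)
    exact ⟨D, fun ψ hψ => hD ⟨ψ, hψ, rfl⟩⟩
  let g : α ⊕ (ℕ × ℕ) → (α ⊕ ℕ) ⊕ (ℕ × ℕ) := fun x => match x with
    | Sum.inl a => Sum.inl (Sum.inl a)
    | Sum.inr (0, l) => Sum.inl (Sum.inr l)
    | Sum.inr (n + 1, l) => Sum.inr (n + 1, l)
  let P : L.Formula (α ⊕ (ℕ × ℕ)) → Prop := fun ψ =>
    ∀ᶠ ω in (iterU D ℕ : Filter (ℕ → ℕ → α)), ψ.Realize (Sum.elim v fun p => v (ω p.1 p.2))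
  let e' : (ℕ × ℕ → N) → ℕ → ℕ → N := fun w n l => if n = 0 then d l else w (n, l)
  have hg : ∀ (w : ℕ × ℕ → N) (ψ : L.Formula (α ⊕ (ℕ × ℕ))),
      (Formula.relabel g ψ).Realize (Sum.elim (Sum.elim v d) w) ↔
        ψ.Realize (Sum.elim v fun p => e' w p.1 p.2) := by
    intro w ψ
    rw [Formula.realize_relabel]
    refine iff_of_eq (congrArg _ ?_)
    funext x
    rcases x with a | ⟨_ | n, l⟩
    · rfl
    · simp [g, e']
    · simp [g, e']
  obtain ⟨w, hwB, hw⟩ := hreal.exists_realize ι (Sum.elim v d)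
    (by rintro (a | l); exacts [hv a, hd l]) ((Formula.relabel g) '' {ψ | P ψ}) (by
      intro s hs
      obtain ⟨t, ht, rfl⟩ := Finset.subset_set_image_iff.1 hs
      let χ : L.Formula (α ⊕ (ℕ × ℕ)) := Formula.iInf fun φ : t => (φ : L.Formula (α ⊕ (ℕ × ℕ)))
      have hχ : P χ := by
        simp only [P, χ, Formula.realize_iInf]
        exact Filter.eventually_all.2 fun φ => ht φ.2
      have hχ' := (eventually_iterU_bot D ((seqSupp χ).erase 0) 0
        (fun j hj => Nat.pos_of_ne_zero (Finset.ne_of_mem_erase hj)) _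
        ((dependsOn_realize v χ).mono (by
          intro i hi
          by_cases h : i = 0
          · exact Or.inl h
          · exact Or.inr (by simpa [h] using hi)))).1 hχ
      obtain ⟨ω, hω⟩ := hχ'.exists
      have h2 : χ.Realize (Sum.elim v fun p => e' (fun q => v (ω q.1 q.2)) p.1 p.2) := by
        let χ' : L.Formula (α ⊕ ℕ) := Formula.relabel (fun x => match x with
          | Sum.inl a => Sum.inl a
          | Sum.inr (0, l) => Sum.inr l
          | Sum.inr (n + 1, l) => Sum.inl (ω (n + 1) l)) χ
        have h3 : χ'.Realize (Sum.elim v d) := by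
          by_contra hcon
          have h4 := hD χ'.not (by simpa using hcon)
          obtain ⟨y, hy1, hy2⟩ := (h4.and hω).exists
          simp only [Formula.realize_not, χ', Formula.realize_relabel] at hy1
          apply hy1
          convert hy2 using 1
          funext x
          rcases x with a | ⟨_ | n, l⟩
          · rfl
          · simp
          · simp
        simp only [χ', Formula.realize_relabel] at h3
        convert h3 using 1
        funext x
        rcases x with a | ⟨_ | n, l⟩
        · rfl
        · simp [e']
        · simp [e']
      refine ⟨fun q => v (ω q.1 q.2), ?_⟩
      intro φ hφ
      obtain ⟨ψ, hψ, rfl⟩ := Finset.mem_image.1 hφ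
      rw [hg]
      simp only [χ, Formula.realize_iInf] at h2
      exact h2 ⟨ψ, hψ⟩)
  have hpos : ∀ ψ, P ψ → ψ.Realize (Sum.elim v fun p => e' w p.1 p.2) := fun ψ hψ =>
    (hg w ψ).1 (hw _ ⟨ψ, hψ, rfl⟩)
  refine ⟨D, e' w, ?_, ?_, fun ψ => ⟨fun h => ?_, hpos ψ⟩⟩
  · funext l; simp [e']
  · intro i l
    by_cases h : i = 0
    · simp only [e', h, if_true]; exact hAB (hd l)
    · simp only [e', h, if_false]; exact hwB _
  · by_contra hcon
    have : P ψ.not := by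
      have := Ultrafilter.eventually_not.2 hcon
      simpa [P] using this
    exact Formula.realize_not.1 (hpos _ this) h

end Morley

section StrongSplitting

variable {L : FirstOrder.Language.{u, u}}

/-- The assignment sending the distinguished variable to `a` and the other variables to `c`. -/
def pointed {N : Type*} (a : N) (c : ℕ → N) : Option ℕ → N := fun o => o.elim a c

/-- A configuration of countable length witnessing that a type strongly splits over longer and
longer finite sets. -/
def HasSS (L : FirstOrder.Language.{u, u}) (N : Type u) [L.Structure N] : Prop :=
  ∃ (a : N) (c : ℕ → Bool → ℕ → N) (φ : ℕ → L.Formula (Option ℕ)),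
    (∀ n, ¬ ((φ n).Realize (pointed a (c n false)) ↔ (φ n).Realize (pointed a (c n true)))) ∧
    ∀ n, ∃ d : ℕ → ℕ → N, ∀ i j, i < j → ∀ ψ : L.Formula ((Fin n × Bool × ℕ) ⊕ (Bool × ℕ)),
      ψ.Realize (Sum.elim (fun p => c p.1 p.2.1 p.2.2) fun p => cond p.1 (d j) (d i) p.2) ↔
        ψ.Realize (Sum.elim (fun p => c p.1 p.2.1 p.2.2) fun p => c n p.1 p.2)

variable {N : Type u} [L.Structure N]

/-- The type of `a` over `A` strongly splits over the finite set `b`. -/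
def SSplit (L : FirstOrder.Language.{u, u}) {N : Type u} [L.Structure N] (A : Set N) (a : N)
    (b : Finset N) : Prop :=
  ∃ (c : Bool → ℕ → N) (φ : L.Formula (Option ℕ)), (∀ t l, c t l ∈ A) ∧
    (∀ t, (Set.range (c t)).Finite) ∧
    ¬ (φ.Realize (pointed a (c false)) ↔ φ.Realize (pointed a (c true))) ∧
    ∃ d : ℕ → ℕ → N, ∀ i j, i < j → ∀ ψ : L.Formula (b ⊕ (Bool × ℕ)),
      ψ.Realize (Sum.elim (↑) fun p => cond p.1 (d j) (d i) p.2) ↔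
        ψ.Realize (Sum.elim (↑) fun p => c p.1 p.2)

theorem hasSS_of_sSplit (A : Set N) (a : N) (h : ∀ b : Finset N, ↑b ⊆ A → SSplit L A a b) :
    HasSS L N := by
  classical
  let F := {b : Finset N // ↑b ⊆ A}
  have h' : ∀ b : F, SSplit L A a b := fun b => h b.1 b.2
  choose c φ hcA hcfin hcφ d hd using h'
  let next : F → F := fun b => ⟨b.1 ∪ (hcfin b false).toFinset ∪ (hcfin b true).toFinset, by
    intro x hx
    simp only [Finset.coe_union, Set.Finite.coe_toFinset, Set.mem_union, Set.mem_range] at hx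
    rcases hx with (hx | ⟨l, rfl⟩) | ⟨l, rfl⟩
    · exact b.2 hx
    · exact hcA _ _ _
    · exact hcA _ _ _⟩
  let B : ℕ → F := fun n => Nat.rec ⟨∅, by simp⟩ (fun _ b => next b) n
  have hB : ∀ n, B (n + 1) = next (B n) := fun n => rfl
  have hmono : Monotone fun n => (B n).1 := monotone_nat_of_le_succ fun n => by
    rw [hB]
    exact Finset.subset_union_left.trans Finset.subset_union_left
  have hmem : ∀ m n, m < n → ∀ t l, c (B m) t l ∈ (B n).1 := by
    intro m n hmn t l
    refine hmono hmn ?_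
    change _ ∈ (B (m + 1)).1
    rw [hB]
    cases t
    · simp [next]
    · simp [next]
  refine ⟨a, fun n => c (B n), fun n => φ (B n), fun n => hcφ _, fun n => ⟨d (B n), ?_⟩⟩
  intro i j hij ψ
  have := hd (B n) i j hij (Formula.relabel
    (Sum.map (fun p => ⟨c (B p.1) p.2.1 p.2.2, hmem _ _ p.1.2 _ _⟩) id) ψ)
  simp only [Formula.realize_relabel, Sum.elim_comp_map] at this
  exact this

variable {α : Type u} [Nonempty α]

theorem hasSS_of_isMor [Nonempty N] {v : α → N} {D : Ultrafilter (ℕ → α)} {e : ℕ → ℕ → N}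
    (he : IsMor L v v D e) (a : N) (φ : L.Formula (Option ℕ))
    (h0 : ∀ n, φ.Realize (pointed a (e n)) ↔ φ.Realize (pointed a (e 0)))
    (hne : ¬ (φ.Realize (pointed a (e 0)) ↔
      ∀ᶠ y in (D : Filter (ℕ → α)), φ.Realize (pointed a (v ∘ y)))) :
    HasSS L (UProd (iterU D ℕᵒᵈ) fun _ => N) := by
  have hM := he.ultrapower
  set E : (ℕ ⊕ₗ ℕᵒᵈ) → ℕ → UProd (iterU D ℕᵒᵈ) (fun _ => N) := fun i =>
    Sum.elim (fun n l => diagEmb (L := L) (iterU D ℕᵒᵈ) N (e n l))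
        (fun n l => UProd.mk (iterU D ℕᵒᵈ) fun ω => v (ω n l)) (ofLex i) with hE
  have hlow : ∀ n, φ.Realize (pointed (diagEmb (L := L) (iterU D ℕᵒᵈ) N a)
      (E (toLex (Sum.inl n)))) ↔ φ.Realize (pointed a (e 0)) := by
    intro n
    rw [← h0 n, ← (diagEmb (L := L) (iterU D ℕᵒᵈ) N).map_formula]
    refine iff_of_eq (congrArg _ ?_)
    funext o
    cases o <;> rfl
  have hup : ∀ n : ℕᵒᵈ, φ.Realize (pointed (diagEmb (L := L) (iterU D ℕᵒᵈ) N a)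
      (E (toLex (Sum.inr n)))) ↔
        ∀ᶠ y in (D : Filter (ℕ → α)), φ.Realize (pointed a (v ∘ y)) := by
    intro n
    rw [← eventually_iterU_single D n]
    refine Iff.trans (iff_of_eq (congrArg _ ?_)) (UProd.realize_mk (iterU D ℕᵒᵈ) φ
      (fun o ω => pointed a (v ∘ ω n) o))
    funext o
    cases o <;> rfl
  refine ⟨diagEmb (L := L) (iterU D ℕᵒᵈ) N a, fun n t => E (cond t (toLex (Sum.inr
    (OrderDual.toDual n))) (toLex (Sum.inl n))), fun _ => φ, fun n => ?_, fun n => ?_⟩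
  · simp only [cond_true, cond_false, hlow, hup]
    exact hne
  · refine ⟨fun i => E (toLex (Sum.inl (n + i))), fun i j hij ψ => ?_⟩
    let J := {x : ℕ ⊕ₗ ℕᵒᵈ // Sum.elim id OrderDual.ofDual (ofLex x) ≤ n}
    let lo : ∀ m, m ≤ n → J := fun m hm => ⟨toLex (Sum.inl m), hm⟩
    let hi : ∀ m, m ≤ n → J := fun m hm => ⟨toLex (Sum.inr (OrderDual.toDual m)), hm⟩
    let f : (Fin n × Bool × ℕ) ⊕ (Bool × ℕ) → α ⊕ (J × ℕ) := fun x => match x with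
      | Sum.inl p => Sum.inr (cond p.2.1 (hi p.1 p.1.2.le) (lo p.1 p.1.2.le), p.2.2)
      | Sum.inr p => Sum.inr (cond p.1 (hi n le_rfl) (lo n le_rfl), p.2)
    let τ : J → ℕ ⊕ₗ ℕᵒᵈ := fun x => match x with
      | ⟨Sum.inl m, _⟩ => if m = n then toLex (Sum.inl (n + i)) else toLex (Sum.inl m)
      | ⟨Sum.inr m, _⟩ => if m = OrderDual.toDual n then toLex (Sum.inl (n + j))
          else toLex (Sum.inr m)
    have hτ : StrictMono τ := by
      rintro ⟨x | x, hx⟩ ⟨y | y, hy⟩ hxy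
      · have h1 : x < y := Sum.Lex.inl_lt_inl_iff.1 hxy
        have h2 : y ≤ n := hy
        have h3 : x ≠ n := (h1.trans_le h2).ne
        change (if x = n then _ else _) < (if y = n then _ else _)
        rw [if_neg h3]
        split_ifs
        · exact Sum.Lex.inl_lt_inl_iff.2 (by omega)
        · exact Sum.Lex.inl_lt_inl_iff.2 h1
      · have h1 : x ≤ n := hx
        change (if x = n then _ else _) < (if y = OrderDual.toDual n then _ else _)
        split_ifs
        · exact Sum.Lex.inl_lt_inl_iff.2 (by omega)
        · exact Sum.Lex.inl_lt_inr _ _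
        · exact Sum.Lex.inl_lt_inl_iff.2 (by omega)
        · exact Sum.Lex.inl_lt_inr _ _
      · exact absurd hxy Sum.Lex.not_inr_lt_inl
      · have h1 : x < y := Sum.Lex.inr_lt_inr_iff.1 hxy
        have h2 : OrderDual.toDual n ≤ x := hx
        have h3 : y ≠ OrderDual.toDual n := (h2.trans_lt h1).ne'
        change (if x = OrderDual.toDual n then _ else _) < (if y = OrderDual.toDual n then _ else _)
        rw [if_neg h3]
        split_ifs
        · exact Sum.Lex.inl_lt_inr _ _
        · exact Sum.Lex.inr_lt_inr_iff.2 h1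
    have e1 : ∀ m, m ≠ n → ∀ hm, τ (lo m hm) = toLex (Sum.inl m) := fun m h _ => if_neg h
    have e2 : ∀ m, m ≠ n → ∀ hm, τ (hi m hm) = toLex (Sum.inr (OrderDual.toDual m)) :=
      fun m h _ => if_neg h
    have e3 : τ (lo n le_rfl) = toLex (Sum.inl (n + i)) := if_pos rfl
    have e4 : τ (hi n le_rfl) = toLex (Sum.inl (n + j)) := if_pos rfl
    have key := hM.realize_comp_iff (Formula.relabel f ψ) τ Subtype.val (hτ.strictMonoOn _)
      ((Subtype.strictMono_coe _).strictMonoOn _)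
    simp only [Formula.realize_relabel] at key
    refine Iff.trans (iff_of_eq (congrArg _ ?_)) (key.trans (iff_of_eq (congrArg _ ?_)))
    · funext x
      rcases x with ⟨m, t, l⟩ | ⟨t, l⟩
      · have hm : (m : ℕ) ≠ n := m.2.ne
        cases t
        · exact congrArg (fun x => E x l) (e1 m hm m.2.le).symm
        · exact congrArg (fun x => E x l) (e2 m hm m.2.le).symm
      · cases t
        · exact congrArg (fun x => E x l) e3.symm
        · exact congrArg (fun x => E x l) e4.symm
    · funext x
      rcases x with ⟨m, t, l⟩ | ⟨t, l⟩ <;> cases t <;> rfl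

end StrongSplitting

section Hull

variable {L : FirstOrder.Language.{u, u}} {N : Type u} [L.Structure N]

/-- A Tarski–Vaught property of the range of `v`, for countable tuples of variables. -/
def TVProp (L : FirstOrder.Language.{u, u}) {N : Type u} [L.Structure N] {K : Type u}
    (v : K → N) : Prop :=
  ∀ (ψ : L.Formula (K ⊕ ℕ)) (w : ℕ → N), ψ.Realize (Sum.elim v w) →
    ∃ y : ℕ → K, ψ.Realize (Sum.elim v (v ∘ y))

theorem tvProp_of_elementary {K : Type u} [L.Structure K] [Nonempty K] (f : K ↪ₑ[L] N) :
    TVProp L f := by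
  intro ψ w h
  have : Nonempty N := Nonempty.map f inferInstance
  obtain ⟨ψ', hψ'⟩ := exists_formula_realize_iff_exists ψ
  have h1 : ψ'.Realize (f ∘ id) := (hψ' N _).2 ⟨w, h⟩
  rw [f.map_formula, hψ'] at h1
  obtain ⟨y, hy⟩ := h1
  refine ⟨y, ?_⟩
  rw [← f.map_formula, Sum.comp_elim] at hy
  exact hy

theorem exists_hull (S : L.ElementarySubstructure N) (hS : (S : Set N).Nonempty) (b : Finset N)
    (hb : (b : Set N) ⊆ S) :
    ∃ (K : Type u) (v : K → N), Nonempty K ∧ #K ≤ max L.card ℵ₀ ∧ (∀ x, v x ∈ S) ∧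
      (b : Set N) ⊆ Set.range v ∧ TVProp L v := by
  rcases le_total (#S) (max L.card ℵ₀) with h | h
  · have : Nonempty S := hS.to_subtype
    exact ⟨S, S.subtype, inferInstance, h, fun x => x.2, fun x hx => ⟨⟨x, hb hx⟩, rfl⟩,
      tvProp_of_elementary _⟩
  · have hfin : (((↑) : S → N) ⁻¹' (b : Set N)).Finite :=
      b.finite_toSet.preimage Subtype.val_injective.injOn
    obtain ⟨S', hbS', hcard⟩ := exists_elementarySubstructure_card_eq L
      (((↑) : S → N) ⁻¹' (b : Set N)) (max L.card ℵ₀) (le_max_right _ _)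
      (by
        rw [lift_id, lift_id]
        exact (lt_aleph0_iff_set_finite.2 hfin).le.trans (le_max_right _ _))
      (by simp) (by simpa using h)
    rw [lift_id, lift_id] at hcard
    have : Nonempty S' := mk_ne_zero_iff.1 (by
      rw [hcard]; exact (aleph0_pos.trans_le (le_max_right _ _)).ne')
    exact ⟨S', S.subtype.comp S'.subtype, inferInstance, hcard.le, fun x => x.1.2,
      fun x hx => ⟨⟨⟨x, hb hx⟩, hbS' hx⟩, rfl⟩, tvProp_of_elementary _⟩

end Hull

section ClosedSet

variable {L : FirstOrder.Language.{u, u}} {N : Type u} [L.Structure N]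

/-- Small hulls of finite subsets of `P`, together with coheir sequences, all inside `P`. -/
structure MorleyData (L : FirstOrder.Language.{u, u}) (N : Type u) [L.Structure N]
    (P : Set N) where
  K : Finset N → Type u
  v : ∀ b, K b → N
  nonempty : ∀ b, Nonempty (K b)
  card_le : ∀ b, #(K b) ≤ max L.card ℵ₀
  mem : ∀ b : Finset N, ↑b ⊆ P → ∀ x, v b x ∈ P
  subset : ∀ b : Finset N, ↑b ⊆ P → (b : Set N) ⊆ Set.range (v b)
  D : ∀ b, (ℕ → N) → Ultrafilter (ℕ → K b)
  e : Finset N → (ℕ → N) → ℕ → ℕ → N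
  e_mem : ∀ b : Finset N, ↑b ⊆ P → ∀ d : ℕ → N, (∀ l, d l ∈ P) → (Set.range d).Finite →
    ∀ i l, e b d i l ∈ P
  e_zero : ∀ b : Finset N, ↑b ⊆ P → ∀ d : ℕ → N, (∀ l, d l ∈ P) → (Set.range d).Finite → e b d 0 = d
  isMor : ∀ b : Finset N, ↑b ⊆ P → ∀ d : ℕ → N, (∀ l, d l ∈ P) → (Set.range d).Finite →
    IsMor L (v b) (v b) (D b d) (e b d)

theorem exists_subset_of_chain {P : ℕ → Set N} (hP : Monotone P) (s : Set N) (hs : s.Finite)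
    (h : s ⊆ ⋃ n, P n) : ∃ n, s ⊆ P n := by
  obtain ⟨I, hI, hsI⟩ := Set.finite_subset_iUnion hs h
  obtain ⟨n, hn⟩ := hI.bddAbove
  exact ⟨n, hsI.trans (Set.iUnion₂_subset fun i hi => hP (hn hi))⟩

theorem mk_finset_subset_le (Q : Set N) (lam : Cardinal.{u}) (h0 : ℵ₀ ≤ lam) (hQ : #Q ≤ lam) :
    #{b : Finset N // ↑b ⊆ Q} ≤ lam := by
  classical
  refine le_trans ?_ ((mk_list_le_max Q).trans (max_le h0 hQ))
  refine mk_le_of_surjective (f := fun l : List Q => ⟨(l.map (↑)).toFinset, ?_⟩) ?_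
  · intro x hx
    simp only [List.coe_toFinset, List.mem_map, Set.mem_ofPred_eq] at hx
    obtain ⟨y, -, rfl⟩ := hx
    exact y.2
  · rintro ⟨b, hb⟩
    refine ⟨b.attach.toList.map fun x => ⟨x.1, hb x.2⟩, Subtype.ext ?_⟩
    ext x
    simp

theorem exists_morleyData [Nonempty N] (S : ℕ → L.ElementarySubstructure N)
    (hS0 : (S 0 : Set N).Nonempty)
    (hS : ∀ n, ∀ x ∈ S n, x ∈ S (n + 1)) {V : Type u} (ι : ℕ × ℕ ↪ V)
    (hr : ∀ n, RealizesOver L (S n : Set N) (S (n + 1)) V) (A : Set N) (hA : A ⊆ S 0)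
    (lam : Cardinal.{u}) (hlam : (2 : Cardinal.{u}) ^ max L.card ℵ₀ ≤ lam) (hAlam : #A ≤ lam) :
    ∃ P : Set N, A ⊆ P ∧ #P ≤ lam ∧ Nonempty (MorleyData L N P) := by
  classical
  have hmono : Monotone fun n => (S n : Set N) := monotone_nat_of_le_succ hS
  have hne : ∀ n, (S n : Set N).Nonempty := fun n => hS0.mono (hmono (Nat.zero_le n))
  have h1 : ∀ b : Finset N, ∃ (K : Type u) (v : K → N), Nonempty K ∧ #K ≤ max L.card ℵ₀ ∧
      ∀ n, (b : Set N) ⊆ S n → (∀ x, v x ∈ S n) ∧ (b : Set N) ⊆ Set.range v ∧ TVProp L v := by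
    intro b
    by_cases h : ∃ n, (b : Set N) ⊆ S n
    · obtain ⟨K, v, h1, h2, h3, h4, h5⟩ := exists_hull (S (Nat.find h)) (hne _) b (Nat.find_spec h)
      exact ⟨K, v, h1, h2, fun n hn => ⟨fun x => hmono (Nat.find_min' h hn) (h3 x), h4, h5⟩⟩
    · refine ⟨PUnit, fun _ => Classical.arbitrary N, inferInstance, ?_,
        fun n hn => (h ⟨n, hn⟩).elim⟩
      simp only [mk_fintype, Fintype.card_punit, Nat.cast_one]
      exact one_le_aleph0.trans (le_max_right _ _)
  choose K v hK hKc hv using h1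
  have h2 : ∀ (b : Finset N) (d : ℕ → N), ∃ (D : Ultrafilter (ℕ → K b)) (e : ℕ → ℕ → N),
      ∀ n, (b : Set N) ⊆ S n → (∀ l, d l ∈ S n) →
        e 0 = d ∧ (∀ i l, e i l ∈ S (n + 1)) ∧ IsMor L (v b) (v b) D e := by
    intro b d
    by_cases h : ∃ n, (b : Set N) ⊆ S n ∧ ∀ l, d l ∈ S n
    · obtain ⟨h1, h2⟩ := Nat.find_spec h
      obtain ⟨h3, h4, h5⟩ := hv b _ h1
      obtain ⟨D, e, h6, h7, h8⟩ := exists_isMor (hr (Nat.find h)) (hS _) ι (v b) h3 h5 d h2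
      exact ⟨D, e, fun n hn hd => ⟨h6, fun i l => hmono
        (Nat.succ_le_succ (Nat.find_min' h ⟨hn, hd⟩)) (h7 i l), h8⟩⟩
    · have : Nonempty (ℕ → K b) := ⟨fun _ => Classical.choice (hK b)⟩
      exact ⟨Ultrafilter.of ⊤, fun _ => d, fun n hn hd => (h ⟨n, hn, hd⟩).elim⟩
  choose D e he using h2
  have hlam0 : ℵ₀ ≤ lam := (le_max_right _ _).trans ((cantor _).le.trans hlam)
  have hlamc : (2 : Cardinal.{u}) ^ ℵ₀ ≤ lam :=
    (power_le_power_left two_ne_zero (le_max_right _ _)).trans hlam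
  let op : Finset N → Set N := fun b => ⋃ b' : {b' // b' ∈ b.powerset},
    (Set.range (v b'.1) ∪ Set.range fun p : (ULift.{u} (ℕ → b) × ULift.{u} (ℕ × ℕ)) =>
      e b'.1 (fun l => (p.1.down l : N)) p.2.down.1 p.2.down.2)
  have hop : ∀ b, #(op b) ≤ lam := by
    intro b
    refine (mk_iUnion_le_sum_mk.trans (sum_le_mk_mul_iSup _)).trans ?_
    refine mul_le_of_le hlam0 ((mk_lt_aleph0).le.trans hlam0) (ciSup_le' fun b' => ?_)
    refine (mk_union_le _ _).trans (add_le_of_le hlam0 (mk_range_le.trans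
      ((hKc _).trans ((cantor _).le.trans hlam))) (mk_range_le.trans ?_))
    rw [mk_prod, lift_id, lift_id]
    refine mul_le_of_le hlam0 ?_ ?_
    · rw [mk_uLift, mk_arrow]
      simp only [lift_power, lift_lift]
      have h4 : (#b : Cardinal.{u}) ≤ 2 ^ ℵ₀ := mk_lt_aleph0.le.trans (cantor _).le
      have h5 := power_le_power_right (c := ℵ₀) h4
      rw [← power_mul, aleph0_mul_aleph0] at h5
      simpa using h5.trans hlamc
    · simp only [mk_uLift]
      exact (lift_le_aleph0.2 mk_le_aleph0).trans hlam0
  let next : Set N → Set N := fun Q => Q ∪ ⋃ b : {b : Finset N // ↑b ⊆ Q}, op b.1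
  let Q : ℕ → Set N := fun n => Nat.rec A (fun _ Q => next Q) n
  have hQ : ∀ n, Q (n + 1) = next (Q n) := fun n => rfl
  have hQm : Monotone Q := monotone_nat_of_le_succ fun n => by
    rw [hQ]; exact Set.subset_union_left
  have hQop : ∀ n (b : Finset N), ↑b ⊆ Q n → op b ⊆ Q (n + 1) := by
    intro n b hb
    rw [hQ]
    exact (Set.subset_iUnion (fun b : {b : Finset N // ↑b ⊆ Q n} => op b.1) ⟨b, hb⟩).trans
      Set.subset_union_right
  have hQS : ∀ n, Q n ⊆ S n := by
    intro n
    induction n with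
    | zero => exact hA
    | succ n ih =>
      rw [hQ]
      refine Set.union_subset (ih.trans (hS n)) (Set.iUnion_subset fun b => ?_)
      refine Set.iUnion_subset fun b' => Set.union_subset ?_ ?_
      · have hb' : (b'.1 : Set N) ⊆ S n := fun x hx =>
          ih (b.2 (Finset.mem_powerset.1 b'.2 hx))
        rintro _ ⟨x, rfl⟩
        exact hS n _ ((hv _ n hb').1 x)
      · have hb' : (b'.1 : Set N) ⊆ S n := fun x hx =>
          ih (b.2 (Finset.mem_powerset.1 b'.2 hx))
        rintro _ ⟨p, rfl⟩
        exact (he b'.1 (fun l => (p.1.down l : N)) n hb' fun l =>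
          ih (b.2 (p.1.down l).2)).2.1 _ _
  have hQc : ∀ n, #↥(Q n) ≤ lam := by
    intro n
    induction n with
    | zero => exact hAlam
    | succ n ih =>
      rw [hQ]
      refine (mk_union_le _ _).trans (add_le_of_le hlam0 ih ?_)
      refine (mk_iUnion_le_sum_mk.trans (sum_le_mk_mul_iSup _)).trans ?_
      refine mul_le_of_le hlam0 ?_ (ciSup_le' fun b => hop _)
      exact mk_finset_subset_le _ lam hlam0 ih
  refine ⟨⋃ n, Q n, Set.subset_iUnion Q 0, ?_, ?_⟩
  · refine ?_
    have h3 : (⋃ n, Q n) = ⋃ n : ULift.{u} ℕ, Q n.down :=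
      (Equiv.ulift.surjective.iUnion_comp Q).symm
    rw [h3]
    refine (mk_iUnion_le _).trans (mul_le_of_le hlam0 ?_ (ciSup_le' fun n => hQc _))
    simpa using hlam0
  have hfin : ∀ (b : Finset N) (d : ℕ → N), ↑b ⊆ (⋃ n, Q n) → (∀ l, d l ∈ ⋃ n, Q n) →
      (Set.range d).Finite → ∃ n, (b : Set N) ⊆ Q n ∧ ∀ l, d l ∈ Q n := by
    intro b d hb hd hdf
    obtain ⟨n, hn⟩ := exists_subset_of_chain hQm ((b : Set N) ∪ Set.range d)
      (b.finite_toSet.union hdf) (Set.union_subset hb (by rintro _ ⟨l, rfl⟩; exact hd l))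
    exact ⟨n, Set.subset_union_left.trans hn, fun l => hn (Or.inr ⟨l, rfl⟩)⟩
  refine ⟨⟨K, v, hK, hKc, ?_, ?_, D, e, ?_, ?_, ?_⟩⟩
  · intro b hb x
    obtain ⟨n, hn⟩ := exists_subset_of_chain hQm b b.finite_toSet hb
    refine Set.mem_iUnion.2 ⟨n + 1, hQop n b hn ?_⟩
    exact Set.mem_iUnion.2 ⟨⟨b, by simp⟩, Or.inl ⟨x, rfl⟩⟩
  · intro b hb
    obtain ⟨n, hn⟩ := exists_subset_of_chain hQm b b.finite_toSet hb
    exact (hv b n (hn.trans (hQS n))).2.1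
  · intro b hb d hd hdf i l
    obtain ⟨n, h1, h2⟩ := hfin b d hb hd hdf
    refine Set.mem_iUnion.2 ⟨n + 1, hQop n (b ∪ hdf.toFinset) ?_ ?_⟩
    · rw [Finset.coe_union, hdf.coe_toFinset]
      exact Set.union_subset h1 (by rintro _ ⟨l, rfl⟩; exact h2 l)
    · refine Set.mem_iUnion.2 ⟨⟨b, Finset.mem_powerset.2 Finset.subset_union_left⟩,
        Or.inr ⟨(⟨fun l => ⟨d l, by simp⟩⟩, ⟨(i, l)⟩), rfl⟩⟩
  · intro b hb d hd hdf
    obtain ⟨n, h1, h2⟩ := hfin b d hb hd hdf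
    exact (he b d n (h1.trans (hQS n)) fun l => hQS n (h2 l)).1
  · intro b hb d hd hdf
    obtain ⟨n, h1, h2⟩ := hfin b d hb hd hdf
    exact (he b d n (h1.trans (hQS n)) fun l => hQS n (h2 l)).2.2

end ClosedSet

section ManyTypes

variable {L : FirstOrder.Language.{u, u}}

theorem card_formula_le (α : Type u) (h : #α ≤ max L.card ℵ₀) :
    #(L.Formula α) ≤ max L.card ℵ₀ := by
  have h1 : #(L.Formula α) ≤ #(Σ n, L.BoundedFormula α n) :=
    mk_le_of_injective (f := fun φ : L.Formula α => (⟨0, φ⟩ : Σ n, L.BoundedFormula α n))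
      fun φ ψ h => by simpa using h
  refine h1.trans (BoundedFormula.card_le.trans ?_)
  rw [lift_id, lift_id]
  exact max_le (le_max_right _ _) (add_le_of_le (le_max_right _ _) h (le_max_left _ _))

/-- A formula with finitely many parameters in `v` rewritten over a countable tuple. -/
theorem exists_formula_pointed {α : Type*} {N : Type u} [L.Structure N] (v : α → N) (x0 : N)
    (φ : L.Formula (α ⊕ Fin 1)) : ∃ (φ' : L.Formula (Option ℕ)) (d : ℕ → N),
      (∀ l, d l = x0 ∨ ∃ a, d l = v a) ∧ (Set.range d).Finite ∧
      ∀ x : N, φ'.Realize (pointed x d) ↔ φ.Realize (Sum.elim v fun _ => x) := by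
  classical
  let l := (fsupp φ).toLeft.toList
  have hl : ∀ a, Sum.inl a ∈ fsupp φ → a ∈ l := fun a ha => by simpa [l] using ha
  let d : ℕ → N := fun n => (l.map v).getD n x0
  have hd : ∀ n, d n ∈ x0 :: l.map v := by
    intro n
    by_cases h : n < (l.map v).length
    · simp only [d, List.getD_eq_getElem _ _ h]
      exact List.mem_cons_of_mem _ (List.getElem_mem _)
    · simp only [d, List.getD_eq_default _ _ (not_lt.1 h)]
      exact List.mem_cons_self
  refine ⟨Formula.relabel (Sum.elim (fun a => some (l.idxOf a)) fun _ => none) φ, d, ?_, ?_, ?_⟩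
  · intro n
    rcases List.mem_cons.1 (hd n) with h | h
    · exact Or.inl h
    · obtain ⟨a, -, ha⟩ := List.mem_map.1 h
      exact Or.inr ⟨a, ha.symm⟩
  · exact (List.finite_toSet (x0 :: l.map v)).subset (by rintro _ ⟨n, rfl⟩; exact hd n)
  · intro x
    rw [Formula.realize_relabel]
    refine realize_congr_fsupp φ ?_
    rintro (a | a) ha
    · have h1 : l.idxOf a < l.length := List.idxOf_lt_length_iff.2 (hl a ha)
      have h2 : l.idxOf a < (l.map v).length := by simpa using h1
      change (l.map v).getD (l.idxOf a) x0 = v a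
      rw [List.getD_eq_getElem _ _ h2, List.getElem_map, List.getElem_idxOf]
    · rfl

theorem exists_hasSS (M : Type u) [L.Structure M] [Nonempty M] (A : Set M) (lam : Cardinal.{u})
    (hlam : (2 : Cardinal.{u}) ^ max L.card ℵ₀ ≤ lam) (hA : #A ≤ lam)
    (hcard : lam < #{p : Set (L.Formula (↥A ⊕ Fin 1)) // IsCompleteTypeOver A p}) :
    ∃ (N : Type u) (_ : L.Structure N), Nonempty (M ↪ₑ[L] N) ∧ HasSS L N := by
  classical
  by_contra hno
  push Not at hno
  let V : Type u := ULift.{u} (ℕ × ℕ)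
  obtain ⟨N, _, f, S, hS, hf, hr⟩ := exists_chain (L := L) M V
  have hNn : Nonempty N := Nonempty.map f inferInstance
  obtain ⟨P, hAP, hPlam, ⟨W⟩⟩ := exists_morleyData S ⟨f (Classical.arbitrary M), hf _⟩ hS
    (Equiv.ulift.symm.toEmbedding) hr (f '' A) (by rintro _ ⟨x, -, rfl⟩; exact hf x) lam hlam
    (mk_image_le.trans hA)
  have hWn := W.nonempty
  have hb : ∀ a : N, ∃ b : Finset N, ↑b ⊆ P ∧ ¬ SSplit L P a b := by
    intro a
    by_contra hcon
    push Not at hcon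
    exact hno N inferInstance ⟨f⟩ (hasSS_of_sSplit P a hcon)
  choose b hbP hb using hb
  have key : ∀ (a : N) (φ : L.Formula (Option ℕ)) (d : ℕ → N), (∀ l, d l ∈ P) →
      (Set.range d).Finite → (φ.Realize (pointed a d) ↔
        ∀ᶠ y in (W.D (b a) d : Filter (ℕ → W.K (b a))),
          φ.Realize (pointed a (W.v (b a) ∘ y))) := by
    intro a φ d hd hdf
    have he := W.isMor (b a) (hbP a) d hd hdf
    have he0 := W.e_zero (b a) (hbP a) d hd hdf
    have hemem := W.e_mem (b a) (hbP a) d hd hdf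
    have hsub := W.subset (b a) (hbP a)
    generalize W.e (b a) d = e at he he0 hemem
    generalize W.D (b a) d = D₀ at he ⊢
    by_contra hne
    rw [← he0] at hne
    refine hno _ inferInstance ⟨(diagEmb (L := L) _ N).comp f⟩ (hasSS_of_isMor he a φ ?_ hne)
    intro n
    rcases Nat.eq_zero_or_pos n with rfl | hn
    · rfl
    by_contra hcon
    refine hb a ⟨fun t => e (cond t n 0), φ, fun t l => hemem _ l, fun t => ?_,
      fun h => hcon h.symm, e, fun i j hij ψ => ?_⟩
    · exact he.finite_range 0 _ (by rwa [he0])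
    · have hg : ∀ x : b a, ∃ y, W.v (b a) y = x := fun x => hsub x.2
      choose g hg using hg
      have h1 := he.pair_iff hij hn (Formula.relabel (Sum.map g id) ψ)
      simp only [Formula.realize_relabel, Sum.elim_comp_map, Function.comp_id] at h1
      have h2 : W.v (b a) ∘ g = Subtype.val := funext hg
      rw [h2] at h1
      refine Iff.trans (iff_of_eq (congrArg _ ?_)) h1
      congr 1
      funext p
      rcases p with ⟨_ | _, l⟩ <;> rfl
  have hreal : ∀ p : {p : Set (L.Formula (↥A ⊕ Fin 1)) // IsCompleteTypeOver A p}, ∃ a : N,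
      ∀ φ, φ ∈ p.1 ↔ φ.Realize (Sum.elim (fun a : A => f a) fun _ => a) := by
    rintro ⟨p, hp, hmax⟩
    have hp' : FinSat (fun a : A => f a) p := by
      refine (finSat_comp_iff f (fun a : A => (a : M)) p).2 fun s hs => ?_
      obtain ⟨x, hx⟩ := hp s hs
      exact ⟨fun _ => x, hx⟩
    obtain ⟨w, -, hw⟩ := (hr 0).exists_realize (W := Fin 1)
      ⟨fun i => ⟨(0, i)⟩, fun i j h => Subsingleton.elim i j⟩ (fun a : A => f a)
      (fun a => hf a) p hp'
    have hw0 : w = fun _ => w 0 := by funext i; rw [Subsingleton.elim i 0]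
    refine ⟨w 0, fun φ => ?_⟩
    have hq := hmax {φ | φ.Realize (Sum.elim (fun a : A => f a) w)} (fun s hs => by
      have h1 : FinSat (f ∘ fun a : A => (a : M)) {φ : L.Formula (↥A ⊕ Fin 1) |
        φ.Realize (Sum.elim (fun a : A => f a) w)} := fun s hs => ⟨w, fun φ hφ => hs hφ⟩
      rw [finSat_comp_iff] at h1
      obtain ⟨w', hw'⟩ := h1 s hs
      refine ⟨w' 0, fun φ hφ => ?_⟩
      have hw0' : w' = fun _ => w' 0 := by funext i; rw [Subsingleton.elim i 0]
      rw [← hw0']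
      exact hw' φ hφ) (fun φ hφ => hw φ hφ)
    rw [← hw0]
    exact iff_of_eq (congrArg (φ ∈ ·) hq.symm)
  choose a ha using hreal
  have hP0 : ∃ x0, x0 ∈ P :=
    ⟨W.v ∅ (Classical.choice (hWn ∅)), W.mem ∅ (by simp) _⟩
  obtain ⟨x0, hx0⟩ := hP0
  have hdet : ∀ (b' : Finset N) (a a' : N), b a = b' → b a' = b' →
      (∀ χ : L.Formula (Option (W.K b')), χ.Realize (fun o => o.elim a (W.v b')) ↔
        χ.Realize (fun o => o.elim a' (W.v b'))) →
      ∀ φ : L.Formula (↥A ⊕ Fin 1), φ.Realize (Sum.elim (fun a : A => f a) fun _ => a) ↔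
        φ.Realize (Sum.elim (fun a : A => f a) fun _ => a') := by
    intro b' a a' h1 h2 h φ
    obtain ⟨φ', d, hd, hdf, hφ'⟩ := exists_formula_pointed (fun a : A => f a) x0 φ
    have hdP : ∀ l, d l ∈ P := by
      intro l
      rcases hd l with h | ⟨x, h⟩
      · rw [h]; exact hx0
      · rw [h]; exact hAP ⟨x, x.2, rfl⟩
    rw [← hφ', ← hφ', key a φ' d hdP hdf, key a' φ' d hdP hdf, h1, h2]
    refine Filter.eventually_congr (Filter.Eventually.of_forall fun y => ?_)
    have := h (Formula.relabel (Option.map y) φ')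
    simp only [Formula.realize_relabel] at this
    refine Iff.trans (iff_of_eq (congrArg _ ?_)) (this.trans (iff_of_eq (congrArg _ ?_)))
    · funext o; cases o <;> rfl
    · funext o; cases o <;> rfl
  have hlam0 : ℵ₀ ≤ lam := (le_max_right _ _).trans ((cantor _).le.trans hlam)
  let T := Σ b' : {b' : Finset N // ↑b' ⊆ P}, Set (L.Formula (Option (W.K b'.1)))
  have hT : #T ≤ lam := by
    rw [mk_sigma]
    refine (sum_le_mk_mul_iSup _).trans (mul_le_of_le hlam0 (mk_finset_subset_le P lam hlam0 hPlam)
      (ciSup_le' fun b' => ?_))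
    rw [mk_set]
    refine (power_le_power_left two_ne_zero (card_formula_le _ ?_)).trans hlam
    rw [mk_option]
    exact add_le_of_le (le_max_right _ _) (W.card_le _) (one_le_aleph0.trans (le_max_right _ _))
  let F : {p : Set (L.Formula (↥A ⊕ Fin 1)) // IsCompleteTypeOver A p} → T := fun p =>
    ⟨⟨b (a p), hbP _⟩, {χ | χ.Realize (fun o => o.elim (a p) (W.v (b (a p))))}⟩
  have hF : Function.Injective F := by
    intro p q hpq
    have h1 : b (a p) = b (a q) := congrArg (fun x : T => x.1.1) hpq
    have h2 : ∀ (b' : Finset N) (hb' : ↑b' ⊆ P) (hq : b (a q) = b'), F q = ⟨⟨b', hb'⟩,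
        {χ | χ.Realize (fun o => o.elim (a q) (W.v b'))}⟩ := by
      rintro _ _ rfl
      rfl
    have h3 := hpq.trans (h2 (b (a p)) (hbP _) h1.symm)
    have h4 := eq_of_heq (Sigma.mk.inj h3).2
    refine Subtype.ext (Set.ext fun φ => ?_)
    rw [ha, ha]
    exact hdet (b (a p)) (a p) (a q) rfl h1.symm (fun χ => iff_of_eq (congrArg (χ ∈ ·) h4)) φ
  exact absurd ((mk_le_of_injective hF).trans hT) (not_le.2 hcard)

end ManyTypes

section Indiscernible

variable {J : Type u} [LinearOrder J]

/-- Every finite cut of `Q` is filled in `Q`. -/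
def Filling (Q : Set J) : Prop :=
  ∀ A B : Finset J, ↑A ⊆ Q → ↑B ⊆ Q → (∀ a ∈ A, ∀ b ∈ B, a < b) →
    ∃ z ∈ Q, (∀ a ∈ A, a < z) ∧ ∀ b ∈ B, z < b

theorem Filling.exists_extend {Q : Set J} (hQ : Filling Q) (t u : Finset J) (ρ : J → J)
    (hρ : StrictMonoOn ρ t) (htQ : ∀ j ∈ t, ρ j ∈ Q) :
    ∃ ρ' : J → J, (∀ j ∈ t, ρ' j = ρ j) ∧ StrictMonoOn ρ' (t ∪ u : Finset J) ∧
      ∀ j ∈ t ∪ u, ρ' j ∈ Q := by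
  classical
  induction u using Finset.induction_on with
  | empty => exact ⟨ρ, fun _ _ => rfl, by simpa using hρ, by simpa using htQ⟩
  | insert a u ha ih =>
    obtain ⟨ρ', h1, h2, h3⟩ := ih
    rw [Finset.union_insert]
    by_cases hat : a ∈ t ∪ u
    · rw [Finset.insert_eq_of_mem hat]
      exact ⟨ρ', h1, h2, h3⟩
    obtain ⟨z, hzQ, hz1, hz2⟩ := hQ (((t ∪ u).filter (· < a)).image ρ')
      (((t ∪ u).filter (a < ·)).image ρ')
      (by intro x hx; simp only [Finset.coe_image, Set.mem_image, Finset.mem_coe,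
            Finset.mem_filter] at hx
          obtain ⟨j, ⟨hj, -⟩, rfl⟩ := hx; exact h3 j hj)
      (by intro x hx; simp only [Finset.coe_image, Set.mem_image, Finset.mem_coe,
            Finset.mem_filter] at hx
          obtain ⟨j, ⟨hj, -⟩, rfl⟩ := hx; exact h3 j hj)
      (by intro x hx y hy
          simp only [Finset.mem_image, Finset.mem_filter] at hx hy
          obtain ⟨i, ⟨hi, hia⟩, rfl⟩ := hx
          obtain ⟨j, ⟨hj, hja⟩, rfl⟩ := hy
          exact h2 hi hj (hia.trans hja))
    have hz1' : ∀ i ∈ t ∪ u, i < a → ρ' i < z := fun i hi hia =>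
      hz1 _ (Finset.mem_image.2 ⟨i, Finset.mem_filter.2 ⟨hi, hia⟩, rfl⟩)
    have hz2' : ∀ i ∈ t ∪ u, a < i → z < ρ' i := fun i hi hia =>
      hz2 _ (Finset.mem_image.2 ⟨i, Finset.mem_filter.2 ⟨hi, hia⟩, rfl⟩)
    have hne : ∀ j ∈ t ∪ u, j ≠ a := fun j hj h => hat (h ▸ hj)
    refine ⟨Function.update ρ' a z, fun j hj => ?_, ?_, ?_⟩
    · rw [Function.update_of_ne (hne j (Finset.mem_union_left _ hj)), h1 j hj]
    · intro i hi j hj hij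
      rw [Finset.mem_coe, Finset.mem_insert] at hi hj
      rcases hi with rfl | hi <;> rcases hj with rfl | hj
      · exact absurd hij (lt_irrefl _)
      · rw [Function.update_self, Function.update_of_ne (hne j hj)]
        exact hz2' j hj hij
      · rw [Function.update_self, Function.update_of_ne (hne i hi)]
        exact hz1' i hi hij
      · rw [Function.update_of_ne (hne i hi), Function.update_of_ne (hne j hj)]
        exact h2 hi hj hij
    · intro j hj
      rcases Finset.mem_insert.1 hj with rfl | hj
      · rwa [Function.update_self]
      · rw [Function.update_of_ne (hne j hj)]
        exact h3 j hj

theorem Filling.exists_reindex {Q : Set J} (hQ : Filling Q) (s u : Finset J) (σ τ : J → J)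
    (hσ : StrictMonoOn σ s) (hτ : StrictMonoOn τ s) (hσQ : ∀ j ∈ s, σ j ∈ Q) :
    ∃ ρ : J → J, (∀ j ∈ s, ρ (τ j) = σ j) ∧ StrictMonoOn ρ (s.image τ ∪ u : Finset J) ∧
      ∀ j ∈ s.image τ ∪ u, ρ j ∈ Q := by
  classical
  rcases s.eq_empty_or_nonempty with rfl | ⟨j₀, hj₀⟩
  · obtain ⟨ρ, -, h2, h3⟩ := hQ.exists_extend ∅ u id (fun _ h => by simp at h) (by simp)
    exact ⟨ρ, by simp, by simpa using h2, by simpa using h3⟩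
  have : Nonempty J := ⟨j₀⟩
  have hinv : ∀ j ∈ s, Function.invFunOn τ s (τ j) = j := fun j hj =>
    hτ.injOn.leftInvOn_invFunOn (Finset.mem_coe.2 hj)
  obtain ⟨ρ, h1, h2, h3⟩ := hQ.exists_extend (s.image τ) u (σ ∘ Function.invFunOn τ s)
    (by
      intro x hx y hy hxy
      obtain ⟨i, hi, rfl⟩ := Finset.mem_image.1 (Finset.mem_coe.1 hx)
      obtain ⟨j, hj, rfl⟩ := Finset.mem_image.1 (Finset.mem_coe.1 hy)
      simp only [Function.comp_apply, hinv i hi, hinv j hj]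
      exact hσ hi hj ((hτ.lt_iff_lt hi hj).1 hxy))
    (by
      intro x hx
      obtain ⟨i, hi, rfl⟩ := Finset.mem_image.1 hx
      simp only [Function.comp_apply, hinv i hi]
      exact hσQ i hi)
  refine ⟨ρ, fun j hj => ?_, h2, h3⟩
  rw [h1 _ (Finset.mem_image_of_mem _ hj), Function.comp_apply, hinv j hj]

variable {L : FirstOrder.Language.{u, u}} {X : Type u} [L.Structure X] [Nonempty X]

/-- A function of finitely many coordinates. -/
structure Fn (J X : Type u) where
  /-- The finite set of coordinates. -/
  supp : Finset J
  /-- The function. -/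
  toFun : (J → X) → X
  dep : DependsOn toFun (supp : Set J)

/-- The constant functions. -/
def Fn.const (x : X) : Fn J X := ⟨∅, fun _ => x, fun _ _ _ => rfl⟩

/-- The projection to a coordinate. -/
def Fn.proj (j : J) : Fn J X := ⟨{j}, fun ω => ω j, fun _ _ h => h j (by simp)⟩

variable (D : Ultrafilter X)

/-- The element of the iterated ultrapower given by a function precomposed with a map of the
index set. -/
noncomputable def el (F : (J → X) → X) (σ : J → J) : UProd (iterU D J) (fun _ => X) :=
  UProd.mk _ fun ω => F (ω ∘ σ)

theorem el_congr {F : (J → X) → X} {s : Finset J} (hF : DependsOn F (s : Set J)) {σ τ : J → J}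
    (h : ∀ j ∈ s, σ j = τ j) : el D F σ = el D F τ := by
  unfold el
  congr 1
  funext ω
  exact hF fun j hj => by simp [h j hj]

theorem el_comp_eq {F : (J → X) → X} {s : Finset J} (hF : DependsOn F (s : Set J))
    {σ τ ρ : J → J} (h : ∀ j ∈ s, σ j = ρ (τ j)) :
    el D F σ = el D (fun ω => F (ω ∘ τ)) ρ :=
  el_congr D (τ := ρ ∘ τ) hF h

theorem el_realize_iff {β : Type*} (φ : L.Formula β) (F : β → (J → X) → X) (s : Finset J)
    (hF : ∀ b, DependsOn (F b) (s : Set J)) {σ : J → J} (hσ : StrictMonoOn σ s) :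
    φ.Realize (fun b => el D (F b) σ) ↔ ∀ᶠ ω in (iterU D J : Filter (J → X)),
      φ.Realize fun b => F b ω := by
  refine (UProd.realize_mk _ φ fun b ω => F b (ω ∘ σ)).trans ?_
  refine eventually_iterU_comp D s (fun ω => φ.Realize fun b => F b ω) ?_ σ hσ
  intro ω ω' h
  have : (fun b => F b ω) = fun b => F b ω' := funext fun b => hF b h
  simp only [this]

theorem el_realize_congr {β : Type*} (φ : L.Formula β) (F : β → (J → X) → X) (s : Finset J)
    (hF : ∀ b, DependsOn (F b) (s : Set J)) {σ τ : J → J} (hσ : StrictMonoOn σ s)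
    (hτ : StrictMonoOn τ s) :
    φ.Realize (fun b => el D (F b) σ) ↔ φ.Realize (fun b => el D (F b) τ) :=
  (el_realize_iff D φ F s hF hσ).trans (el_realize_iff D φ F s hF hτ).symm

theorem el_realize_bounded_congr {β : Type*} {n : ℕ} (φ : L.BoundedFormula β n)
    (F : β → (J → X) → X) (F' : Fin n → (J → X) → X) (s : Finset J)
    (hF : ∀ b, DependsOn (F b) (s : Set J)) (hF' : ∀ b, DependsOn (F' b) (s : Set J))
    {σ τ : J → J} (hσ : StrictMonoOn σ s) (hτ : StrictMonoOn τ s) :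
    φ.Realize (fun b => el D (F b) σ) (fun b => el D (F' b) σ) ↔
      φ.Realize (fun b => el D (F b) τ) (fun b => el D (F' b) τ) := by
  have h := el_realize_congr D φ.toFormula (Sum.elim F F') s
    (by rintro (b | b); exacts [hF b, hF' b]) hσ hτ
  rw [BoundedFormula.realize_toFormula, BoundedFormula.realize_toFormula] at h
  exact h

variable (L) in
/-- The generators given by the functions in `G` applied to increasing tuples from `A`. -/
def gens (G : Set (Fn J X)) (A : Set J) : Set (UProd (iterU D J) (fun _ => X)) :=
  {x | ∃ F ∈ G, ∃ σ : J → J, StrictMonoOn σ F.supp ∧ (∀ j ∈ F.supp, σ j ∈ A) ∧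
    el D F.toFun σ = x}

variable (L) in
/-- The substructure generated by `gens`. -/
noncomputable def hullS (G : Set (Fn J X)) (A : Set J) :
    L.Substructure (UProd (iterU D J) (fun _ => X)) :=
  Substructure.closure L (gens D G A)

theorem gens_mono {G G' : Set (Fn J X)} {A A' : Set J} (hG : G ⊆ G') (hA : A ⊆ A') :
    gens D G A ⊆ gens D G' A' := by
  rintro x ⟨F, hF, σ, h1, h2, rfl⟩
  exact ⟨F, hG hF, σ, h1, fun j hj => hA (h2 j hj), rfl⟩

theorem hullS_mono {G G' : Set (Fn J X)} {A A' : Set J} (hG : G ⊆ G') (hA : A ⊆ A') :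
    hullS L D G A ≤ hullS L D G' A' :=
  Substructure.closure_mono (gens_mono D hG hA)

variable (L) in
/-- A function all of whose translates belong to the corresponding hulls. -/
def Good (G : Set (Fn J X)) (s : Finset J) (F : (J → X) → X) : Prop :=
  DependsOn F (s : Set J) ∧ ∀ σ : J → J, StrictMonoOn σ s → el D F σ ∈ hullS L D G (σ '' s)

theorem Good.mem {G : Set (Fn J X)} {s : Finset J} {F : (J → X) → X} (h : Good L D G s F)
    {A : Set J} {σ : J → J} (hσ : StrictMonoOn σ s) (hA : ∀ j ∈ s, σ j ∈ A) :
    el D F σ ∈ hullS L D G A :=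
  hullS_mono D subset_rfl (by rintro _ ⟨j, hj, rfl⟩; exact hA j hj) (h.2 σ hσ)

theorem Good.mono {G : Set (Fn J X)} {s t : Finset J} {F : (J → X) → X} (h : Good L D G s F)
    (hst : s ⊆ t) : Good L D G t F :=
  ⟨fun _ _ hω => h.1 fun j hj => hω j (hst hj), fun _ hσ =>
    h.mem D (hσ.mono (Finset.coe_subset.2 hst)) fun j hj => ⟨j, hst hj, rfl⟩⟩

theorem Good.comp {G : Set (Fn J X)} {s : Finset J} {F : (J → X) → X} (h : Good L D G s F)
    {ρ : J → J} (hρ : StrictMonoOn ρ s) :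
    Good L D G (s.image ρ) (fun ω => F (ω ∘ ρ)) := by
  refine ⟨by exact h.1.comp_right ρ, fun σ hσ => ?_⟩
  refine h.mem D (σ := σ ∘ ρ) (fun i hi j hj hij => hσ ?_ ?_ (hρ hi hj hij)) fun j hj => ?_
  · exact Finset.mem_coe.2 (Finset.mem_image_of_mem _ hi)
  · exact Finset.mem_coe.2 (Finset.mem_image_of_mem _ hj)
  · exact ⟨ρ j, Finset.mem_coe.2 (Finset.mem_image_of_mem _ hj), rfl⟩

theorem good_of_mem {G : Set (Fn J X)} {F : Fn J X} (hF : F ∈ G) :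
    Good L D G F.supp F.toFun :=
  ⟨F.dep, fun σ hσ => Substructure.subset_closure
    ⟨F, hF, σ, hσ, fun j hj => ⟨j, hj, rfl⟩, rfl⟩⟩

theorem exists_good {G : Set (Fn J X)} {A : Set J} {x : UProd (iterU D J) (fun _ => X)}
    (hx : x ∈ hullS L D G A) : ∃ (s : Finset J) (F : (J → X) → X), ↑s ⊆ A ∧ Good L D G s F ∧
      el D F id = x := by
  classical
  refine Substructure.closure_induction (p := fun x => ∃ (s : Finset J) (F : (J → X) → X),
    ↑s ⊆ A ∧ Good L D G s F ∧ el D F id = x) hx ?_ ?_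
  · rintro _ ⟨F, hF, σ, h1, h2, rfl⟩
    refine ⟨F.supp.image σ, _, ?_, (good_of_mem D hF).comp D h1, rfl⟩
    intro j hj
    obtain ⟨i, hi, rfl⟩ := Finset.mem_image.1 (Finset.mem_coe.1 hj)
    exact h2 i hi
  · intro n f x hx
    choose s F hs hF hx using hx
    refine ⟨Finset.univ.biUnion s, fun ω => Structure.funMap f fun i => F i ω, ?_, ⟨?_, ?_⟩, ?_⟩
    · intro j hj
      obtain ⟨i, -, hi⟩ := Finset.mem_biUnion.1 (Finset.mem_coe.1 hj)
      exact hs i hi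
    · intro ω ω' h
      refine congrArg (Structure.funMap f) (funext fun i => (hF i).1 fun j hj => h j ?_)
      exact Finset.mem_coe.2 (Finset.mem_biUnion.2 ⟨i, Finset.mem_univ _, hj⟩)
    · intro σ hσ
      have : el D (fun ω => Structure.funMap f fun i => F i ω) σ =
          Structure.funMap f fun i => el D (F i) σ := (UProd.funMap_mk _ f _).symm
      rw [this]
      refine Substructure.fun_mem _ f _ fun i => ?_
      have hsub : s i ⊆ Finset.univ.biUnion s := Finset.subset_biUnion_of_mem s (Finset.mem_univ i)
      exact (hF i).mem D (hσ.mono (Finset.coe_subset.2 hsub)) fun j hj => ⟨j, hsub hj, rfl⟩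
    · have : el D (fun ω => Structure.funMap f fun i => F i ω) id =
          Structure.funMap f fun i => el D (F i) id := (UProd.funMap_mk _ f _).symm
      rw [this]
      exact congrArg _ (funext hx)

/-- Truth in the hull of `G` is invariant under moves. -/
theorem hullS_realize_congr (hJ : Filling (Set.univ : Set J)) {G : Set (Fn J X)} {β : Type*}
    {n : ℕ} (φ : L.BoundedFormula β n) (s : Finset J) (σ τ : J → J) (hσ : StrictMonoOn σ s)
    (hτ : StrictMonoOn τ s) (F : β → (J → X) → X) (F' : Fin n → (J → X) → X)
    (hF : ∀ b, Good L D G s (F b)) (hF' : ∀ b, Good L D G s (F' b))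
    (v w : β → hullS L D G Set.univ) (v' w' : Fin n → hullS L D G Set.univ)
    (hv : ∀ b, (v b : UProd (iterU D J) (fun _ => X)) = el D (F b) σ)
    (hw : ∀ b, (w b : UProd (iterU D J) (fun _ => X)) = el D (F b) τ)
    (hv' : ∀ b, (v' b : UProd (iterU D J) (fun _ => X)) = el D (F' b) σ)
    (hw' : ∀ b, (w' b : UProd (iterU D J) (fun _ => X)) = el D (F' b) τ) :
    φ.Realize v v' ↔ φ.Realize w w' := by
  classical
  have atomic : ∀ {n : ℕ} (φ : L.BoundedFormula β n) (_ : φ.IsQF) (s : Finset J) (σ τ : J → J)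
      (_ : StrictMonoOn σ s)
      (_ : StrictMonoOn τ s) (F : β → (J → X) → X) (F' : Fin n → (J → X) → X)
      (_ : ∀ b, Good L D G s (F b)) (_ : ∀ b, Good L D G s (F' b))
      (v w : β → hullS L D G Set.univ) (v' w' : Fin n → hullS L D G Set.univ)
      (_ : ∀ b, (v b : UProd (iterU D J) (fun _ => X)) = el D (F b) σ)
      (_ : ∀ b, (w b : UProd (iterU D J) (fun _ => X)) = el D (F b) τ)
      (_ : ∀ b, (v' b : UProd (iterU D J) (fun _ => X)) = el D (F' b) σ)
      (_ : ∀ b, (w' b : UProd (iterU D J) (fun _ => X)) = el D (F' b) τ),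
      φ.Realize v v' ↔ φ.Realize w w' := by
    intro n φ hφ s σ τ hσ hτ F F' hF hF' v w v' w' hv hw hv' hw'
    rw [← hφ.realize_embedding (hullS L D G Set.univ).subtype,
      ← hφ.realize_embedding (hullS L D G Set.univ).subtype]
    have h := el_realize_bounded_congr D φ F F' s (fun b => (hF b).1) (fun b => (hF' b).1) hσ hτ
    have e1 : (hullS L D G Set.univ).subtype ∘ v = fun b => el D (F b) σ := funext hv
    have e2 : (hullS L D G Set.univ).subtype ∘ w = fun b => el D (F b) τ := funext hw
    have e3 : (hullS L D G Set.univ).subtype ∘ v' = fun b => el D (F' b) σ := funext hv'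
    have e4 : (hullS L D G Set.univ).subtype ∘ w' = fun b => el D (F' b) τ := funext hw'
    rw [e1, e2, e3, e4]
    exact h
  induction φ generalizing s σ τ F v w with
  | falsum => rfl
  | equal t₁ t₂ =>
    exact atomic (BoundedFormula.equal t₁ t₂) (BoundedFormula.IsAtomic.equal t₁ t₂).isQF
      s σ τ hσ hτ F F' hF hF' v w v' w' hv hw hv' hw'
  | rel R ts =>
    exact atomic (BoundedFormula.rel R ts) (BoundedFormula.IsAtomic.rel R ts).isQF
      s σ τ hσ hτ F F' hF hF' v w v' w' hv hw hv' hw'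
  | imp φ ψ ih1 ih2 =>
    rw [BoundedFormula.realize_imp, BoundedFormula.realize_imp]
    exact imp_congr (ih1 s σ τ hσ hτ F F' hF hF' v w v' w' hv hw hv' hw')
      (ih2 s σ τ hσ hτ F F' hF hF' v w v' w' hv hw hv' hw')
  | @all n φ ih =>
    have key : ∀ (σ τ : J → J) (_ : StrictMonoOn σ s) (_ : StrictMonoOn τ s)
        (v w : β → hullS L D G Set.univ) (v' w' : Fin n → hullS L D G Set.univ)
        (_ : ∀ b, (v b : UProd (iterU D J) (fun _ => X)) = el D (F b) σ)
        (_ : ∀ b, (w b : UProd (iterU D J) (fun _ => X)) = el D (F b) τ)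
        (_ : ∀ b, (v' b : UProd (iterU D J) (fun _ => X)) = el D (F' b) σ)
        (_ : ∀ b, (w' b : UProd (iterU D J) (fun _ => X)) = el D (F' b) τ),
        φ.all.Realize v v' → φ.all.Realize w w' := by
      intro σ τ hσ hτ v w v' w' hv hw hv' hw' h
      rw [BoundedFormula.realize_all] at h ⊢
      intro b
      obtain ⟨u, F₁, -, hF₁, hb⟩ := exists_good D b.2
      obtain ⟨ρ, h1, h2, -⟩ := hJ.exists_reindex s u σ τ hσ hτ fun _ _ => trivial
      have hF₂ : Good L D G (s.image τ ∪ u) F₁ := hF₁.mono D Finset.subset_union_right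
      have hmem : el D F₁ ρ ∈ hullS L D G Set.univ := hF₂.mem D h2 fun _ _ => Set.mem_univ _
      have hφ := h ⟨_, hmem⟩
      refine (ih _ ρ id h2 (fun _ _ _ _ h => h) (fun b ω => F b (ω ∘ τ))
        (Fin.snoc (α := fun _ => (J → X) → X) (fun b ω => F' b (ω ∘ τ)) F₁)
        (fun b => ((hF b).comp D hτ).mono D Finset.subset_union_left) ?_ v w _ _ ?_ ?_ ?_ ?_).1 hφ
      · refine Fin.lastCases ?_ fun i => ?_
        · rw [Fin.snoc_last]
          exact hF₂
        · rw [Fin.snoc_castSucc]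
          exact ((hF' i).comp D hτ).mono D Finset.subset_union_left
      · exact fun b => (hv b).trans (el_comp_eq D (hF b).1 fun j hj => (h1 j hj).symm)
      · exact hw
      · refine Fin.lastCases ?_ fun i => ?_
        · rw [Fin.snoc_last, Fin.snoc_last]
        · rw [Fin.snoc_castSucc, Fin.snoc_castSucc]
          exact (hv' i).trans (el_comp_eq D (hF' i).1 fun j hj => (h1 j hj).symm)
      · refine Fin.lastCases ?_ fun i => ?_
        · rw [Fin.snoc_last, Fin.snoc_last]
          exact hb.symm
        · rw [Fin.snoc_castSucc, Fin.snoc_castSucc]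
          exact hw' i
    exact ⟨key σ τ hσ hτ v w v' w' hv hw hv' hw', key τ σ hτ hσ w v w' v' hw hv hw' hv'⟩

end Indiscernible

section Blocks

/-- The index order: a reversed order of blocks, each a copy of the rationals. -/
abbrev Idx (B : Type u) [LinearOrder B] : Type u := Bᵒᵈ ×ₗ ℚ

variable {B : Type u} [LinearOrder B]

/-- The block of an index. -/
def blk (j : Idx B) : B := OrderDual.ofDual (ofLex j).1

/-- The rational coordinate of an index. -/
def rat (j : Idx B) : ℚ := (ofLex j).2

/-- The index with given block and rational coordinate. -/
def idx (b : B) (q : ℚ) : Idx B := toLex (OrderDual.toDual b, q)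

@[simp] theorem blk_idx (b : B) (q : ℚ) : blk (idx b q) = b := rfl

@[simp] theorem rat_idx (b : B) (q : ℚ) : rat (idx b q) = q := rfl

theorem idx_lt_iff {i j : Idx B} : i < j ↔ blk j < blk i ∨ blk i = blk j ∧ rat i < rat j :=
  Prod.Lex.lt_iff

/-- The union of a set of blocks. -/
def blocks (C : Set B) : Set (Idx B) := {j | blk j ∈ C}

theorem blocks_univ : blocks (Set.univ : Set B) = Set.univ := rfl

theorem blocks_mono {C C' : Set B} (h : C ⊆ C') : blocks C ⊆ blocks C' := fun _ hj => h hj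

theorem filling_blocks {C : Set B} (hC : C.Nonempty) : Filling (blocks C) := by
  classical
  obtain ⟨c, hc⟩ := hC
  have : Nonempty (blocks C) := ⟨⟨idx c 0, hc⟩⟩
  have : NoMaxOrder (blocks C) := ⟨fun j => ⟨⟨idx (blk j.1) (rat j.1 + 1), j.2⟩,
    idx_lt_iff.2 (Or.inr ⟨rfl, lt_add_one _⟩)⟩⟩
  have : NoMinOrder (blocks C) := ⟨fun j => ⟨⟨idx (blk j.1) (rat j.1 - 1), j.2⟩,
    idx_lt_iff.2 (Or.inr ⟨rfl, sub_one_lt _⟩)⟩⟩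
  have : DenselyOrdered (blocks C) := by
    refine ⟨fun i j hij => ?_⟩
    rcases idx_lt_iff.1 (show i.1 < j.1 from hij) with h | ⟨h1, h2⟩
    · exact ⟨⟨idx (blk i.1) (rat i.1 + 1), i.2⟩, idx_lt_iff.2 (Or.inr ⟨rfl, lt_add_one _⟩),
        idx_lt_iff.2 (Or.inl h)⟩
    · obtain ⟨q, hq1, hq2⟩ := exists_between h2
      exact ⟨⟨idx (blk i.1) q, i.2⟩, idx_lt_iff.2 (Or.inr ⟨rfl, hq1⟩),
        idx_lt_iff.2 (Or.inr ⟨h1, hq2⟩)⟩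
  intro A B hA hB hAB
  obtain ⟨z, h1, h2⟩ := Order.exists_between_finsets (A.subtype (· ∈ blocks C))
    (B.subtype (· ∈ blocks C)) fun x hx y hy =>
      hAB x (Finset.mem_subtype.1 hx) y (Finset.mem_subtype.1 hy)
  exact ⟨z, z.2, fun a ha => h1 ⟨a, hA ha⟩ (Finset.mem_subtype.2 ha),
    fun b hb => h2 ⟨b, hB hb⟩ (Finset.mem_subtype.2 hb)⟩

theorem filling_univ [Nonempty B] : Filling (Set.univ : Set (Idx B)) := by
  rw [← blocks_univ]
  exact filling_blocks Set.univ_nonempty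

theorem mk_idx [Infinite B] : #(Idx B) = #B := by
  have h1 : #(Idx B) = #(B × ℚ) := rfl
  rw [h1, mk_prod, lift_uzero, mk_eq_aleph0 ℚ, lift_aleph0]
  exact mul_aleph0_eq (aleph0_le_mk B)

end Blocks

section StrictGeneration

variable {B : Type u} [LinearOrder B] {L : FirstOrder.Language.{u, u}} {X : Type u} [L.Structure X]
  [Nonempty X] (D : Ultrafilter X)

theorem el_proj_mem_gens {J : Type u} [LinearOrder J] {G : Set (Fn J X)} {j₀ : J}
    (h : Fn.proj j₀ ∈ G) {A : Set J} {j : J} (hj : j ∈ A) :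
    el D (fun ω => ω j) id ∈ gens D G A := by
  refine ⟨_, h, fun _ => j, ?_, fun _ _ => hj, rfl⟩
  intro a ha b hb hab
  have ha' : a = j₀ := Finset.mem_singleton.1 ha
  have hb' : b = j₀ := Finset.mem_singleton.1 hb
  exact absurd hab (by rw [ha', hb']; exact lt_irrefl _)

theorem el_const_mem {J : Type u} [LinearOrder J] {G : Set (Fn J X)} {x : X}
    (h : Fn.const x ∈ G) (A : Set J) : el D (fun _ => x) id ∈ hullS L D G A :=
  Substructure.subset_closure ⟨_, h, id, fun _ h => by simp [Fn.const] at h,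
    fun _ h => by simp [Fn.const] at h, rfl⟩

theorem el_proj_injective {J : Type u} [LinearOrder J]
    (hD : ∀ x, ∀ᶠ y in (D : Filter X), y ≠ x) :
    Function.Injective fun j : J => el D (fun ω => ω j) id := by
  intro i j hij
  by_contra hne
  have h1 : ∀ᶠ ω in (iterU D J : Filter (J → X)), ω i = ω j := (UProd.mk_eq_mk _).1 hij
  obtain ⟨ω, h, h'⟩ := (h1.and (eventually_iterU_ne D hD i j hne)).exists
  exact h' h

theorem blk_mem_of_el_mem_hullS (hD : ∀ x, ∀ᶠ y in (D : Filter X), y ≠ x)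
    {G : Set (Fn (Idx B) X)} {C : Set B} {j : Idx B}
    (h : el D (fun ω => ω j) id ∈ hullS L D G (blocks C)) : blk j ∈ C := by
  classical
  by_contra hC
  obtain ⟨s, F, hs, hF, hFx⟩ := exists_good D h
  let j' : Idx B := idx (blk j) (rat j + 1)
  have hjj' : j ≠ j' := fun h => by
    have := congrArg rat h
    simp [j'] at this
  have hbs : ∀ i ∈ s, blk i ≠ blk j := fun i hi h => hC (h ▸ hs hi)
  have hjs : ∀ i ∈ s, i ≠ j := fun i hi h => hbs i hi (h ▸ rfl)
  let σ : Idx B → Idx B := Function.update id j j'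
  have hσ : StrictMonoOn σ ((insert j s : Finset (Idx B)) : Set (Idx B)) := by
    intro a ha b hb hab
    have hσj : σ j = j' := Function.update_self ..
    have hσs : ∀ i ∈ s, σ i = i := fun i hi => Function.update_of_ne (hjs i hi) ..
    rcases Finset.mem_insert.1 (Finset.mem_coe.1 ha) with ha' | ha' <;>
      rcases Finset.mem_insert.1 (Finset.mem_coe.1 hb) with hb' | hb'
    · exact absurd hab (by rw [ha', hb']; exact lt_irrefl _)
    · rw [ha'] at hab
      rw [ha', hσj, hσs b hb']
      rcases idx_lt_iff.1 hab with h | h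
      · exact idx_lt_iff.2 (Or.inl h)
      · exact absurd h.1.symm (hbs b hb')
    · rw [hb'] at hab
      rw [hb', hσj, hσs a ha']
      rcases idx_lt_iff.1 hab with h | h
      · exact idx_lt_iff.2 (Or.inl h)
      · exact absurd h.1 (hbs a ha')
    · rwa [hσs a ha', hσs b hb']
  have h1 : ∀ᶠ ω in (iterU D (Idx B) : Filter (Idx B → X)), F ω = ω j := (UProd.mk_eq_mk _).1 hFx
  have hdep : DependsOn (fun ω : Idx B → X => F ω = ω j)
      ((insert j s : Finset (Idx B)) : Set (Idx B)) := by
    intro ω ω' h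
    have e1 : F ω = F ω' := hF.1 fun i hi => h i (by simp [Finset.mem_coe.1 hi])
    have e2 : ω j = ω' j := h j (by simp)
    simp only [e1, e2]
  have h2 := (eventually_iterU_comp D _ _ hdep σ hσ).2 h1
  obtain ⟨ω, h, h', h''⟩ := (h1.and (h2.and (eventually_iterU_ne D hD j j' hjj'))).exists
  have e1 : F (ω ∘ σ) = F ω := hF.1 fun i hi => by
    simp [σ, Function.update_of_ne (hjs i (Finset.mem_coe.1 hi))]
  have e2 : (ω ∘ σ) j = ω j' := by simp [σ]
  rw [e1, e2] at h'
  exact h'' (h.symm.trans h')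

theorem mk_gens_le [Infinite B] {G : Set (Fn (Idx B) X)} (hG : #G ≤ #B) (A : Set (Idx B)) :
    #(gens D G A) ≤ #B := by
  have hinf : ℵ₀ ≤ #B := aleph0_le_mk B
  let T := Σ F : G, (F.1.supp → Idx B)
  have hsurj : ∀ x : gens D G A, ∃ t : T, ∀ σ : Idx B → Idx B,
      (∀ j : t.1.1.supp, σ j = t.2 j) → el D t.1.1.toFun σ = x := by
    rintro ⟨x, F, hF, σ, -, -, rfl⟩
    exact ⟨⟨⟨F, hF⟩, fun j => σ j⟩, fun τ hτ => el_congr D F.dep fun j hj => hτ ⟨j, hj⟩⟩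
  choose f hf using hsurj
  have hinj : Function.Injective f := by
    intro x y hxy
    classical
    refine Subtype.ext ?_
    let σ : Idx B → Idx B := fun j => if h : j ∈ (f x).1.1.supp then (f x).2 ⟨j, h⟩ else j
    have hσ : ∀ j : (f x).1.1.supp, σ j = (f x).2 j := fun j => by simp [σ]
    rw [← hf x σ hσ, ← hf y σ (by rw [← hxy]; exact hσ), hxy]
  refine (mk_le_of_injective hinj).trans ?_
  rw [mk_sigma]
  refine (sum_le_mk_mul_iSup _).trans (mul_le_of_le hinf hG (ciSup_le' fun F => ?_))
  rw [← power_def, mk_idx]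
  rw [mk_coe_finset]
  exact power_nat_le hinf

theorem strictlyGenerated_hullS [Infinite B] (hD : ∀ x, ∀ᶠ y in (D : Filter X), y ≠ x)
    (hB : ℵ₀ < #B) {G : Set (Fn (Idx B) X)} (hG : #G ≤ #B) {j₀ : Idx B} (hj₀ : Fn.proj j₀ ∈ G) :
    StrictlyGenerated L (hullS L D G Set.univ) #B := by
  classical
  refine ⟨⟨Subtype.val ⁻¹' (gens D G Set.univ), ?_, ?_⟩, ?_⟩
  · rw [mk_preimage_of_injective_of_subset_range _ _ Subtype.val_injective
      (by rw [Subtype.range_coe]; exact Substructure.subset_closure)]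
    refine le_antisymm (mk_gens_le D hG _) ?_
    rw [← mk_idx]
    exact mk_le_of_injective (f := fun j : Idx B => (⟨_, el_proj_mem_gens D hj₀ (Set.mem_univ j)⟩ :
      gens D G Set.univ)) fun i j h => el_proj_injective D hD (congrArg Subtype.val h)
  · rw [Generates, eq_top_iff]
    rintro ⟨x, hx⟩ -
    refine Substructure.closure_induction' (L := L) (gens D G Set.univ)
      (p := fun x hx => (⟨x, hx⟩ : hullS L D G Set.univ) ∈
        Substructure.closure L (Subtype.val ⁻¹' (gens D G Set.univ))) ?_ ?_ hx
    · intro x hx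
      exact Substructure.subset_closure hx
    · intro n f x hx
      choose hx1 hx2 using hx
      exact ⟨_, Substructure.fun_mem _ f _ hx2⟩
  · rintro ν hν ⟨Y, hY, hgen⟩
    have hs : ∀ y : Y, ∃ s : Finset (Idx B), (y.1 : UProd (iterU D (Idx B)) fun _ => X) ∈
        hullS L D G (s : Set (Idx B)) := by
      intro y
      obtain ⟨s, F, -, hF, hx⟩ := exists_good D y.1.2
      refine ⟨s, ?_⟩
      rw [← hx]
      exact hF.mem D (fun _ _ _ _ h => h) fun j hj => hj
    choose s hs using hs
    let C : Set B := ⋃ y : Y, blk '' (s y : Set (Idx B))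
    have hC : #C < #B := by
      refine (mk_iUnion_le_sum_mk).trans_lt ?_
      refine (sum_le_mk_mul_iSup _).trans_lt (mul_lt_of_lt hB.le (hY ▸ hν) ?_)
      refine lt_of_le_of_lt (ciSup_le' fun y => ?_) hB
      exact ((s y).finite_toSet.image blk).lt_aleph0.le
    obtain ⟨b, hb⟩ : ∃ b, b ∉ C := by
      by_contra hcon
      push Not at hcon
      rw [Set.eq_univ_of_forall hcon, mk_univ] at hC
      exact lt_irrefl _ hC
    refine hb (blk_mem_of_el_mem_hullS (L := L) (G := G) D hD (j := idx b 0) ?_)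
    have hle : Substructure.closure L Y ≤
        (hullS L D G (blocks C)).comap (hullS L D G Set.univ).subtype.toHom := by
      rw [Substructure.closure_le]
      intro y hy
      refine hullS_mono D subset_rfl ?_ (hs ⟨y, hy⟩)
      intro j hj
      exact Set.mem_iUnion.2 ⟨⟨y, hy⟩, j, hj, rfl⟩
    rw [show Substructure.closure L Y = ⊤ from hgen] at hle
    exact hle (x := ⟨_, Substructure.subset_closure (el_proj_mem_gens D hj₀
      (Set.mem_univ (idx b 0)))⟩) trivial

end StrictGeneration

section Branches

variable {L : FirstOrder.Language.{u, u}} {N : Type u} [L.Structure N]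

theorem FinSat.transfer [Nonempty N] {α V : Type*} {v v' : α → N}
    (h : ∀ ψ : L.Formula α, ψ.Realize v ↔ ψ.Realize v') {p : Set (L.Formula (α ⊕ V))}
    (hp : FinSat v p) : FinSat v' p := by
  intro s hs
  obtain ⟨ψ, hψ⟩ := FinSat.exists_formula s
  rw [← hψ, ← h, hψ]
  exact hp s hs

theorem HasSS.map {N' : Type u} [L.Structure N'] (f : N ↪ₑ[L] N') (h : HasSS L N) :
    HasSS L N' := by
  obtain ⟨a, c, φ, h1, h2⟩ := h
  have key : ∀ (β : Type) (ψ : L.Formula β) (v : β → N) (v' : β → N'), (∀ b, v' b = f (v b)) →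
      (ψ.Realize v' ↔ ψ.Realize v) := by
    intro β ψ v v' h
    rw [← f.map_formula]
    exact iff_of_eq (congrArg _ (funext h))
  refine ⟨f a, fun n b l => f (c n b l), φ, fun n => ?_, fun n => ?_⟩
  · rw [key _ (φ n) (pointed a (c n false)) _ (by rintro (_ | l) <;> rfl),
      key _ (φ n) (pointed a (c n true)) _ (by rintro (_ | l) <;> rfl)]
    exact h1 n
  · obtain ⟨d, hd⟩ := h2 n
    refine ⟨fun i l => f (d i l), fun i j hij ψ => ?_⟩
    rw [key _ ψ _ _ ?_, hd i j hij, key _ ψ _ _ ?_]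
    · rintro (p | p) <;> rfl
    · rintro (p | ⟨_ | _, l⟩) <;> rfl

variable (L) in
/-- The first `n` levels of `g` and `c` have the same type. -/
def SameType (n : ℕ) (g c : ℕ → Bool → ℕ → N) : Prop :=
  ∀ ψ : L.Formula (Fin n × Bool × ℕ), ψ.Realize (fun p => g p.1 p.2.1 p.2.2) ↔
    ψ.Realize (fun p => c p.1 p.2.1 p.2.2)

theorem SameType.of_forall {g c : ℕ → Bool → ℕ → N} (h : ∀ n, SameType L n g c)
    (ψ : L.Formula (ℕ × Bool × ℕ)) :
    ψ.Realize (fun p => g p.1 p.2.1 p.2.2) ↔ ψ.Realize (fun p => c p.1 p.2.1 p.2.2) := by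
  classical
  obtain ⟨n, hn⟩ : ∃ n, ∀ p ∈ fsupp ψ, p.1 < n + 1 :=
    ⟨(fsupp ψ).sup fun p => p.1, fun p hp => Nat.lt_succ_of_le
      (Finset.le_sup (f := fun p : ℕ × Bool × ℕ => p.1) hp)⟩
  let r : ℕ × Bool × ℕ → Fin (n + 1) × Bool × ℕ := fun p => (Fin.ofNat (n + 1) p.1, p.2)
  have h1 := h (n + 1) (Formula.relabel r ψ)
  simp only [Formula.realize_relabel] at h1
  have key : ∀ g : ℕ → Bool → ℕ → N, ψ.Realize (fun p => g p.1 p.2.1 p.2.2) ↔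
      ψ.Realize ((fun p : Fin (n + 1) × Bool × ℕ => g p.1 p.2.1 p.2.2) ∘ r) := by
    intro g
    refine realize_congr_fsupp ψ fun p hp => ?_
    simp only [Function.comp_apply, r, Fin.ofNat, Nat.mod_eq_of_lt (hn p hp)]
  rw [key, key, h1]

theorem exists_sequence [Nonempty N] {S : ℕ → Set N} {V V' : Type u} [LinearOrder V]
    (ι : V × ℕ ↪ V') (hS : ∀ n, RealizesOver L (S n) (S (n + 1)) V')
    {c : ℕ → Bool → ℕ → N} {n : ℕ} {d : ℕ → ℕ → N}
    (hd : ∀ i j, i < j → ∀ ψ : L.Formula ((Fin n × Bool × ℕ) ⊕ (Bool × ℕ)),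
      ψ.Realize (Sum.elim (fun p => c p.1 p.2.1 p.2.2) fun p => cond p.1 (d j) (d i) p.2) ↔
        ψ.Realize (Sum.elim (fun p => c p.1 p.2.1 p.2.2) fun p => c n p.1 p.2))
    {g : ℕ → Bool → ℕ → N} (hg : SameType L n g c) (hgS : ∀ m < n, ∀ b i, g m b i ∈ S n) :
    ∃ r : V → ℕ → N, (∀ v i, r v i ∈ S (n + 1)) ∧ ∀ v v', v < v' →
      SameType L (n + 1) (Function.update g n fun b => cond b (r v') (r v)) c := by
  classical
  let rel : V → V → (Fin n × Bool × ℕ) ⊕ (Bool × ℕ) → (Fin n × Bool × ℕ) ⊕ (V × ℕ) :=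
    fun v v' => Sum.map id fun p => (cond p.1 v' v, p.2)
  let p : Set (L.Formula ((Fin n × Bool × ℕ) ⊕ (V × ℕ))) :=
    {χ | ∃ (v v' : V) (ψ : L.Formula ((Fin n × Bool × ℕ) ⊕ (Bool × ℕ))), v < v' ∧
      ψ.Realize (Sum.elim (fun p => c p.1 p.2.1 p.2.2) fun p => c n p.1 p.2) ∧
      χ = Formula.relabel (rel v v') ψ}
  have hrel : ∀ (v v' : V) (ψ : L.Formula ((Fin n × Bool × ℕ) ⊕ (Bool × ℕ)))
      (x : Fin n × Bool × ℕ → N) (w : V × ℕ → N), (Formula.relabel (rel v v') ψ).Realize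
        (Sum.elim x w) ↔ ψ.Realize (Sum.elim x fun p => w (cond p.1 v' v, p.2)) := by
    intro v v' ψ x w
    rw [Formula.realize_relabel]
    refine iff_of_eq (congrArg _ ?_)
    funext q
    rcases q with q | q <;> rfl
  have hp : FinSat (fun p : Fin n × Bool × ℕ => c p.1 p.2.1 p.2.2) p := by
    intro s hs
    have hs' : ∀ χ : s, ∃ (v v' : V) (ψ : L.Formula ((Fin n × Bool × ℕ) ⊕ (Bool × ℕ))), v < v' ∧
      ψ.Realize (Sum.elim (fun p => c p.1 p.2.1 p.2.2) fun p => c n p.1 p.2) ∧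
      χ.1 = Formula.relabel (rel v v') ψ := fun χ => hs χ.2
    choose v v' ψ hvv' hψ hχ using hs'
    let T : Finset V := Finset.univ.image v
    let e : V → ℕ := fun x => (T.filter (· < x)).card
    refine ⟨fun q => d (e q.1) q.2, fun χ hχs => ?_⟩
    refine (iff_of_eq (congrArg (fun x => Formula.Realize x _) (hχ ⟨χ, hχs⟩))).2
      ((hrel _ _ _ _ _).2 ?_)
    have hlt : e (v ⟨χ, hχs⟩) < e (v' ⟨χ, hχs⟩) := by
      refine Finset.card_lt_card ⟨fun x hx => ?_, fun h => ?_⟩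
      · rw [Finset.mem_filter] at hx ⊢
        exact ⟨hx.1, hx.2.trans (hvv' _)⟩
      · have := h (Finset.mem_filter.2 ⟨Finset.mem_image_of_mem v (Finset.mem_univ ⟨χ, hχs⟩),
          hvv' _⟩)
        exact lt_irrefl _ (Finset.mem_filter.1 this).2
    have h1 := (hd _ _ hlt (ψ ⟨χ, hχs⟩)).2 (hψ _)
    refine (iff_of_eq (congrArg _ ?_)).1 h1
    funext q
    rcases q with q | ⟨_ | _, l⟩ <;> rfl
  obtain ⟨w, hw1, hw2⟩ := (hS n).exists_realize ι (fun p : Fin n × Bool × ℕ => g p.1 p.2.1 p.2.2)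
    (fun p => hgS p.1 p.1.2 _ _) p (hp.transfer fun ψ => (hg ψ).symm)
  refine ⟨fun v i => w (v, i), fun v i => hw1 _, fun v v' hvv' ψ => ?_⟩
  let t : Fin (n + 1) × Bool × ℕ → (Fin n × Bool × ℕ) ⊕ (Bool × ℕ) := fun q =>
    Fin.lastCases (motive := fun _ => (Fin n × Bool × ℕ) ⊕ (Bool × ℕ)) (Sum.inr q.2)
      (fun i => Sum.inl (i, q.2)) q.1
  have ht : ∀ (g : ℕ → Bool → ℕ → N) (ψ : L.Formula (Fin (n + 1) × Bool × ℕ)),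
      ψ.Realize (fun p => g p.1 p.2.1 p.2.2) ↔ (Formula.relabel t ψ).Realize
        (Sum.elim (fun p : Fin n × Bool × ℕ => g p.1 p.2.1 p.2.2) fun p => g n p.1 p.2) := by
    intro g ψ
    rw [Formula.realize_relabel]
    refine iff_of_eq (congrArg _ ?_)
    funext ⟨i, q⟩
    refine Fin.lastCases ?_ (fun i => ?_) i
    · simp [t]
    · simp [t]
  have key : ∀ ψ : L.Formula ((Fin n × Bool × ℕ) ⊕ (Bool × ℕ)),
      ψ.Realize (Sum.elim (fun p => c p.1 p.2.1 p.2.2) fun p => c n p.1 p.2) →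
      ψ.Realize (Sum.elim (fun p => g p.1 p.2.1 p.2.2) fun p => cond p.1 (fun i => w (v', i))
        (fun i => w (v, i)) p.2) := by
    intro ψ hψ
    have h1 := (hrel v v' ψ _ _).1 (hw2 _ ⟨v, v', ψ, hvv', hψ, rfl⟩)
    refine (iff_of_eq (congrArg _ ?_)).1 h1
    funext q
    rcases q with q | ⟨_ | _, l⟩ <;> rfl
  have key' : ∀ ψ : L.Formula ((Fin n × Bool × ℕ) ⊕ (Bool × ℕ)),
      ψ.Realize (Sum.elim (fun p => g p.1 p.2.1 p.2.2) fun p => cond p.1 (fun i => w (v', i))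
        (fun i => w (v, i)) p.2) ↔
      ψ.Realize (Sum.elim (fun p => c p.1 p.2.1 p.2.2) fun p => c n p.1 p.2) := by
    intro ψ
    refine ⟨fun h => ?_, key ψ⟩
    by_contra hcon
    have := key ψ.not (Formula.realize_not.2 hcon)
    exact Formula.realize_not.1 this h
  rw [ht c, ht, ← key']
  refine iff_of_eq (congrArg _ ?_)
  funext q
  rcases q with ⟨i, q⟩ | q
  · simp [i.2.ne]
  · simp

theorem exists_realize_branch [Nonempty N] {X : Type u} [L.Structure X] (f : N ↪ₑ[L] X)
    {V : Type u} [Nonempty V] (hf : RealizesOver L (Set.range f) Set.univ V)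
    {g c : ℕ → Bool → ℕ → N} (hg : ∀ n, SameType L n g c) (a : N) :
    ∃ x : X, ∀ (n : ℕ) (b : Bool) (φ : L.Formula (Option ℕ)),
      φ.Realize (pointed x fun i => f (g n b i)) ↔ φ.Realize (pointed a (c n b)) := by
  have : Nonempty X := Nonempty.map f inferInstance
  let p : Set (L.Formula ((ℕ × Bool × ℕ) ⊕ Unit)) :=
    {χ | χ.Realize (Sum.elim (fun p => c p.1 p.2.1 p.2.2) fun _ => a)}
  have hp : FinSat (fun p : ℕ × Bool × ℕ => c p.1 p.2.1 p.2.2) p :=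
    fun s hs => ⟨fun _ => a, fun φ hφ => hs hφ⟩
  have hp' : FinSat (f ∘ fun p : ℕ × Bool × ℕ => g p.1 p.2.1 p.2.2) p :=
    (finSat_comp_iff f _ p).2 (hp.transfer fun ψ => (SameType.of_forall hg ψ).symm)
  obtain ⟨w, -, hw⟩ := hf.exists_realize (W := Unit)
    ⟨fun _ => Classical.arbitrary V, fun _ _ _ => rfl⟩ _ (fun q => ⟨_, rfl⟩) p hp'
  have hw' : ∀ χ : L.Formula ((ℕ × Bool × ℕ) ⊕ Unit),
      χ.Realize (Sum.elim (f ∘ fun p : ℕ × Bool × ℕ => g p.1 p.2.1 p.2.2) w) ↔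
        χ.Realize (Sum.elim (fun p => c p.1 p.2.1 p.2.2) fun _ => a) := by
    intro χ
    refine ⟨fun h => ?_, fun h => hw χ h⟩
    by_contra hcon
    exact Formula.realize_not.1 (hw χ.not (Formula.realize_not.2 hcon)) h
  refine ⟨w (), fun n b φ => ?_⟩
  have h := hw' (Formula.relabel
    (fun o : Option ℕ => o.elim (Sum.inr ()) fun i => Sum.inl (n, b, i)) φ)
  rw [Formula.realize_relabel, Formula.realize_relabel] at h
  refine Iff.trans (iff_of_eq (congrArg _ ?_)) (h.trans (iff_of_eq (congrArg _ ?_)))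
  · funext o; cases o <;> rfl
  · funext o; cases o <;> rfl

end Branches

section Nodes

variable {L : FirstOrder.Language.{u, u}} {N : Type u} [L.Structure N]

variable (L) in
/-- The first `n` levels of `g` lie in `S n` and have the same type as those of `c`. -/
def Approx (S : ℕ → Set N) (c : ℕ → Bool → ℕ → N) (n : ℕ) (g : ℕ → Bool → ℕ → N) : Prop :=
  SameType L n g c ∧ ∀ m < n, ∀ b i, g m b i ∈ S n

theorem Approx.exists_next [Nonempty N] {S : ℕ → Set N} (hSm : ∀ n, S n ⊆ S (n + 1))
    {V : Type u} [LinearOrder V] (hS : ∀ n, RealizesOver L (S n) (S (n + 1)) (V × ULift.{u} ℕ))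
    {c : ℕ → Bool → ℕ → N}
    (hd : ∀ n, ∃ d : ℕ → ℕ → N, ∀ i j, i < j →
      ∀ ψ : L.Formula ((Fin n × Bool × ℕ) ⊕ (Bool × ℕ)),
      ψ.Realize (Sum.elim (fun p => c p.1 p.2.1 p.2.2) fun p => cond p.1 (d j) (d i) p.2) ↔
        ψ.Realize (Sum.elim (fun p => c p.1 p.2.1 p.2.2) fun p => c n p.1 p.2))
    {n : ℕ} {g : ℕ → Bool → ℕ → N} (hg : Approx L S c n g) {Z : Type u}
    (hZ : (2 : Cardinal.{u}) ^ #Z < #V) (test : (ℕ → N) → Set Z) :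
    ∃ g', (∀ m < n, g' m = g m) ∧ Approx L S c (n + 1) g' ∧
      test (g' n false) = test (g' n true) := by
  obtain ⟨d, hd⟩ := hd n
  obtain ⟨r, hr1, hr2⟩ := exists_sequence (V := V)
    ⟨fun p => (p.1, ULift.up p.2), fun p q h => by simpa [Prod.ext_iff] using h⟩ hS hd hg.1 hg.2
  obtain ⟨v, v', hne, heq⟩ : ∃ v v', v ≠ v' ∧ test (r v) = test (r v') := by
    by_contra hcon
    push Not at hcon
    have : Function.Injective fun v => test (r v) := fun v v' h => by
      by_contra hne
      exact hcon v v' hne h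
    have := mk_le_of_injective this
    rw [mk_set] at this
    exact absurd hZ (not_lt.2 this)
  wlog hlt : v < v' generalizing v v'
  · exact this v' v hne.symm heq.symm (lt_of_le_of_ne (not_lt.1 hlt) hne.symm)
  refine ⟨_, fun m hm => Function.update_of_ne hm.ne _ _, ⟨hr2 v v' hlt, ?_⟩, ?_⟩
  · intro m hm b i
    rcases Nat.lt_succ_iff_lt_or_eq.1 hm with hm | rfl
    · rw [Function.update_of_ne hm.ne]
      exact hSm n (hg.2 m hm b i)
    · rw [Function.update_self]
      cases b
      · exact hr1 _ _
      · exact hr1 _ _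
  · rw [Function.update_self]
    exact heq

theorem Approx.congr {S : ℕ → Set N} {c : ℕ → Bool → ℕ → N} {n : ℕ} {g g' : ℕ → Bool → ℕ → N}
    (hg : Approx L S c n g) (h : ∀ m < n, g' m = g m) : Approx L S c n g' := by
  refine ⟨fun ψ => ?_, fun m hm b i => by rw [h m hm]; exact hg.2 m hm b i⟩
  rw [← hg.1 ψ]
  refine iff_of_eq (congrArg _ (funext fun p => ?_))
  rw [h p.1 p.1.2]

/-- The node of a tree of approximations at a finite sequence, the last term coming first. -/
def node {Ω Y E : Type*} (next : Y → ℕ → E → E) (g₀ : E) (G : Ω → Y) : List Ω → E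
  | [] => g₀
  | β :: l => next (G β) l.length (node next g₀ G l)

theorem node_congr {Ω Y E : Type*} {next : Y → ℕ → E → E} {g₀ : E} {G G' : Ω → Y} {l : List Ω}
    (h : ∀ β ∈ l, G β = G' β) : node next g₀ G l = node next g₀ G' l := by
  induction l with
  | nil => rfl
  | cons β l ih =>
    rw [node, node, h β (by simp), ih fun β hβ => h β (by simp [hβ])]

/-- The first `n` terms of a sequence, in reversed order. -/
def initial {Ω : Type*} (e : ℕ → Ω) : ℕ → List Ω
  | 0 => []
  | n + 1 => e n :: initial e n

theorem length_initial {Ω : Type*} (e : ℕ → Ω) (n : ℕ) : (initial e n).length = n := by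
  induction n with
  | zero => rfl
  | succ n ih => rw [initial, List.length_cons, ih]

theorem exists_of_mem_initial {Ω : Type*} {e : ℕ → Ω} {n : ℕ} {β : Ω} (h : β ∈ initial e n) :
    ∃ k, e k = β := by
  induction n with
  | zero => simp [initial] at h
  | succ n ih =>
    rcases List.mem_cons.1 h with rfl | h
    · exact ⟨n, rfl⟩
    · exact ih h

theorem node_properties {Ω Y : Type*} {S : ℕ → Set N} {c : ℕ → Bool → ℕ → N}
    {next : Y → ℕ → (ℕ → Bool → ℕ → N) → (ℕ → Bool → ℕ → N)} {R : Y → (ℕ → N) → (ℕ → N) → Prop}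
    (hnext : ∀ y n g, Approx L S c n g → (∀ m < n, next y n g m = g m) ∧
      Approx L S c (n + 1) (next y n g) ∧ R y (next y n g n false) (next y n g n true))
    {g₀ : ℕ → Bool → ℕ → N} (hg₀ : Approx L S c 0 g₀) (G : Ω → Y) (e : ℕ → Ω) :
    (∀ n, Approx L S c n fun m => node next g₀ G (initial e (m + 1)) m) ∧
      ∀ n, R (G (e n)) (node next g₀ G (initial e (n + 1)) n false)
        (node next g₀ G (initial e (n + 1)) n true) := by
  have h1 : ∀ n, Approx L S c n (node next g₀ G (initial e n)) := by
    intro n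
    induction n with
    | zero => exact hg₀
    | succ n ih =>
      have := (hnext (G (e n)) n _ ih).2.1
      rwa [initial, node, length_initial]
  have h2 : ∀ n m, m < n → node next g₀ G (initial e n) m =
      node next g₀ G (initial e (m + 1)) m := by
    intro n m hm
    induction n with
    | zero => exact absurd hm (Nat.not_lt_zero m)
    | succ n ih =>
      rcases Nat.lt_succ_iff_lt_or_eq.1 hm with hm | rfl
      · rw [← ih hm, initial, node, length_initial]
        exact (hnext (G (e n)) n _ (h1 n)).1 m hm
      · rfl
  refine ⟨fun n => (h1 n).congr fun m hm => (h2 n m hm).symm, fun n => ?_⟩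
  have := (hnext (G (e n)) n _ (h1 n)).2.2
  rwa [initial, node, length_initial]

end Nodes

section Stages

variable {Ω : Type v} [LinearOrder Ω] {Y E : Type u}

/-- One step of the construction of the stages. -/
def stageStep {A : Type u} (next : Set A → ℕ → E → E) (g₀ : E) (tv : Set A → Set A)
    (cst : E → Set A) (top : (ℕ → E) → A) (e : Ω → ℕ → Ω) (a₀ : A) (G : Ω → Set A) (α : Ω) :
    Set A :=
  {a₀} ∪ (⋃ β < α, (G β ∪ tv (G β) ∪
    {top fun m => node next g₀ G (initial (e β) (m + 1))})) ∪
    ⋃ (l : List Ω) (_ : ∀ β ∈ l, β < α), cst (node next g₀ G l)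

theorem exists_stages [WellFoundedLT Ω] {A : Type u} (next : Set A → ℕ → E → E) (g₀ : E)
    (tv : Set A → Set A) (cst : E → Set A) (top : (ℕ → E) → A) (e : Ω → ℕ → Ω)
    (he : ∀ β n, e β n ≤ β) (a₀ : A) :
    ∃ G : Ω → Set A, ∀ α, G α = stageStep next g₀ tv cst top e a₀ G α := by
  classical
  have hcongr : ∀ (G G' : Ω → Set A) (α : Ω), (∀ β < α, G β = G' β) →
      stageStep next g₀ tv cst top e a₀ G α = stageStep next g₀ tv cst top e a₀ G' α := by
    intro G G' α h
    have h1 : ∀ l : List Ω, (∀ β ∈ l, β < α) → node next g₀ G l = node next g₀ G' l :=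
      fun l hl => node_congr fun β hβ => h β (hl β hβ)
    unfold stageStep
    congr 1
    · congr 1
      refine Set.iUnion_congr fun β => Set.iUnion_congr fun hβ => ?_
      rw [h β hβ]
      congr 3
      funext m
      refine h1 _ fun γ hγ => ?_
      obtain ⟨k, rfl⟩ := exists_of_mem_initial hγ
      exact (he β k).trans_lt hβ
    · refine Set.iUnion_congr fun l => Set.iUnion_congr fun hl => ?_
      rw [h1 l hl]
  let F : ∀ α : Ω, (∀ β, β < α → Set A) → Set A := fun α rec =>
    stageStep next g₀ tv cst top e a₀ (fun β => if h : β < α then rec β h else ∅) α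
  refine ⟨WellFounded.fix wellFounded_lt F, fun α => ?_⟩
  conv_lhs => rw [WellFounded.fix_eq]
  refine hcongr _ _ α fun β hβ => ?_
  simp only [dif_pos hβ]

variable {A : Type u} {next : Set A → ℕ → E → E} {g₀ : E}
    {tv : Set A → Set A} {cst : E → Set A} {top : (ℕ → E) → A} {e : Ω → ℕ → Ω} {a₀ : A}
    {G : Ω → Set A}

theorem stage_monotone (hG : ∀ α, G α = stageStep next g₀ tv cst top e a₀ G α) : Monotone G := by
  intro β α h
  rcases h.eq_or_lt with rfl | h
  · exact le_rfl
  rw [hG α]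
  exact fun x hx => Or.inl (Or.inr (Set.mem_iUnion₂.2 ⟨β, h, Or.inl (Or.inl hx)⟩))

theorem tv_subset_stage (hG : ∀ α, G α = stageStep next g₀ tv cst top e a₀ G α) {α β : Ω}
    (h : β < α) : tv (G β) ⊆ G α := by
  rw [hG α]
  exact fun x hx => Or.inl (Or.inr (Set.mem_iUnion₂.2 ⟨β, h, Or.inl (Or.inr hx)⟩))

theorem top_mem_stage (hG : ∀ α, G α = stageStep next g₀ tv cst top e a₀ G α) {α β : Ω}
    (h : β < α) : top (fun m => node next g₀ G (initial (e β) (m + 1))) ∈ G α := by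
  rw [hG α]
  exact Or.inl (Or.inr (Set.mem_iUnion₂.2 ⟨β, h, Or.inr rfl⟩))

theorem mem_stage (hG : ∀ α, G α = stageStep next g₀ tv cst top e a₀ G α) (α : Ω) :
    a₀ ∈ G α := by
  rw [hG α]
  exact Or.inl (Or.inl rfl)

theorem cst_subset_stage (hG : ∀ α, G α = stageStep next g₀ tv cst top e a₀ G α) {α : Ω}
    {l : List Ω} (h : ∀ β ∈ l, β < α) : cst (node next g₀ G l) ⊆ G α := by
  rw [hG α]
  exact fun x hx => Or.inr (Set.mem_iUnion₂.2 ⟨l, h, hx⟩)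

theorem exists_mem_stage (hG : ∀ α, G α = stageStep next g₀ tv cst top e a₀ G α) {δ : Ω}
    (hne : ∃ β, β < δ) (hlim : ∀ β < δ, ∃ γ < δ, β < γ) {x : A} (hx : x ∈ G δ) :
    ∃ β < δ, x ∈ G β := by
  have hx' := hx
  rw [hG δ] at hx'
  rcases hx' with (h | h) | h
  · obtain ⟨β, hβ⟩ := hne
    exact ⟨β, hβ, h ▸ mem_stage hG β⟩
  · obtain ⟨β, hβ, h⟩ := Set.mem_iUnion₂.1 h
    obtain ⟨γ, hγ, hβγ⟩ := hlim β hβ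
    rcases h with (h | h) | h
    · exact ⟨β, hβ, h⟩
    · exact ⟨γ, hγ, tv_subset_stage hG hβγ h⟩
    · exact ⟨γ, hγ, h ▸ top_mem_stage hG hβγ⟩
  · obtain ⟨l, hl, h⟩ := Set.mem_iUnion₂.1 h
    obtain ⟨γ, hγ, hlγ⟩ : ∃ γ < δ, ∀ β ∈ l, β < γ := by
      clear h
      induction l with
      | nil => exact hne.imp fun β h => ⟨h, by simp⟩
      | cons β l ih =>
        obtain ⟨γ, hγ, h⟩ := ih fun β hβ => hl β (by simp [hβ])
        obtain ⟨γ', hγ', h'⟩ := hlim β (hl β (by simp))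
        refine ⟨max γ γ', max_lt hγ hγ', fun β' hβ' => ?_⟩
        rcases List.mem_cons.1 hβ' with rfl | hβ'
        · exact lt_max_of_lt_right h'
        · exact lt_max_of_lt_left (h β' hβ')
    exact ⟨γ, hγ, cst_subset_stage hG hlγ h⟩

theorem countable_stage [WellFoundedLT Ω]
    (hG : ∀ α, G α = stageStep next g₀ tv cst top e a₀ G α)
    (hΩ : ∀ α : Ω, (Set.Iio α).Countable) (htv : ∀ Y, (tv Y).Countable)
    (hcst : ∀ x, (cst x).Countable) (α : Ω) : (G α).Countable := by
  induction α using WellFoundedLT.induction with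
  | ind α ih =>
    rw [hG α]
    refine ((Set.countable_singleton _).union ((hΩ α).biUnion fun β hβ => ?_)).union ?_
    · exact ((ih β hβ).union (htv _)).union (Set.countable_singleton _)
    · have : Countable (Set.Iio α) := hΩ α
      have h : {l : List Ω | ∀ β ∈ l, β < α}.Countable := by
        refine (Set.countable_range fun l : List (Set.Iio α) => l.map Subtype.val).mono ?_
        intro l hl
        exact ⟨l.attach.map fun β => ⟨β.1, hl β.1 β.2⟩, by simp⟩
      exact h.biUnion fun l _ => hcst _

end Stages

section Hulls

variable {J : Type u} [LinearOrder J] {L : FirstOrder.Language.{u, u}} {X : Type u}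
  [L.Structure X] [Nonempty X] (D : Ultrafilter X)

theorem exists_good_tuple {ι : Type*} [Finite ι] {G : Set (Fn J X)} {A : Set J}
    {v : ι → UProd (iterU D J) (fun _ => X)} (hv : ∀ i, v i ∈ hullS L D G A) :
    ∃ (s : Finset J) (F : ι → (J → X) → X), ↑s ⊆ A ∧ (∀ i, Good L D G s (F i)) ∧
      ∀ i, v i = el D (F i) id := by
  classical
  have := Fintype.ofFinite ι
  choose s F hs hF hx using fun i => exists_good D (hv i)
  refine ⟨Finset.univ.biUnion s, F, ?_, fun i => (hF i).mono D
    (Finset.subset_biUnion_of_mem s (Finset.mem_univ i)), fun i => (hx i).symm⟩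
  intro j hj
  obtain ⟨i, -, hi⟩ := Finset.mem_biUnion.1 (Finset.mem_coe.1 hj)
  exact hs i hi

theorem exists_mem_hullS_of_directed {Ω : Type*} [LinearOrder Ω] [Nonempty Ω]
    {G : Ω → Set (Fn J X)} (hG : Monotone G) {A : Set J} {x : UProd (iterU D J) (fun _ => X)}
    (hx : x ∈ hullS L D (⋃ α, G α) A) : ∃ α, x ∈ hullS L D (G α) A := by
  refine Substructure.closure_induction (p := fun x => ∃ α, x ∈ hullS L D (G α) A) hx ?_ ?_
  · rintro _ ⟨F, hF, σ, h1, h2, rfl⟩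
    obtain ⟨α, hα⟩ := Set.mem_iUnion.1 hF
    exact ⟨α, Substructure.subset_closure ⟨F, hα, σ, h1, h2, rfl⟩⟩
  · intro n f x hx
    choose α hα using hx
    obtain ⟨β, hβ⟩ : ∃ β, ∀ i, α i ≤ β := by
      obtain ⟨β, hβ⟩ := (Set.finite_range α).bddAbove
      exact ⟨β, fun i => hβ ⟨i, rfl⟩⟩
    exact ⟨β, Substructure.fun_mem _ f _ fun i => hullS_mono D (hG (hβ i)) subset_rfl (hα i)⟩

theorem exists_finset_mem_hullS {G : Set (Fn J X)} {A : Set J}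
    {x : UProd (iterU D J) (fun _ => X)} (hx : x ∈ hullS L D G A) :
    ∃ s : Finset J, ↑s ⊆ A ∧ x ∈ hullS L D G (s : Set J) := by
  obtain ⟨s, F, hs, hF, hx⟩ := exists_good D hx
  refine ⟨s, hs, ?_⟩
  rw [← hx]
  exact hF.mem D (fun _ _ _ _ h => h) fun j hj => hj

theorem countable_gens {G : Set (Fn J X)} (hG : G.Countable) {A : Set J} (hA : A.Countable) :
    (gens D G A).Countable := by
  classical
  have : Countable A := hA
  have h : gens D G A ⊆ ⋃ F ∈ G, Set.range fun t : F.supp → A =>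
      el D F.toFun fun j => if h : j ∈ F.supp then (t ⟨j, h⟩ : J) else j := by
    rintro x ⟨F, hF, σ, h1, h2, rfl⟩
    refine Set.mem_iUnion₂.2 ⟨F, hF, fun j => ⟨σ j, h2 j j.2⟩, el_congr D F.dep fun j hj => ?_⟩
    simp [hj]
  exact (hG.biUnion fun F _ => Set.countable_range _).mono h

theorem map_mem_of_mem_closure {M M' : Type u} [L.Structure M] [L.Structure M']
    {S : L.Substructure M} {S' : L.Substructure M'} (h : S →[L] S') {A : Set M} (hA : A ⊆ S)
    {P : L.Substructure M'} (H : ∀ x (hx : x ∈ A), (h ⟨x, hA hx⟩ : M') ∈ P) {x : S}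
    (hx : (x : M) ∈ Substructure.closure L A) : (h x : M') ∈ P := by
  have hle : Substructure.closure L A ≤
      ((P.comap S'.subtype.toHom).comap h).map S.subtype.toHom := by
    rw [Substructure.closure_le]
    exact fun x hx => ⟨⟨x, hA hx⟩, H x hx, rfl⟩
  obtain ⟨y, hy, hxy⟩ := hle hx
  have : y = x := Subtype.ext hxy
  exact this ▸ hy

end Hulls

section TarskiVaught

variable {J : Type u} [LinearOrder J] {L : FirstOrder.Language.{u, u}} {X : Type u}
  [L.Structure X] [Nonempty X] (D : Ultrafilter X)

/-- The height of a formula. -/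
def height {α : Type} : {n : ℕ} → L.BoundedFormula α n → ℕ
  | _, .falsum => 0
  | _, .equal _ _ => 0
  | _, .rel _ _ => 0
  | _, .imp φ ψ => max (height φ) (height ψ) + 1
  | _, .all φ => height φ + 1

variable (L) in
/-- The Tarski-Vaught test fails for the hull of `G` and a formula of height `r`. -/
def TVFail (G : Set (Fn J X)) (α : Type) (r : ℕ) : Prop :=
  ∃ (n : ℕ) (χ : L.BoundedFormula α (n + 1)) (v : α → UProd (iterU D J) (fun _ => X))
    (v' : Fin n → UProd (iterU D J) (fun _ => X)), height χ = r ∧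
    (∀ a, v a ∈ hullS L D G Set.univ) ∧ (∀ a, v' a ∈ hullS L D G Set.univ) ∧
    (∀ b ∈ hullS L D G Set.univ, χ.Realize v (Fin.snoc v' b)) ∧ ¬ χ.all.Realize v v'

variable (L) in
/-- The function `Y` witnesses a failure of the Tarski-Vaught test. -/
def TVSol (G : Set (Fn J X)) (α : Type) (r : ℕ) (Y : Fn J X) : Prop :=
  ∃ (n : ℕ) (χ : L.BoundedFormula α (n + 1)) (F : α → (J → X) → X) (F' : Fin n → (J → X) → X),
    height χ = r ∧ (∀ a, Good L D G Y.supp (F a)) ∧ (∀ a, Good L D G Y.supp (F' a)) ∧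
    (∀ b ∈ hullS L D G Set.univ,
      χ.Realize (fun a => el D (F a) id) (Fin.snoc (fun a => el D (F' a) id) b)) ∧
    ¬ χ.Realize (fun a => el D (F a) id) (Fin.snoc (fun a => el D (F' a) id) (el D Y.toFun id))

theorem el_realize_bounded {β : Type*} {n : ℕ} (φ : L.BoundedFormula β n)
    (F : β → (J → X) → X) (F' : Fin n → (J → X) → X) :
    φ.Realize (fun b => el D (F b) id) (fun b => el D (F' b) id) ↔
      ∀ᶠ ω in (iterU D J : Filter (J → X)), φ.Realize (fun b => F b ω) (fun b => F' b ω) := by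
  have h := UProd.realize_mk (iterU D J) φ.toFormula (fun b ω => (Sum.elim F F' b) ω)
  refine Iff.trans ?_ (h.trans ?_)
  · rw [BoundedFormula.realize_toFormula]
    rfl
  · refine iff_of_eq (congrArg (fun p : (J → X) → Prop =>
      ∀ᶠ ω in (iterU D J : Filter (J → X)), p ω) ?_)
    funext ω
    rw [BoundedFormula.realize_toFormula]
    rfl

theorem fin_snoc_comp {α β : Type*} (f : α → β) {n : ℕ} (v : Fin n → α) (x : α) :
    (fun i => f (Fin.snoc (α := fun _ => α) v x i)) =
      Fin.snoc (α := fun _ => β) (fun i => f (v i)) (f x) := by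
  funext i
  refine Fin.lastCases ?_ (fun i => ?_) i
  · rw [Fin.snoc_last, Fin.snoc_last]
  · rw [Fin.snoc_castSucc, Fin.snoc_castSucc]

theorem TVFail.exists_tvSol {G : Set (Fn J X)} {α : Type} [Finite α] {r : ℕ}
    (h : TVFail L D G α r) : ∃ Y, TVSol L D G α r Y := by
  classical
  obtain ⟨n, χ, v, v', hr, hv, hv', hK, hU⟩ := h
  obtain ⟨s₁, F, -, hF, hvF⟩ := exists_good_tuple D hv
  obtain ⟨s₂, F', -, hF', hvF'⟩ := exists_good_tuple D hv'
  obtain rfl := funext hvF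
  obtain rfl := funext hvF'
  let sk : (α → X) → (Fin n → X) → X := fun x x' =>
    if h : ∃ y, ¬ χ.Realize x (Fin.snoc x' y) then h.choose else Classical.arbitrary X
  have hdep : DependsOn (fun ω : J → X => sk (fun a => F a ω) fun a => F' a ω)
      ((s₁ ∪ s₂ : Finset J) : Set J) := by
    intro ω ω' h
    have e1 : (fun a => F a ω) = fun a => F a ω' := funext fun a => (hF a).1 fun j hj =>
      h j (Finset.mem_coe.2 (Finset.mem_union_left _ hj))
    have e2 : (fun a => F' a ω) = fun a => F' a ω' := funext fun a => (hF' a).1 fun j hj =>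
      h j (Finset.mem_coe.2 (Finset.mem_union_right _ hj))
    simp only [e1, e2]
  refine ⟨⟨s₁ ∪ s₂, _, hdep⟩, n, χ, F, F', hr, fun a => (hF a).mono D Finset.subset_union_left,
    fun a => (hF' a).mono D Finset.subset_union_right, hK, fun hcon => ?_⟩
  rw [← fin_snoc_comp (fun F => el D F id), el_realize_bounded] at hcon
  have h2 : ∀ᶠ ω in (iterU D J : Filter (J → X)),
      ¬ χ.all.Realize (fun b => F b ω) (fun b => F' b ω) := by
    rw [Ultrafilter.eventually_not, ← el_realize_bounded]
    exact hU
  obtain ⟨ω, h3, h4⟩ := (hcon.and h2).exists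
  rw [BoundedFormula.realize_all] at h4
  push Not at h4
  have h5 := h4.choose_spec
  rw [fin_snoc_comp (fun F : (J → X) → X => F ω)] at h3
  simp only [sk, dif_pos h4] at h3
  exact h5 h3

/-- Without failures of the Tarski-Vaught test, truth in the hull is truth in the ultrapower. -/
theorem realize_hullS_iff {G : Set (Fn J X)} {α : Type} {r : ℕ}
    (h : ∀ r' < r, ¬ TVFail L D G α r') {n : ℕ} (φ : L.BoundedFormula α n) (hφ : height φ ≤ r)
    (v : α → hullS L D G Set.univ) (v' : Fin n → hullS L D G Set.univ) :
    φ.Realize v v' ↔ φ.Realize (fun a => (v a : UProd (iterU D J) (fun _ => X)))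
      (fun a => (v' a : UProd (iterU D J) (fun _ => X))) := by
  induction φ generalizing r with
  | falsum => rfl
  | equal t₁ t₂ =>
    exact ((BoundedFormula.IsAtomic.equal t₁ t₂).isQF.realize_embedding
      (hullS L D G Set.univ).subtype).symm
  | rel R ts =>
    exact ((BoundedFormula.IsAtomic.rel R ts).isQF.realize_embedding
      (hullS L D G Set.univ).subtype).symm
  | imp φ ψ ih1 ih2 =>
    rw [height] at hφ
    rw [BoundedFormula.realize_imp, BoundedFormula.realize_imp]
    exact imp_congr (ih1 h (by omega) v') (ih2 h (by omega) v')
  | @all n φ ih =>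
    rw [height] at hφ
    have e : ∀ b : hullS L D G Set.univ, φ.Realize v (Fin.snoc v' b) ↔
        φ.Realize (fun a => (v a : UProd (iterU D J) (fun _ => X)))
          (Fin.snoc (fun a => (v' a : UProd (iterU D J) (fun _ => X))) b) := by
      intro b
      rw [ih h (by omega), fin_snoc_comp Subtype.val]
    constructor
    · intro h1
      by_contra hcon
      exact h (height φ) (by omega) ⟨n, φ, _, _, rfl, fun a => (v a).2, fun a => (v' a).2,
        fun b hb => (e ⟨b, hb⟩).1 (h1 ⟨b, hb⟩), hcon⟩
    · intro h1 b
      exact (e b).2 (h1 _)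

end TarskiVaught

section Closing

variable {B : Type u} [LinearOrder B] {L : FirstOrder.Language.{u, u}} {X : Type u}
  [L.Structure X] [Nonempty X] {D : Ultrafilter X} {Ω : Type v} [LinearOrder Ω]

/-- The isomorphism `h` maps the hull of `G` and `C` to the hull of `G₀` and `C`. -/
def ClosedAt {G' G₀ : Set (Fn (Idx B) X)}
    (h : hullS L D G' Set.univ ≃[L] hullS L D G₀ Set.univ) (G : Set (Fn (Idx B) X))
    (C : Set B) : Prop :=
  ∀ x : hullS L D G' Set.univ,
    (x : UProd (iterU D (Idx B)) fun _ => X) ∈ hullS L D G (blocks C) ↔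
    (h x : UProd (iterU D (Idx B)) fun _ => X) ∈ hullS L D G₀ (blocks C)

theorem countable_blocks {C : Set B} (hC : C.Countable) : (blocks C).Countable := by
  have : Countable C := hC
  refine (Set.countable_range fun p : C × ℚ => idx p.1.1 p.2).mono fun j hj => ?_
  exact ⟨(⟨blk j, hj⟩, rat j), rfl⟩

theorem exists_closing_step [Nonempty Ω] {G : Ω → Set (Fn (Idx B) X)} (hG : Monotone G)
    (hGc : ∀ α, (G α).Countable) (hΩ : ∀ s : Set Ω, s.Countable → ∃ b, ∀ a ∈ s, a < b)
    {G₀ : Set (Fn (Idx B) X)} (hG₀ : G₀.Countable)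
    (h : hullS L D (⋃ α, G α) Set.univ ≃[L] hullS L D G₀ Set.univ) (δ : Ω) {C : Set B}
    (hC : C.Countable) :
    ∃ (δ' : Ω) (C' : Set B), δ < δ' ∧ C ⊆ C' ∧ C'.Countable ∧
      (∀ x : hullS L D (⋃ α, G α) Set.univ,
        (x : UProd (iterU D (Idx B)) fun _ => X) ∈ hullS L D (G δ) (blocks C) →
        (h x : UProd (iterU D (Idx B)) fun _ => X) ∈ hullS L D G₀ (blocks C')) ∧
      ∀ x : hullS L D (⋃ α, G α) Set.univ,
        (h x : UProd (iterU D (Idx B)) fun _ => X) ∈ hullS L D G₀ (blocks C) →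
        (x : UProd (iterU D (Idx B)) fun _ => X) ∈ hullS L D (G δ') (blocks C') := by
  have hA₁ : gens D (G δ) (blocks C) ⊆ hullS L D (⋃ α, G α) Set.univ :=
    (gens_mono D (Set.subset_iUnion G δ) (Set.subset_univ _)).trans Substructure.subset_closure
  have hA₂ : gens D G₀ (blocks C) ⊆ hullS L D G₀ Set.univ :=
    (gens_mono D subset_rfl (Set.subset_univ _)).trans Substructure.subset_closure
  have hc₁ : Countable (gens D (G δ) (blocks C)) := countable_gens D (hGc δ) (countable_blocks hC)
  have hc₂ : Countable (gens D G₀ (blocks C)) := countable_gens D hG₀ (countable_blocks hC)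
  choose s _ hs using fun x : gens D (G δ) (blocks C) =>
    exists_finset_mem_hullS D (h ⟨x, hA₁ x.2⟩).2
  choose t _ ht using fun x : gens D G₀ (blocks C) =>
    exists_finset_mem_hullS D (h.symm ⟨x, hA₂ x.2⟩).2
  choose α hα using fun x => exists_mem_hullS_of_directed D hG (ht x)
  obtain ⟨δ', hδ'⟩ := hΩ (insert δ (Set.range α)) ((Set.countable_range α).insert δ)
  let C' : Set B := C ∪ ((⋃ x, blk '' (s x : Set (Idx B))) ∪ ⋃ x, blk '' (t x : Set (Idx B)))
  have hsC : ∀ x, (s x : Set (Idx B)) ⊆ blocks C' := fun x j hj =>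
    Or.inr (Or.inl (Set.mem_iUnion.2 ⟨x, j, hj, rfl⟩))
  have htC : ∀ x, (t x : Set (Idx B)) ⊆ blocks C' := fun x j hj =>
    Or.inr (Or.inr (Set.mem_iUnion.2 ⟨x, j, hj, rfl⟩))
  refine ⟨δ', C', hδ' δ (Set.mem_insert _ _), Set.subset_union_left, ?_, ?_, ?_⟩
  · refine hC.union ((Set.countable_iUnion fun x => ?_).union (Set.countable_iUnion fun x => ?_))
    · exact ((s x).finite_toSet.image blk).countable
    · exact ((t x).finite_toSet.image blk).countable
  · intro x hx
    exact map_mem_of_mem_closure h.toHom hA₁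
      (fun x hx => hullS_mono D subset_rfl (hsC ⟨x, hx⟩) (hs ⟨x, hx⟩)) hx
  · intro x hx
    have := map_mem_of_mem_closure h.symm.toHom hA₂ (P := hullS L D (G δ') (blocks C'))
      (fun x hx => hullS_mono D (hG (hδ' _ (Or.inr ⟨⟨x, hx⟩, rfl⟩)).le) (htC ⟨x, hx⟩)
        (hα ⟨x, hx⟩)) hx
    have e : h.symm.toHom (h x) = x := h.symm_apply_apply x
    rwa [e] at this

theorem exists_mem_hullS_nat {G : ℕ → Set (Fn (Idx B) X)} (hG : Monotone G) {C : ℕ → Set B}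
    (hC : Monotone C) {x : UProd (iterU D (Idx B)) fun _ => X}
    (hx : x ∈ hullS L D (⋃ n, G n) (blocks (⋃ n, C n))) :
    ∃ n, x ∈ hullS L D (G n) (blocks (C n)) := by
  obtain ⟨s, hs, hx⟩ := exists_finset_mem_hullS D hx
  obtain ⟨n, hn⟩ := exists_mem_hullS_of_directed D hG hx
  choose! m hm using fun j (hj : j ∈ s) => Set.mem_iUnion.1 (hs hj)
  refine ⟨max n (s.sup m), hullS_mono D (hG (le_max_left _ _)) (fun j hj => ?_) hn⟩
  exact hC ((Finset.le_sup (f := m) hj).trans (le_max_right _ _)) (hm j hj)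

theorem exists_closedAt [Nonempty Ω] [WellFoundedLT Ω] {G : Ω → Set (Fn (Idx B) X)}
    (hG : Monotone G) (hGc : ∀ α, (G α).Countable)
    (hGlim : ∀ δ, (∃ β, β < δ) → (∀ β < δ, ∃ γ < δ, β < γ) → ∀ x ∈ G δ, ∃ β < δ, x ∈ G β)
    (hΩ : ∀ s : Set Ω, s.Countable → ∃ b, ∀ a ∈ s, a < b)
    {G₀ : Set (Fn (Idx B) X)} (hG₀ : G₀.Countable)
    (h : hullS L D (⋃ α, G α) Set.univ ≃[L] hullS L D G₀ Set.univ) (γ : Ω) (b₀ : B) :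
    ∃ (δ : Ω) (C : Set B), γ < δ ∧ b₀ ∈ C ∧ (∀ β < δ, ∃ γ < δ, β < γ) ∧ ClosedAt h (G δ) C ∧
      ∀ t : Finset B, ↑t ⊆ C → ∃ β < δ, ∀ x : hullS L D (⋃ α, G α) Set.univ,
        (h x : UProd (iterU D (Idx B)) fun _ => X) ∈ hullS L D G₀ (blocks (t : Set B)) →
        (x : UProd (iterU D (Idx B)) fun _ => X) ∈ hullS L D (G β) Set.univ := by
  choose δ' C' h1 h2 h3 h4 h5 using fun p : {p : Ω × Set B // p.2.Countable} =>
    exists_closing_step hG hGc hΩ hG₀ h p.1.1 p.2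
  let P : ℕ → {p : Ω × Set B // p.2.Countable} := fun n =>
    Nat.rec ⟨(γ, {b₀}), Set.countable_singleton b₀⟩ (fun _ p => ⟨(δ' p, C' p), h3 p⟩) n
  let d : ℕ → Ω := fun n => (P n).1.1
  let E : ℕ → Set B := fun n => (P n).1.2
  have hd : ∀ n, d n < d (n + 1) := fun n => h1 (P n)
  have hE : Monotone E := monotone_nat_of_le_succ fun n => h2 (P n)
  have hdm : Monotone d := monotone_nat_of_le_succ fun n => (hd n).le
  obtain ⟨δ, hδ, hmin⟩ : ∃ δ, (∀ n, d n < δ) ∧ ∀ β < δ, ∃ n, β ≤ d n := by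
    have hne : {b | ∀ n, d n < b}.Nonempty := by
      obtain ⟨b, hb⟩ := hΩ _ (Set.countable_range d)
      exact ⟨b, fun n => hb _ ⟨n, rfl⟩⟩
    refine ⟨wellFounded_lt.min _ hne, wellFounded_lt.min_mem _ hne, fun β hβ => ?_⟩
    by_contra hcon
    push Not at hcon
    exact wellFounded_lt.not_lt_min {b | ∀ n, d n < b} hcon hβ
  have hlim : ∀ β < δ, ∃ γ < δ, β < γ := fun β hβ => by
    obtain ⟨n, hn⟩ := hmin β hβ
    exact ⟨d (n + 1), hδ (n + 1), hn.trans_lt (hd n)⟩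
  have hGδ : G δ ⊆ ⋃ n, G (d n) := fun x hx => by
    obtain ⟨β, hβ, hx⟩ := hGlim δ ⟨_, hδ 0⟩ hlim x hx
    obtain ⟨n, hn⟩ := hmin β hβ
    exact Set.mem_iUnion.2 ⟨n, hG hn hx⟩
  refine ⟨δ, ⋃ n, E n, hδ 0, Set.mem_iUnion.2 ⟨0, rfl⟩, hlim, fun x => ⟨fun hx => ?_, fun hx => ?_⟩,
    fun t ht => ?_⟩
  · obtain ⟨n, hn⟩ := exists_mem_hullS_nat (hG.comp hdm) hE (hullS_mono D hGδ subset_rfl hx)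
    exact hullS_mono D subset_rfl (blocks_mono (Set.subset_iUnion E (n + 1))) (h4 (P n) x hn)
  · obtain ⟨n, hn⟩ := exists_mem_hullS_nat (G := fun _ => G₀) monotone_const hE
      (hullS_mono D (Set.subset_iUnion (fun _ : ℕ => G₀) 0) subset_rfl hx)
    exact hullS_mono D (hG (hδ (n + 1)).le) (blocks_mono (Set.subset_iUnion E (n + 1)))
      (h5 (P n) x hn)
  · choose! m hm using fun b (hb : b ∈ t) => Set.mem_iUnion.1 (ht hb)
    refine ⟨d (t.sup m + 1), hδ (t.sup m + 1), fun x hx => ?_⟩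
    refine hullS_mono D subset_rfl (Set.subset_univ _) (h5 (P (t.sup m)) x ?_)
    refine hullS_mono D subset_rfl (blocks_mono fun b hb => ?_) hx
    exact hE (Finset.le_sup (f := m) hb) (hm b hb)

/-- The Tarski-Vaught test inside closed hulls. -/
theorem ClosedAt.exists_realize [Nonempty B] {G' G₀ G : Set (Fn (Idx B) X)}
    {h : hullS L D G' Set.univ ≃[L] hullS L D G₀ Set.univ} {C : Set B} (hC : ClosedAt h G C)
    (hne : C.Nonempty) {α : Type} [Finite α] {n : ℕ} (χ : L.BoundedFormula α (n + 1))
    (v : α → hullS L D G' Set.univ) (v' : Fin n → hullS L D G' Set.univ)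
    (hv : ∀ a, (v a : UProd (iterU D (Idx B)) fun _ => X) ∈ hullS L D G (blocks C))
    (hv' : ∀ a, (v' a : UProd (iterU D (Idx B)) fun _ => X) ∈ hullS L D G (blocks C))
    (hex : ∃ y : hullS L D G' Set.univ, χ.Realize v (Fin.snoc v' y)) :
    ∃ y : hullS L D G' Set.univ, (y : UProd (iterU D (Idx B)) fun _ => X) ∈ hullS L D G (blocks C) ∧
      χ.Realize v (Fin.snoc v' y) := by
  obtain ⟨y, hy⟩ := hex
  obtain ⟨s₁, F, hs₁, hF, hvF⟩ := exists_good_tuple D fun a => (hC _).1 (hv a)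
  obtain ⟨s₂, F', hs₂, hF', hvF'⟩ := exists_good_tuple D fun a => (hC _).1 (hv' a)
  obtain ⟨s₃, F₃, -, hF₃, hyF⟩ := exists_good D (h y).2
  obtain ⟨ρ, h1, h2, h3⟩ := (filling_blocks hne).exists_extend (s₁ ∪ s₂) s₃ id
    (fun _ _ _ _ h => h) (by
      intro j hj
      rcases Finset.mem_union.1 hj with hj | hj
      exacts [hs₁ hj, hs₂ hj])
  have hg : ∀ a, Good L D G₀ (s₁ ∪ s₂ ∪ s₃) (F a) := fun a =>
    ((hF a).mono D Finset.subset_union_left).mono D Finset.subset_union_left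
  have hg' : ∀ a, Good L D G₀ (s₁ ∪ s₂ ∪ s₃) (F' a) := fun a =>
    ((hF' a).mono D Finset.subset_union_right).mono D Finset.subset_union_left
  have hg₃ : Good L D G₀ (s₁ ∪ s₂ ∪ s₃) F₃ := hF₃.mono D Finset.subset_union_right
  have hmem : el D F₃ ρ ∈ hullS L D G₀ (blocks C) := hg₃.mem D h2 h3
  let z : hullS L D G₀ Set.univ := ⟨_, hullS_mono D subset_rfl (Set.subset_univ _) hmem⟩
  have hz : ((h (h.symm z) : hullS L D G₀ Set.univ) : UProd (iterU D (Idx B)) fun _ => X) =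
      el D F₃ ρ := congrArg Subtype.val (h.apply_symm_apply z)
  refine ⟨h.symm z, (hC _).2 (by rw [hz]; exact hmem), ?_⟩
  rw [← StrongHomClass.realize_boundedFormula h] at hy ⊢
  refine (hullS_realize_congr D filling_univ χ (s₁ ∪ s₂ ∪ s₃) id ρ (fun _ _ _ _ h => h) h2 F
    (Fin.snoc (α := fun _ => (Idx B → X) → X) F' F₃) hg ?_ _ _ _ _ ?_ ?_ ?_ ?_).1 hy
  · refine Fin.lastCases ?_ fun i => ?_
    · rw [Fin.snoc_last]
      exact hg₃
    · rw [Fin.snoc_castSucc]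
      exact hg' i
  · exact hvF
  · exact fun a => (hvF a).trans (el_congr D (hF a).1 fun j hj =>
      (h1 j (Finset.mem_union_left _ hj)).symm)
  · refine Fin.lastCases ?_ fun i => ?_
    · rw [Function.comp_apply, Fin.snoc_last, Fin.snoc_last]
      exact hyF.symm
    · rw [Function.comp_apply, Fin.snoc_castSucc, Fin.snoc_castSucc]
      exact hvF' i
  · refine Fin.lastCases ?_ fun i => ?_
    · rw [Function.comp_apply, Fin.snoc_last, Fin.snoc_last]
      exact hz
    · rw [Function.comp_apply, Fin.snoc_castSucc, Fin.snoc_castSucc]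
      exact (hvF' i).trans (el_congr D (hF' i).1 fun j hj =>
        (h1 j (Finset.mem_union_right _ hj)).symm)

end Closing

section Elementarity

variable {B : Type u} [LinearOrder B] {L : FirstOrder.Language.{u, u}} {X : Type u}
  [L.Structure X] [Nonempty X] {D : Ultrafilter X} {Ω : Type v} [LinearOrder Ω]

theorem exists_forall_mem_hullS [Nonempty Ω] {G : Ω → Set (Fn (Idx B) X)} (hG : Monotone G)
    {ι : Type*} [Finite ι] {A : Set (Idx B)} {v : ι → UProd (iterU D (Idx B)) fun _ => X}
    (hv : ∀ i, v i ∈ hullS L D (⋃ α, G α) A) : ∃ α, ∀ i, v i ∈ hullS L D (G α) A := by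
  choose α hα using fun i => exists_mem_hullS_of_directed D hG (hv i)
  obtain ⟨β, hβ⟩ := (Set.finite_range α).bddAbove
  exact ⟨β, fun i => hullS_mono D (hG (hβ ⟨i, rfl⟩)) subset_rfl (hα i)⟩

theorem el_realize_snoc_congr {J : Type u} [LinearOrder J] {β : Type*} {n : ℕ}
    (χ : L.BoundedFormula β (n + 1)) (F : β → (J → X) → X) (F' : Fin n → (J → X) → X)
    (Z : (J → X) → X) (s : Finset J) (hF : ∀ b, DependsOn (F b) (s : Set J))
    (hF' : ∀ b, DependsOn (F' b) (s : Set J)) (hZ : DependsOn Z (s : Set J))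
    {σ τ : J → J} (hσ : StrictMonoOn σ s) (hτ : StrictMonoOn τ s) :
    χ.Realize (fun a => el D (F a) σ) (Fin.snoc (fun a => el D (F' a) σ) (el D Z σ)) ↔
      χ.Realize (fun a => el D (F a) τ) (Fin.snoc (fun a => el D (F' a) τ) (el D Z τ)) := by
  rw [← fin_snoc_comp (fun F => el D F σ), ← fin_snoc_comp (fun F => el D F τ)]
  refine el_realize_bounded_congr D χ F _ s hF ?_ hσ hτ
  refine Fin.lastCases ?_ fun i => ?_
  · rw [Fin.snoc_last]
    exact hZ
  · rw [Fin.snoc_castSucc]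
    exact hF' i

theorem not_tvFail_iUnion [Nonempty Ω] [Nonempty B] {G : Ω → Set (Fn (Idx B) X)} (hG : Monotone G)
    {α : Type} [Finite α]
    (htv : ∀ δ r, (∃ Y, TVSol L D (G δ) α r Y) → ∃ Y ∈ ⋃ δ, G δ, TVSol L D (G δ) α r Y)
    {G₀ : Set (Fn (Idx B) X)} (h : hullS L D (⋃ α, G α) Set.univ ≃[L] hullS L D G₀ Set.univ)
    (hcl : ∀ γ, ∃ (δ : Ω) (C : Set B), γ < δ ∧ C.Nonempty ∧ ClosedAt h (G δ) C) (r : ℕ) :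
    ¬ TVFail L D (⋃ δ, G δ) α r := by
  classical
  induction r using Nat.strong_induction_on with
  | h r ih =>
    rintro ⟨n, χ, v, v', hr, hv, hv', hK, hU⟩
    obtain ⟨γ₁, hγ₁⟩ := exists_forall_mem_hullS hG hv
    obtain ⟨γ₂, hγ₂⟩ := exists_forall_mem_hullS hG hv'
    obtain ⟨δ, C, hδ, hne, hC⟩ := hcl (max γ₁ γ₂)
    have hsub : G δ ⊆ ⋃ δ, G δ := Set.subset_iUnion G δ
    have hfail : TVFail L D (G δ) α r := ⟨n, χ, v, v', hr,
      fun a => hullS_mono D (hG ((le_max_left _ _).trans hδ.le)) subset_rfl (hγ₁ a),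
      fun a => hullS_mono D (hG ((le_max_right _ _).trans hδ.le)) subset_rfl (hγ₂ a),
      fun b hb => hK b (hullS_mono D hsub subset_rfl hb), hU⟩
    clear hK hU hv hv' hγ₁ hγ₂ hr χ v v' n
    obtain ⟨Y, hY, n, χ, F, F', hr, hF, hF', hχ, hnot⟩ := htv δ r hfail.exists_tvSol
    obtain ⟨ρ, -, h2, h3⟩ := (filling_blocks hne).exists_extend ∅ Y.supp id
      (fun _ h => by simp at h) (by simp)
    rw [Finset.empty_union] at h2 h3
    have hFC : ∀ a, el D (F a) ρ ∈ hullS L D (G δ) (blocks C) := fun a => (hF a).mem D h2 h3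
    have hFC' : ∀ a, el D (F' a) ρ ∈ hullS L D (G δ) (blocks C) := fun a => (hF' a).mem D h2 h3
    have hinc : hullS L D (G δ) (blocks C) ≤ hullS L D (⋃ δ, G δ) Set.univ :=
      hullS_mono D hsub (Set.subset_univ _)
    have hYmem : el D Y.toFun ρ ∈ hullS L D (⋃ δ, G δ) Set.univ :=
      (good_of_mem D hY).mem D h2 fun _ _ => Set.mem_univ _
    let w : α → hullS L D (⋃ δ, G δ) Set.univ := fun a => ⟨_, hinc (hFC a)⟩
    let w' : Fin n → hullS L D (⋃ δ, G δ) Set.univ := fun a => ⟨_, hinc (hFC' a)⟩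
    have hiff : ∀ y : hullS L D (⋃ δ, G δ) Set.univ, χ.not.Realize w (Fin.snoc w' y) ↔
        ¬ χ.Realize (fun a => el D (F a) ρ) (Fin.snoc (fun a => el D (F' a) ρ) y) := by
      intro y
      rw [BoundedFormula.realize_not, realize_hullS_iff D ih χ hr.le, fin_snoc_comp Subtype.val]
    have hex : ∃ y : hullS L D (⋃ δ, G δ) Set.univ, χ.not.Realize w (Fin.snoc w' y) := by
      refine ⟨⟨_, hYmem⟩, (hiff _).2 fun hcon => hnot ?_⟩
      exact (el_realize_snoc_congr χ F F' Y.toFun Y.supp (fun a => (hF a).1) (fun a => (hF' a).1)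
        Y.dep h2 (fun _ _ _ _ h => h)).1 hcon
    obtain ⟨y, hyC, hy⟩ := hC.exists_realize hne χ.not w w' hFC hFC' hex
    obtain ⟨s, Z, hs, hZ, hyZ⟩ := exists_good D hyC
    refine (hiff y).1 hy ?_
    obtain ⟨τ, h4, h5, -⟩ := (filling_univ (B := B)).exists_reindex Y.supp s id ρ
      (fun _ _ _ _ h => h) h2 fun _ _ => trivial
    have hZτ : el D Z τ ∈ hullS L D (G δ) Set.univ :=
      (hZ.mono D Finset.subset_union_right).mem D h5 fun _ _ => Set.mem_univ _
    have h6 := hχ _ hZτ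
    rw [← hyZ]
    have e1 : ∀ a, el D (F a) id = el D (fun ω => F a (ω ∘ ρ)) τ := fun a =>
      el_comp_eq D (hF a).1 fun j hj => (h4 j hj).symm
    have e2 : ∀ a, el D (F' a) id = el D (fun ω => F' a (ω ∘ ρ)) τ := fun a =>
      el_comp_eq D (hF' a).1 fun j hj => (h4 j hj).symm
    simp only [e1, e2] at h6
    exact (el_realize_snoc_congr χ (fun a ω => F a (ω ∘ ρ)) (fun a ω => F' a (ω ∘ ρ)) Z
      (Y.supp.image ρ ∪ s) (fun a => (((hF a).comp D h2).mono D Finset.subset_union_left).1)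
      (fun a => (((hF' a).comp D h2).mono D Finset.subset_union_left).1)
      (hZ.mono D Finset.subset_union_right).1 h5 (fun _ _ _ _ h => h)).1 h6

end Elementarity

section Contradiction

variable {B : Type u} [LinearOrder B] {L : FirstOrder.Language.{u, u}} {X : Type u}
  [L.Structure X] [Nonempty X] {D : Ultrafilter X} {Ω : Type v} [LinearOrder Ω]

theorem exists_formula_fin (φ : L.Formula (Option ℕ)) : ∃ (k : ℕ) (ψ : L.Formula (Fin (k + 1))),
    ∀ (M : Type u) [L.Structure M] (x : M) (c : ℕ → M),
      φ.Realize (pointed x c) ↔ ψ.Realize (Fin.cons x fun i : Fin k => c i) := by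
  classical
  obtain ⟨k, hk⟩ : ∃ k, ∀ i, some i ∈ fsupp φ → i < k :=
    ⟨(fsupp φ).sup (fun o => o.elim 0 id) + 1, fun i hi => Nat.lt_succ_of_le
      (Finset.le_sup (f := fun o : Option ℕ => o.elim 0 id) hi)⟩
  let r : Option ℕ → Fin (k + 1) := fun o =>
    o.elim 0 fun i => if h : i < k then Fin.succ ⟨i, h⟩ else 0
  refine ⟨k, Formula.relabel r φ, fun M _ x c => ?_⟩
  rw [Formula.realize_relabel]
  refine realize_congr_fsupp φ fun o ho => ?_
  rcases o with _ | i
  · rfl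
  · simp [r, pointed, hk i ho]
    rfl

theorem formula_realize_hullS_iff {J : Type u} [LinearOrder J] {G : Set (Fn J X)} {α : Type}
    (h : ∀ r, ¬ TVFail L D G α r) (φ : L.Formula α) (v : α → hullS L D G Set.univ) :
    φ.Realize v ↔ φ.Realize fun a => (v a : UProd (iterU D J) (fun _ => X)) := by
  have := realize_hullS_iff D (r := height φ) (fun r _ => h r) φ le_rfl v default
  refine this.trans (iff_of_eq (congrArg _ ?_))
  exact Subsingleton.elim _ _

theorem hullS_formula_realize_congr {J : Type u} [LinearOrder J]
    (hJ : Filling (Set.univ : Set J)) {G : Set (Fn J X)} {β : Type*}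
    (φ : L.Formula β) (s : Finset J) (σ τ : J → J) (hσ : StrictMonoOn σ s)
    (hτ : StrictMonoOn τ s) (F : β → (J → X) → X) (hF : ∀ b, Good L D G s (F b))
    (v w : β → hullS L D G Set.univ)
    (hv : ∀ b, (v b : UProd (iterU D J) (fun _ => X)) = el D (F b) σ)
    (hw : ∀ b, (w b : UProd (iterU D J) (fun _ => X)) = el D (F b) τ) :
    φ.Realize v ↔ φ.Realize w :=
  hullS_realize_congr D hJ φ s σ τ hσ hτ F (fun i : Fin 0 => i.elim0) hF (fun i => i.elim0) v w
    default default hv hw (fun i => i.elim0) (fun i => i.elim0)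

/-- The indices outside `C` can be pushed into blocks in `C`, far to the right. -/
theorem exists_push [WellFoundedLT B] [OrderTop B] {C : Set B} (hC : ⊤ ∈ C) (s : Finset (Idx B)) :
    ∃ t : Finset B, ↑t ⊆ C ∧ ∀ s' : Finset (Idx B), ↑s' ⊆ blocks C → ∃ σ : Idx B → Idx B,
      StrictMonoOn σ (s ∪ s' : Finset (Idx B)) ∧ (∀ j ∈ s', σ j = j) ∧
      ∀ j ∈ s, σ j ∈ blocks (t : Set B) := by
  classical
  have hγ : ∀ b : B, ∃ c ∈ C, b ≤ c ∧ ∀ c' ∈ C, b ≤ c' → c ≤ c' := by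
    intro b
    have hne : {c | c ∈ C ∧ b ≤ c}.Nonempty := ⟨⊤, hC, le_top⟩
    refine ⟨wellFounded_lt.min _ hne, (wellFounded_lt.min_mem _ hne).1,
      (wellFounded_lt.min_mem _ hne).2, fun c' h1 h2 => ?_⟩
    exact not_lt.1 (wellFounded_lt.not_lt_min {c | c ∈ C ∧ b ≤ c} ⟨h1, h2⟩)
  choose γ hγC hγle hγmin using hγ
  have hγmono : ∀ b b', b ≤ b' → γ b ≤ γ b' := fun b b' h =>
    hγmin b _ (hγC b') (h.trans (hγle b'))
  have hγid : ∀ b ∈ C, γ b = b := fun b hb => le_antisymm (hγmin b b hb le_rfl) (hγle b)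
  refine ⟨s.image fun j => γ (blk j), ?_, fun s' hs' => ?_⟩
  · intro b hb
    obtain ⟨j, -, rfl⟩ := Finset.mem_image.1 (Finset.mem_coe.1 hb)
    exact hγC _
  obtain ⟨q, hq⟩ : ∃ q : ℚ, ∀ j ∈ s ∪ s', rat j < q := by
    obtain ⟨q, hq⟩ := ((s ∪ s').finite_toSet.image rat).bddAbove
    exact ⟨q + 1, fun j hj => (hq ⟨j, hj, rfl⟩).trans_lt (lt_add_one q)⟩
  let l : Idx B → ℕ := fun j => (s.filter (· < j)).card
  let σ : Idx B → Idx B := fun j => if blk j ∈ C then j else idx (γ (blk j)) (q + l j)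
  have hσ₁ : ∀ j, blk j ∈ C → σ j = j := fun j hj => if_pos hj
  have hσ₂ : ∀ j, blk j ∉ C → σ j = idx (γ (blk j)) (q + l j) := fun j hj => if_neg hj
  have hs : ∀ j ∈ s ∪ s', blk j ∉ C → j ∈ s := fun j hj hjC =>
    (Finset.mem_union.1 hj).resolve_right fun h => hjC (hs' h)
  refine ⟨σ, fun i hi j hj hij => ?_, fun j hj => hσ₁ j (hs' hj), fun j hj => ?_⟩
  · have hi' : i ∈ s ∪ s' := Finset.mem_coe.1 hi
    have hj' : j ∈ s ∪ s' := Finset.mem_coe.1 hj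
    have hle : blk j ≤ blk i := by
      rcases idx_lt_iff.1 hij with h | h
      exacts [h.le, h.1.ge]
    by_cases hiC : blk i ∈ C <;> by_cases hjC : blk j ∈ C
    · rwa [hσ₁ i hiC, hσ₁ j hjC]
    · rw [hσ₁ i hiC, hσ₂ j hjC, idx_lt_iff, blk_idx, rat_idx]
      rcases (hγmin _ _ hiC hle).lt_or_eq with h | h
      · exact Or.inl h
      · refine Or.inr ⟨h.symm, (hq i hi').trans_le ?_⟩
        have : (0 : ℚ) ≤ l j := Nat.cast_nonneg _
        linarith
    · rw [hσ₂ i hiC, hσ₁ j hjC, idx_lt_iff, blk_idx, rat_idx]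
      refine Or.inl ((lt_of_le_of_ne hle fun h => hiC (h ▸ hjC)).trans_le (hγle _))
    · rw [hσ₂ i hiC, hσ₂ j hjC, idx_lt_iff, blk_idx, rat_idx, blk_idx, rat_idx]
      rcases (hγmono _ _ hle).lt_or_eq with h | h
      · exact Or.inl h
      · refine Or.inr ⟨h.symm, ?_⟩
        have hl : l i < l j := by
          refine Finset.card_lt_card ⟨fun x hx => ?_, fun hcon => ?_⟩
          · rw [Finset.mem_filter] at hx ⊢
            exact ⟨hx.1, hx.2.trans hij⟩
          · exact lt_irrefl _ (Finset.mem_filter.1 (hcon (Finset.mem_filter.2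
              ⟨hs i hi' hiC, hij⟩))).2
        have : (l i : ℚ) < l j := Nat.cast_lt.2 hl
        linarith
  · by_cases hjC : blk j ∈ C
    · rw [hσ₁ j hjC]
      exact Finset.mem_coe.2 (Finset.mem_image.2 ⟨j, hj, hγid _ hjC⟩)
    · rw [hσ₂ j hjC]
      exact Finset.mem_coe.2 (Finset.mem_image.2 ⟨j, hj, rfl⟩)

theorem ClosedAt.false_of_indist [WellFoundedLT B] [OrderTop B] {G : Ω → Set (Fn (Idx B) X)}
    {G₀ : Set (Fn (Idx B) X)}
    {h : hullS L D (⋃ α, G α) Set.univ ≃[L] hullS L D G₀ Set.univ} {δ : Ω} {C : Set B}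
    (hC : ClosedAt h (G δ) C) (htop : ⊤ ∈ C)
    (hfin : ∀ t : Finset B, ↑t ⊆ C → ∃ β < δ, ∀ x : hullS L D (⋃ α, G α) Set.univ,
        (h x : UProd (iterU D (Idx B)) fun _ => X) ∈ hullS L D G₀ (blocks (t : Set B)) →
        (x : UProd (iterU D (Idx B)) fun _ => X) ∈ hullS L D (G β) Set.univ)
    (hel : ∀ k r, ¬ TVFail L D (⋃ α, G α) (Fin k) r) {x : X} (hx : Fn.const x ∈ ⋃ α, G α)
    (H : ∀ β < δ, ∃ (φ : L.Formula (Option ℕ)) (c : Bool → ℕ → X),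
      (∀ b i, Fn.const (c b i) ∈ G δ) ∧
      ¬ (φ.Realize (pointed x (c false)) ↔ φ.Realize (pointed x (c true))) ∧
      ∀ m ∈ hullS L D (G β) Set.univ,
        φ.Realize (pointed m fun i => diagEmb (L := L) (iterU D (Idx B)) X (c false i)) ↔
        φ.Realize (pointed m fun i => diagEmb (L := L) (iterU D (Idx B)) X (c true i))) :
    False := by
  classical
  let K := hullS L D (⋃ α, G α) Set.univ
  let xx : K := ⟨el D (fun _ => x) id, el_const_mem D hx _⟩
  obtain ⟨s, F, -, hF, hxF⟩ := exists_good D (h xx).2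
  obtain ⟨t, htC, ht⟩ := exists_push htop s
  obtain ⟨β, hβ, hβt⟩ := hfin t htC
  obtain ⟨φ, c, hcG, hne, hm⟩ := H β hβ
  obtain ⟨k, ψ, hψ⟩ := exists_formula_fin φ
  let E : Bool × Fin k → K := fun p => ⟨el D (fun _ => c p.1 p.2) id,
    el_const_mem D (Set.mem_iUnion.2 ⟨δ, hcG _ _⟩) _⟩
  have hE : ∀ p, (h (E p) : UProd (iterU D (Idx B)) fun _ => X) ∈ hullS L D G₀ (blocks C) :=
    fun p => (hC _).1 (el_const_mem D (hcG _ _) _)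
  obtain ⟨s', F', hs', hF', hEF⟩ := exists_good_tuple D hE
  obtain ⟨σ, h1, h2, h3⟩ := ht s' hs'
  have hFs : Good L D G₀ (s ∪ s') F := hF.mono D Finset.subset_union_left
  have hσs : StrictMonoOn σ (s : Set (Idx B)) :=
    h1.mono (Finset.coe_subset.2 Finset.subset_union_left)
  have hFm : el D F σ ∈ hullS L D G₀ (blocks (t : Set B)) := hF.mem D hσs h3
  let z : hullS L D G₀ Set.univ := ⟨el D F σ, hullS_mono D subset_rfl (Set.subset_univ _) hFm⟩
  let m : K := h.symm z
  have hmz : h m = z := h.apply_symm_apply z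
  have hmβ : (m : UProd (iterU D (Idx B)) fun _ => X) ∈ hullS L D (G β) Set.univ :=
    hβt m (by rw [hmz]; exact hFm)
  let val : K → Bool → Fin (k + 1) → K := fun y b =>
    Fin.cons (α := fun _ => K) y fun i => E (b, i)
  have key : ∀ b, ψ.Realize (val xx b) ↔ ψ.Realize (val m b) := by
    intro b
    rw [← StrongHomClass.realize_formula h, ← StrongHomClass.realize_formula h]
    refine hullS_formula_realize_congr filling_univ ψ (s ∪ s') id σ (fun _ _ _ _ h => h) h1
      (Fin.cons (α := fun _ => (Idx B → X) → X) F fun i => F' (b, i)) ?_ _ _ ?_ ?_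
    · refine Fin.cases hFs fun i => (hF' (b, i)).mono D Finset.subset_union_right
    · refine Fin.cases hxF.symm fun i => hEF (b, i)
    · refine Fin.cases (congrArg Subtype.val hmz) fun i => (hEF (b, i)).trans ?_
      exact el_congr D (hF' (b, i)).1 fun j hj => (h2 j hj).symm
  have hval : ∀ y b, ψ.Realize (val y b) ↔ φ.Realize (pointed
      (y : UProd (iterU D (Idx B)) fun _ => X)
        fun i => diagEmb (L := L) (iterU D (Idx B)) X (c b i)) := by
    intro y b
    rw [formula_realize_hullS_iff (hel (k + 1)), hψ]
    refine iff_of_eq (congrArg _ (funext ?_))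
    exact Fin.cases rfl fun i => rfl
  have hxx : ∀ b, ψ.Realize (val xx b) ↔ φ.Realize (pointed x (c b)) := by
    intro b
    rw [hval, ← (diagEmb (L := L) (iterU D (Idx B)) X).map_formula φ]
    refine iff_of_eq (congrArg _ (funext fun o => ?_))
    rcases o with _ | i <;> rfl
  refine hne ?_
  rw [← hxx, ← hxx, key, key, hval, hval]
  exact hm _ hmβ

end Contradiction

section Preliminaries

theorem isUniversal_of_isUniversalTheory {L : FirstOrder.Language.{u, u}} {T : L.Theory}
    (h : IsUniversalTheory T) : T.IsUniversal := by
  refine ⟨fun φ hφ => ?_⟩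
  obtain ⟨n, ψ, hψ, rfl⟩ := h φ hφ
  have : ∀ (n : ℕ) (ψ : L.BoundedFormula Empty n), ψ.IsUniversal → ψ.alls.IsUniversal := by
    intro n
    induction n with
    | zero => exact fun ψ hψ => hψ
    | succ n ih => exact fun ψ hψ => ih _ hψ.all
  exact this n ψ (.of_isQF hψ)

theorem exists_wellOrder_aleph_one : ∃ (Ω : Type u) (_ : LinearOrder Ω) (_ : WellFoundedLT Ω)
    (_ : Nonempty Ω), #Ω = ℵ₁ ∧ (∀ α : Ω, (Set.Iio α).Countable) ∧
      ∀ s : Set Ω, s.Countable → ∃ b, ∀ a ∈ s, a < b := by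
  let Ω : Type u := (ℵ₁ : Cardinal.{u}).ord.ToType
  have h1 : #Ω = ℵ₁ := mk_ord_toType _
  have h2 : ∀ α : Ω, (Set.Iio α).Countable := by
    intro α
    have h : #(Set.Iio α) < ℵ₁ := (mk_Iio_lt α (by rw [h1, Ordinal.type_toType])).trans_eq h1
    refine le_aleph0_iff_set_countable.1 (Order.lt_succ_iff.1 ?_)
    exact h.trans_eq succ_aleph0.symm
  refine ⟨Ω, inferInstance, inferInstance, ?_, h1, h2, fun s hs => ?_⟩
  · refine mk_ne_zero_iff.1 ?_
    rw [h1]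
    exact (aleph_pos 1).ne'
  · by_contra hcon
    push Not at hcon
    have h : (Set.univ : Set Ω).Countable := by
      refine (hs.biUnion fun a _ => (h2 a).union (Set.countable_singleton a)).mono fun b _ => ?_
      obtain ⟨a, ha, hab⟩ := hcon b
      exact Set.mem_iUnion₂.2 ⟨a, ha, hab.lt_or_eq⟩
    have := le_aleph0_iff_set_countable.2 h
    rw [mk_univ, h1] at this
    exact absurd this (not_le.2 aleph0_lt_aleph_one)

theorem exists_enumeration {Ω : Type v} [LinearOrder Ω] (hΩ : ∀ α : Ω, (Set.Iio α).Countable) :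
    ∃ e : Ω → ℕ → Ω, (∀ δ n, e δ n ≤ δ) ∧
      ∀ δ, (∃ β, β < δ) → (∀ n, e δ n < δ) ∧ ∀ β < δ, ∃ n, e δ n = β := by
  have h : ∀ δ : Ω, ∃ e : ℕ → Ω, (∀ n, e n ≤ δ) ∧
      ((∃ β, β < δ) → (∀ n, e n < δ) ∧ ∀ β < δ, ∃ n, e n = β) := by
    intro δ
    by_cases hδ : ∃ β, β < δ
    · obtain ⟨e, he⟩ := (hΩ δ).exists_eq_range hδ
      have h1 : ∀ n, e n < δ := fun n => Set.mem_Iio.1 (he ▸ Set.mem_range_self n)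
      refine ⟨e, fun n => (h1 n).le, fun _ => ⟨h1, fun β hβ => ?_⟩⟩
      have : β ∈ Set.range e := he ▸ Set.mem_Iio.2 hβ
      exact this
    · exact ⟨fun _ => δ, fun _ => le_rfl, fun h => absurd h hδ⟩
  choose e h1 h2 using h
  exact ⟨e, h1, h2⟩

end Preliminaries

section Next

variable {B : Type u} [LinearOrder B] [Infinite B] {L : FirstOrder.Language.{u, u}} {X : Type u}
  [L.Structure X] [Nonempty X] (D : Ultrafilter X)

theorem mk_hullS_le {G : Set (Fn (Idx B) X)} (hG : #G ≤ #B) :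
    #(hullS L D G Set.univ) ≤ max (max L.card ℵ₀) #B := by
  have h := Substructure.lift_card_closure_le (L := L) (s := gens D G Set.univ)
  rw [lift_id, lift_id, lift_id] at h
  refine h.trans (max_le (le_max_of_le_left (le_max_right _ _)) ?_)
  refine add_le_of_le (le_max_of_le_left (le_max_right _ _))
    ((mk_gens_le D hG _).trans (le_max_right _ _)) (le_max_of_le_left (le_max_of_le_left ?_))
  rw [card_eq_card_functions_add_card_relations, mk_sigma]
  simp only [lift_id]
  exact self_le_add_right _ _

theorem mk_formula_option_nat_le : #(L.Formula (Option ℕ)) ≤ max L.card ℵ₀ := by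
  have h1 : #(L.Formula (Option ℕ)) ≤ #(Σ n, L.BoundedFormula (Option ℕ) n) :=
    mk_le_of_injective (f := fun φ : L.Formula (Option ℕ) =>
      (⟨0, φ⟩ : Σ n, L.BoundedFormula (Option ℕ) n)) fun φ ψ h => by simpa using h
  refine h1.trans (BoundedFormula.card_le.trans ?_)
  rw [lift_uzero, mk_eq_aleph0 (Option ℕ), lift_aleph0]
  exact max_le (le_max_right _ _) (add_le_of_le (le_max_right _ _) (le_max_right _ _)
    (le_max_left _ _))

theorem mk_formula_prod_hullS_le {G : Set (Fn (Idx B) X)} (hG : #G ≤ #B) :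
    #(L.Formula (Option ℕ) × hullS L D G Set.univ) ≤ max (max L.card ℵ₀) #B := by
  have h0 : ℵ₀ ≤ max (max L.card ℵ₀) #B := le_max_of_le_left (le_max_right _ _)
  rw [mk_prod, lift_id, lift_id]
  exact mul_le_of_le h0 (mk_formula_option_nat_le.trans (le_max_left _ _)) (mk_hullS_le D hG)

variable (L) in
/-- The sequences `p` and `q` have the same type over the hull of `G`. -/
def Indist {N : Type u} (f : N → X) (G : Set (Fn (Idx B) X)) (p q : ℕ → N) : Prop :=
  ∀ (φ : L.Formula (Option ℕ)), ∀ m ∈ hullS L D G Set.univ,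
    φ.Realize (pointed m fun i => diagEmb (L := L) (iterU D (Idx B)) X (f (p i))) ↔
      φ.Realize (pointed m fun i => diagEmb (L := L) (iterU D (Idx B)) X (f (q i)))

theorem exists_next_indist {N : Type u} [L.Structure N] [Nonempty N] (f : N → X) {S : ℕ → Set N}
    (hSm : ∀ n, S n ⊆ S (n + 1)) {V : Type u} [LinearOrder V]
    (hV : (2 : Cardinal.{u}) ^ max (max L.card ℵ₀) #B < #V)
    (hS : ∀ n, RealizesOver L (S n) (S (n + 1)) (V × ULift.{u} ℕ)) {c : ℕ → Bool → ℕ → N}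
    (hd : ∀ n, ∃ d : ℕ → ℕ → N, ∀ i j, i < j →
      ∀ ψ : L.Formula ((Fin n × Bool × ℕ) ⊕ (Bool × ℕ)),
      ψ.Realize (Sum.elim (fun p => c p.1 p.2.1 p.2.2) fun p => cond p.1 (d j) (d i) p.2) ↔
        ψ.Realize (Sum.elim (fun p => c p.1 p.2.1 p.2.2) fun p => c n p.1 p.2)) :
    ∃ next : Set (Fn (Idx B) X) → ℕ → (ℕ → Bool → ℕ → N) → ℕ → Bool → ℕ → N,
      ∀ G n g, Approx L S c n g → (∀ m < n, next G n g m = g m) ∧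
        Approx L S c (n + 1) (next G n g) ∧
        (G.Countable → Indist L D f G (next G n g n false) (next G n g n true)) := by
  have h : ∀ (G : Set (Fn (Idx B) X)) n g, ∃ g', Approx L S c n g → (∀ m < n, g' m = g m) ∧
      Approx L S c (n + 1) g' ∧ (G.Countable → Indist L D f G (g' n false) (g' n true)) := by
    intro G n g
    by_cases hg : Approx L S c n g
    swap
    · exact ⟨g, fun h => absurd h hg⟩
    by_cases hG : G.Countable
    · have hG' : #G ≤ #B := (le_aleph0_iff_set_countable.2 hG).trans (aleph0_le_mk B)
      obtain ⟨g', h1, h2, h3⟩ := hg.exists_next hSm hS hd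
        (Z := L.Formula (Option ℕ) × hullS L D G Set.univ)
        ((power_le_power_left two_ne_zero (mk_formula_prod_hullS_le D hG')).trans_lt hV)
        fun p => {z | z.1.Realize (pointed
          (z.2 : UProd (iterU D (Idx B)) fun _ => X)
          fun i => diagEmb (L := L) (iterU D (Idx B)) X (f (p i)))}
      exact ⟨g', fun _ => ⟨h1, h2, fun _ φ m hm => Set.ext_iff.1 h3 (φ, ⟨m, hm⟩)⟩⟩
    · obtain ⟨g', h1, h2, -⟩ := hg.exists_next hSm hS hd (Z := PUnit)
        ((power_le_power_left two_ne_zero (by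
          rw [mk_punit]
          exact one_le_aleph0.trans (le_max_of_le_right (aleph0_le_mk B)))).trans_lt hV)
        fun _ => ∅
      exact ⟨g', fun _ => ⟨h1, h2, fun h => absurd h hG⟩⟩
  choose next hnext using h
  exact ⟨next, hnext⟩

end Next

section StronglySplitting

variable {B : Type u} [LinearOrder B] {L : FirstOrder.Language.{u, u}}
  {X : Type u} [L.Structure X] [Nonempty X] (D : Ultrafilter X)

theorem exists_stages_indist (hB : ℵ₀ < #B) {N : Type u} [L.Structure N] [Nonempty N]
    (f : N ↪ₑ[L] X) (hf : RealizesOver L (Set.range f) Set.univ PUnit.{u + 1}) {S : ℕ → Set N}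
    (hSm : ∀ n, S n ⊆ S (n + 1)) {V : Type u} [LinearOrder V]
    (hV : (2 : Cardinal.{u}) ^ max (max L.card ℵ₀) #B < #V)
    (hS : ∀ n, RealizesOver L (S n) (S (n + 1)) (V × ULift.{u} ℕ)) {a : N}
    {c : ℕ → Bool → ℕ → N} {φ : ℕ → L.Formula (Option ℕ)}
    (hφ : ∀ n, ¬ ((φ n).Realize (pointed a (c n false)) ↔ (φ n).Realize (pointed a (c n true))))
    (hd : ∀ n, ∃ d : ℕ → ℕ → N, ∀ i j, i < j →
      ∀ ψ : L.Formula ((Fin n × Bool × ℕ) ⊕ (Bool × ℕ)),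
      ψ.Realize (Sum.elim (fun p => c p.1 p.2.1 p.2.2) fun p => cond p.1 (d j) (d i) p.2) ↔
        ψ.Realize (Sum.elim (fun p => c p.1 p.2.1 p.2.2) fun p => c n p.1 p.2))
    {Ω : Type u} [LinearOrder Ω] [WellFoundedLT Ω] (hΩ : ∀ α : Ω, (Set.Iio α).Countable)
    (j₀ : Idx B) :
    ∃ G : Ω → Set (Fn (Idx B) X), Monotone G ∧ (∀ α, (G α).Countable) ∧
      (∀ α, Fn.proj j₀ ∈ G α) ∧
      (∀ δ, (∃ β, β < δ) → (∀ β < δ, ∃ γ < δ, β < γ) → ∀ x ∈ G δ, ∃ β < δ, x ∈ G β) ∧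
      (∀ (k : ℕ) (r : ℕ) (β α : Ω), β < α → (∃ Y, TVSol L D (G β) (Fin k) r Y) →
        ∃ Y ∈ G α, TVSol L D (G β) (Fin k) r Y) ∧
      ∀ δ, (∃ β, β < δ) → ∃ x : X, (∀ α, δ < α → Fn.const x ∈ G α) ∧
        ∀ β < δ, ∃ (ψ : L.Formula (Option ℕ)) (g : Bool → ℕ → N),
          (∀ b i, Fn.const (f (g b i)) ∈ G δ) ∧
          ¬ (ψ.Realize (pointed x fun i => f (g false i)) ↔
            ψ.Realize (pointed x fun i => f (g true i))) ∧
          Indist L D f (G β) (g false) (g true) := by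
  classical
  have : Infinite B := infinite_iff.2 hB.le
  obtain ⟨e, he, he'⟩ := exists_enumeration hΩ
  obtain ⟨next, hnext⟩ := exists_next_indist D f hSm hV hS hd
  let g₀ : ℕ → Bool → ℕ → N := c
  have hg₀ : Approx L S c 0 g₀ := ⟨fun _ => Iff.rfl, fun m hm => absurd hm (Nat.not_lt_zero m)⟩
  let sol : Set (Fn (Idx B) X) → ℕ × ℕ → Fn (Idx B) X := fun G p =>
    if h : ∃ Y, TVSol L D G (Fin p.1) p.2 Y then h.choose else Fn.proj j₀
  let tv : Set (Fn (Idx B) X) → Set (Fn (Idx B) X) := fun G => Set.range (sol G)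
  let cst : (ℕ → Bool → ℕ → N) → Set (Fn (Idx B) X) := fun g =>
    Set.range fun p : ℕ × Bool × ℕ => Fn.const (f (g p.1 p.2.1 p.2.2))
  have hpick : ∀ g : ℕ → Bool → ℕ → N, ∃ x : X, (∀ n, SameType L n g c) →
      ∀ (n : ℕ) (b : Bool) (φ : L.Formula (Option ℕ)),
        φ.Realize (pointed x fun i => f (g n b i)) ↔ φ.Realize (pointed a (c n b)) := by
    intro g
    by_cases hg : ∀ n, SameType L n g c
    · obtain ⟨x, hx⟩ := exists_realize_branch f hf hg a
      exact ⟨x, fun _ => hx⟩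
    · exact ⟨Classical.arbitrary X, fun h => absurd h hg⟩
  choose pick hpick using hpick
  obtain ⟨G, hG⟩ := exists_stages next g₀ tv cst
    (fun g => Fn.const (pick fun m => g m m)) e he (Fn.proj j₀)
  have hGc : ∀ α, (G α).Countable :=
    countable_stage hG hΩ (fun _ => Set.countable_range _) fun _ => Set.countable_range _
  refine ⟨G, stage_monotone hG, hGc, mem_stage hG, fun δ h1 h2 x hx =>
    exists_mem_stage hG h1 h2 hx, fun k r β α hβα hY => ?_, fun δ hδ => ?_⟩
  · refine ⟨_, tv_subset_stage hG hβα ⟨(k, r), rfl⟩, ?_⟩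
    have : sol (G β) (k, r) = hY.choose := dif_pos hY
    rw [this]
    exact hY.choose_spec
  · obtain ⟨he1, he2⟩ := he' δ hδ
    obtain ⟨hn1, hn2⟩ := node_properties (next := next)
      (R := fun G p q => G.Countable → Indist L D f G p q) hnext hg₀ G (e δ)
    have hx := hpick _ fun n => (hn1 n).1
    refine ⟨_, fun α hα => top_mem_stage hG hα, fun β hβ => ?_⟩
    obtain ⟨n, rfl⟩ := he2 β hβ
    refine ⟨φ n, node next g₀ G (initial (e δ) (n + 1)) n, fun b i => ?_, ?_, hn2 n (hGc _)⟩
    · refine cst_subset_stage hG (l := initial (e δ) (n + 1)) (fun β hβ => ?_) ⟨(n, b, i), rfl⟩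
      obtain ⟨k, rfl⟩ := exists_of_mem_initial hβ
      exact he1 k
    · rw [hx n false (φ n), hx n true (φ n)]
      exact hφ n

/-- If hulls of the cardinality of `B` are unique up to isomorphism, the structure has no
strongly splitting sequence. -/
theorem false_of_hullS_unique [WellFoundedLT B] [OrderTop B] (hB : ℵ₀ < #B)
    {N : Type u} [L.Structure N] [Nonempty N]
    (f : N ↪ₑ[L] X) (hf : RealizesOver L (Set.range f) Set.univ PUnit.{u + 1}) {S : ℕ → Set N}
    (hSm : ∀ n, S n ⊆ S (n + 1)) {V : Type u} [LinearOrder V]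
    (hV : (2 : Cardinal.{u}) ^ max (max L.card ℵ₀) #B < #V)
    (hS : ∀ n, RealizesOver L (S n) (S (n + 1)) (V × ULift.{u} ℕ)) {a : N}
    {c : ℕ → Bool → ℕ → N} {φ : ℕ → L.Formula (Option ℕ)}
    (hφ : ∀ n, ¬ ((φ n).Realize (pointed a (c n false)) ↔ (φ n).Realize (pointed a (c n true))))
    (hd : ∀ n, ∃ d : ℕ → ℕ → N, ∀ i j, i < j →
      ∀ ψ : L.Formula ((Fin n × Bool × ℕ) ⊕ (Bool × ℕ)),
      ψ.Realize (Sum.elim (fun p => c p.1 p.2.1 p.2.2) fun p => cond p.1 (d j) (d i) p.2) ↔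
        ψ.Realize (Sum.elim (fun p => c p.1 p.2.1 p.2.2) fun p => c n p.1 p.2))
    (j₀ : Idx B)
    (hiso : ∀ G G₀ : Set (Fn (Idx B) X), #G ≤ #B → #G₀ ≤ #B → Fn.proj j₀ ∈ G → Fn.proj j₀ ∈ G₀ →
      Nonempty (hullS L D G Set.univ ≃[L] hullS L D G₀ Set.univ)) : False := by
  obtain ⟨Ω, _, _, _, hΩ1, hΩ2, hΩ3⟩ := exists_wellOrder_aleph_one.{u}
  obtain ⟨G, hGm, hGc, hj₀, hGlim, htv, htop⟩ :=
    exists_stages_indist D hB f hf hSm hV hS hφ hd hΩ2 j₀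
  have hcard : #(⋃ α, G α : Set (Fn (Idx B) X)) ≤ #B := by
    refine (mk_iUnion_le _).trans (mul_le_of_le hB.le ?_ ?_)
    · rw [hΩ1, ← succ_aleph0]
      exact Order.succ_le_of_lt hB
    · exact ciSup_le' fun α => (le_aleph0_iff_set_countable.2 (hGc α)).trans hB.le
  have hG₀ : ({Fn.proj j₀} : Set (Fn (Idx B) X)).Countable := Set.countable_singleton _
  obtain ⟨h⟩ := hiso _ {Fn.proj j₀} hcard ((le_aleph0_iff_set_countable.2 hG₀).trans hB.le)
    (Set.mem_iUnion.2 ⟨Classical.arbitrary Ω, hj₀ _⟩) rfl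
  have hcl := exists_closedAt hGm hGc hGlim hΩ3 hG₀ h
  have hel : ∀ k r, ¬ TVFail L D (⋃ α, G α) (Fin k) r := by
    intro k r
    refine not_tvFail_iUnion hGm (fun δ r hY => ?_) h (fun γ => ?_) r
    · obtain ⟨α, hα⟩ := hΩ3 {δ} (Set.countable_singleton δ)
      obtain ⟨Y, hY1, hY2⟩ := htv k r δ α (hα δ rfl) hY
      exact ⟨Y, Set.mem_iUnion.2 ⟨α, hY1⟩, hY2⟩
    · obtain ⟨δ, C, h1, h2, -, h3, -⟩ := hcl γ ⊤
      exact ⟨δ, C, h1, ⟨⊤, h2⟩, h3⟩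
  obtain ⟨δ, C, h1, h2, -, h3, h4⟩ := hcl (Classical.arbitrary Ω) ⊤
  obtain ⟨x, hx1, hx2⟩ := htop δ ⟨_, h1⟩
  obtain ⟨α, hα⟩ := hΩ3 {δ} (Set.countable_singleton δ)
  refine h3.false_of_indist h2 h4 hel (Set.mem_iUnion.2 ⟨α, hx1 α (hα δ rfl)⟩) fun β hβ => ?_
  obtain ⟨ψ, g, hg1, hg2, hg3⟩ := hx2 β hβ
  exact ⟨ψ, fun b i => f (g b i), hg1, hg2, hg3 ψ⟩

theorem not_hasSS_of_kUnique {T : L.Theory} (hT : IsUniversalTheory T) {κ : Cardinal.{u}}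
    (hκ : ℵ₀ < κ) (hTκ : KUnique T κ) {M : Type u} [L.Structure M] [Infinite M] (hM : M ⊨ T) :
    ¬ HasSS L M := by
  intro hSS
  have := isUniversal_of_isUniversalTheory hT
  obtain ⟨B, _, _, _, rfl⟩ : ∃ (B : Type u) (_ : LinearOrder B) (_ : WellFoundedLT B)
      (_ : OrderTop B), #B = κ := by
    refine ⟨WithTop κ.ord.ToType, inferInstance, inferInstance, inferInstance, ?_⟩
    have : #(WithTop κ.ord.ToType) = #(Option κ.ord.ToType) := rfl
    rw [this, mk_option, mk_ord_toType, add_one_eq hκ.le]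
  have : Infinite B := infinite_iff.2 hκ.le
  let V : Type u := (Order.succ ((2 : Cardinal.{u}) ^ max (max L.card ℵ₀) #B)).ord.ToType
  have hV : (2 : Cardinal.{u}) ^ max (max L.card ℵ₀) #B < #V := by
    rw [mk_ord_toType]
    exact Order.lt_succ _
  obtain ⟨N, _, i, S, hSm, -, hS⟩ := exists_chain (L := L) M (V × ULift.{u} ℕ)
  have : Nonempty N := Nonempty.map i inferInstance
  obtain ⟨a, c, φ, hφ, hd⟩ := hSS.map i
  obtain ⟨X, _, f, hf⟩ := exists_realizesOver_range (L := L) N PUnit.{u + 1}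
  have : Nonempty X := Nonempty.map f inferInstance
  have : Infinite X := Infinite.of_injective (f ∘ i) (f.injective.comp i.injective)
  have hX : X ⊨ T := ((f.comp i).elementarilyEquivalent).theory_model_iff.1 hM
  let D : Ultrafilter X := Filter.hyperfilter X
  have hD : ∀ x, ∀ᶠ y in (D : Filter X), y ≠ x := fun x =>
    Filter.hyperfilter_le_cofinite (Set.finite_singleton x).compl_mem_cofinite
  have hU : UProd (iterU D (Idx B)) (fun _ => X) ⊨ T :=
    (diagEmb (L := L) (iterU D (Idx B)) X).elementarilyEquivalent.theory_model_iff.1 hX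
  let j₀ : Idx B := idx ⊤ 0
  refine false_of_hullS_unique D hκ f hf (S := fun n => (S n : Set N))
    hSm hV hS hφ hd j₀ fun G G₀ h1 h2 h3 h4 => ?_
  refine hTκ.2 _ _ _ _ (Substructure.models_of_isUniversal _ _)
    (Substructure.models_of_isUniversal _ _) ?_ ?_
  · exact strictlyGenerated_hullS D hD hκ h1 h3
  · exact strictlyGenerated_hullS D hD hκ h2 h4

end StronglySplitting

/-- If a universal theory `T` is `κ`-unique for some uncountable `κ`, then the theory of the
infinite models of `T` is superstable: for every `lam ≥ 2 ^ max(|L|, ℵ₀)`, every infinite model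
`M` of `T`, and every `A ⊆ M` with `#A ≤ lam`, there are at most `lam` complete 1-types
over `A`. -/
theorem stmt2 {L : FirstOrder.Language.{u, u}} (T : L.Theory)
    (hTuniv : IsUniversalTheory T)
    (κ : Cardinal.{u}) (hκ : ℵ₀ < κ) (hTκ : KUnique T κ) :
    ∀ lam : Cardinal.{u}, (2 : Cardinal.{u}) ^ max L.card ℵ₀ ≤ lam →
      ∀ (M : Type u) (_ : L.Structure M), M ⊨ T → Infinite M →
        ∀ A : Set M, #A ≤ lam →
          #{p : Set (L.Formula (↥A ⊕ Fin 1)) // IsCompleteTypeOver A p} ≤ lam := by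
  intro lam hlam M _ hM _ A hA
  by_contra hcon
  obtain ⟨N, _, ⟨f⟩, hN⟩ := exists_hasSS M A lam hlam hA (not_le.1 hcon)
  have : Infinite N := Infinite.of_injective f f.injective
  exact not_hasSS_of_kUnique hTuniv hκ hTκ (f.elementarilyEquivalent.theory_model_iff.1 hM) hN
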